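/- Let (𝒫, 𝒩) be a Beurling generalized number system whose integers are θ-well-behaved for some θ ∈ [0,1), and suppose that for some real k ≥ 1 there is c_k with (1/T) ∫_0^T |ζ_𝒫((1+θ)/2 + it)|^{2k} dt ≪_k (log T)^{c_k} and (1/T) ∫_0^T |ζ'_𝒫((1+θ)/2 + it)|^{2k} dt ≪_k (log T)^{c_k} for T ≥ 2. Then there is a constant c (depending on k and the system) such that uniformly for α ≥ (1+θ)/2 and T ≥ 2, N(ζ_𝒫; α, T) ≪_k T^{2(k+1)(1−α)/(2(1−α)+k(1−θ))} (log T)^c, and uniformly for α ≥ (3k−1+(k−1)θ)/(4k−2) and T ≥ 2, N(ζ_𝒫; α, T) ≪_k T^{4(3α−2−θ)(1−α)/(k(2α−1−θ)(4α−3−θ)+4(3α−2−θ)(1−α))} (log T)^c. Moreover, if 2k is an integer the hypothesis on ζ'_𝒫 may be omitted. -/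

import Mathlib

open Filter Asymptotics

/-- A Beurling generalized number system: a nondecreasing sequence of generalized
primes `p` with `1 < p 0` tending to infinity, together with the nondecreasing
enumeration `n` (with multiplicity) of all finite products of the generalized primes,
witnessed by the bijection `equiv` from exponent vectors to indices. -/
structure BeurlingSystem where
  p : ℕ → ℝ
  n : ℕ → ℝ
  one_lt_p : 1 < p 0
  mono_p : Monotone p
  tendsto_p : Tendsto p atTop atTop
  mono_n : Monotone n
  equiv : (ℕ →₀ ℕ) ≃ ℕ
  n_eq : ∀ k : ℕ →₀ ℕ, n (equiv k) = ∏ j ∈ k.support, p j ^ k j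

/-- The integer counting function `N_𝒫(x)`. -/
noncomputable def BeurlingSystem.Nint (S : BeurlingSystem) (x : ℝ) : ℕ :=
  {j : ℕ | S.n j ≤ x}.ncard

/-- `Z` is an analytic continuation of the Beurling zeta function of the system `S`
to the half-plane `Re s > θ`, with density `A`: it agrees with the Dirichlet series
on `Re s > 1` and `Z s - A/(s-1)` is analytic on `Re s > θ`. -/
def BeurlingSystem.IsZeta (S : BeurlingSystem) (θ A : ℝ) (Z : ℂ → ℂ) : Prop :=
  (∀ s : ℂ, 1 < s.re → Z s = ∑' j : ℕ, (S.n j : ℂ) ^ (-s)) ∧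
    DifferentiableOn ℂ (fun s => Z s - (A : ℂ) / (s - 1)) {s : ℂ | θ < s.re}

/-- The number of zeros (without multiplicity) of `Z` with `α ≤ Re ρ` and `|Im ρ| ≤ T`. -/
noncomputable def zeroCount (Z : ℂ → ℂ) (α T : ℝ) : ℕ :=
  {ρ : ℂ | Z ρ = 0 ∧ α ≤ ρ.re ∧ |ρ.im| ≤ T}.ncard

namespace BeurlingSystem

open Finset

variable {S : BeurlingSystem} {θ A : ℝ} {Z : ℂ → ℂ}

/-- The hypotheses on the number system and its zeta function, bundled. -/
structure WellBehaved (S : BeurlingSystem) (θ A : ℝ) (Z : ℂ → ℂ) : Prop where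
  nonneg : 0 ≤ θ
  lt_one : θ < 1
  density_pos : 0 < A
  count : (fun x : ℝ => (S.Nint x : ℝ) - A * x) =O[atTop] fun x : ℝ => x ^ θ
  zeta : S.IsZeta θ A Z

/-- The generalized integer with a given exponent vector. -/
noncomputable def val (S : BeurlingSystem) (m : ℕ →₀ ℕ) : ℝ := S.n (S.equiv m)

lemma one_lt_prime (S : BeurlingSystem) (j : ℕ) : 1 < S.p j :=
  S.one_lt_p.trans_le (S.mono_p (Nat.zero_le j))

lemma val_eq_prod (S : BeurlingSystem) (m : ℕ →₀ ℕ) :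
    S.val m = m.prod fun j e => S.p j ^ e := S.n_eq m

@[simp] lemma val_zero (S : BeurlingSystem) : S.val 0 = 1 := by simp [val_eq_prod]

lemma val_add (S : BeurlingSystem) (x y : ℕ →₀ ℕ) : S.val (x + y) = S.val x * S.val y := by
  simp only [val_eq_prod]
  exact Finsupp.prod_add_index' (by simp) (by intro a b c; rw [pow_add])

lemma one_le_val (S : BeurlingSystem) (m : ℕ →₀ ℕ) : 1 ≤ S.val m := by
  rw [val_eq_prod, Finsupp.prod]
  exact Finset.prod_induction _ (fun x : ℝ => 1 ≤ x) (fun _ _ => one_le_mul_of_one_le_of_one_le) le_rfl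
    fun j _ => one_le_pow₀ (S.one_lt_prime j).le

lemma val_pos (S : BeurlingSystem) (m : ℕ →₀ ℕ) : 0 < S.val m :=
  zero_lt_one.trans_le (S.one_le_val m)

lemma one_le_n (S : BeurlingSystem) (j : ℕ) : 1 ≤ S.n j := by
  simpa [val] using S.one_le_val (S.equiv.symm j)

lemma n_pos (S : BeurlingSystem) (j : ℕ) : 0 < S.n j := zero_lt_one.trans_le (S.one_le_n j)

lemma exists_count_bound (h : S.WellBehaved θ A Z) :
    ∃ C : ℝ, 0 < C ∧ ∃ x₀ : ℝ, 1 ≤ x₀ ∧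
      ∀ x, x₀ ≤ x → |(S.Nint x : ℝ) - A * x| ≤ C * x ^ θ := by
  obtain ⟨C, hC, hb⟩ := h.count.exists_pos
  rw [IsBigOWith] at hb
  obtain ⟨x₀, hx₀⟩ := eventually_atTop.1 hb
  refine ⟨C, hC, max x₀ 1, le_max_right _ _, fun x hx => ?_⟩
  have := hx₀ x ((le_max_left _ _).trans hx)
  have hx1 : (0:ℝ) < x := by linarith [le_max_right x₀ 1]
  rwa [Real.norm_eq_abs, Real.norm_eq_abs, abs_of_pos (Real.rpow_pos_of_pos hx1 _)] at this

lemma finite_n_le (h : S.WellBehaved θ A Z) (x : ℝ) : {j : ℕ | S.n j ≤ x}.Finite := by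
  obtain ⟨C, hC, x₀, hx₀, hb⟩ := exists_count_bound h
  have hlim : Tendsto (fun x : ℝ => x ^ (1 - θ)) atTop atTop :=
    tendsto_rpow_atTop (by linarith [h.lt_one])
  obtain ⟨y, hy1, hy2, hy3⟩ := ((hlim.eventually_gt_atTop (C / A)).and
    ((eventually_ge_atTop x).and (eventually_ge_atTop x₀))).exists
  have hy0 : 0 < y := by linarith
  have hA := h.density_pos
  have key : C * y ^ θ < A * y := by
    have : y = y ^ (1 - θ) * y ^ θ := by
      rw [← Real.rpow_add hy0]; simp
    rw [div_lt_iff₀ hA] at hy1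
    calc C * y ^ θ < (y ^ (1 - θ) * A) * y ^ θ := by gcongr
      _ = A * (y ^ (1 - θ) * y ^ θ) := by ring
      _ = A * y := by rw [← this]
  have hpos : (0:ℝ) < S.Nint y := by
    have := (abs_le.1 (hb y hy3)).1
    linarith
  have hne : {j : ℕ | S.n j ≤ y}.ncard ≠ 0 := by
    have : 0 < S.Nint y := by exact_mod_cast hpos
    exact this.ne'
  exact (Set.finite_of_ncard_ne_zero hne).subset fun j hj => le_trans hj hy2

lemma Nint_mono (h : S.WellBehaved θ A Z) {x y : ℝ} (hxy : x ≤ y) : S.Nint x ≤ S.Nint y :=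
  Set.ncard_le_ncard (fun _ hj => le_trans hj hxy) (finite_n_le h y)

lemma exists_error_bound (h : S.WellBehaved θ A Z) :
    ∃ C : ℝ, 0 < C ∧ ∀ x, 0 ≤ x → |(S.Nint x : ℝ) - A * x| ≤ C * (1 + x) ^ θ := by
  obtain ⟨C, hC, x₀, hx₀, hb⟩ := exists_count_bound h
  have hA := h.density_pos
  refine ⟨C + S.Nint x₀ + A * x₀, by positivity, fun x hx => ?_⟩
  have h1 : (1:ℝ) ≤ (1 + x) ^ θ := Real.one_le_rpow (by linarith) h.nonneg
  rcases le_total x₀ x with hx0 | hx0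
  · calc _ ≤ C * x ^ θ := hb x hx0
      _ ≤ C * (1 + x) ^ θ := by
        gcongr
        · exact h.nonneg
        · linarith
      _ ≤ _ := by
        gcongr
        have : 0 ≤ A * x₀ := by positivity
        have : (0:ℝ) ≤ S.Nint x₀ := by positivity
        linarith
  · have h2 : (S.Nint x : ℝ) ≤ S.Nint x₀ := by exact_mod_cast Nint_mono h hx0
    have h3 : A * x ≤ A * x₀ := by gcongr
    have h4 : 0 ≤ A * x := by positivity
    have h5 : (0:ℝ) ≤ S.Nint x := by positivity
    calc _ ≤ C + S.Nint x₀ + A * x₀ := by rw [abs_le]; constructor <;> linarith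
      _ = (C + S.Nint x₀ + A * x₀) * 1 := by ring
      _ ≤ _ := by gcongr

lemma exists_n_lower (h : S.WellBehaved θ A Z) :
    ∃ K : ℝ, 1 ≤ K ∧ ∀ j : ℕ, (j + 1 : ℝ) ≤ K * S.n j := by
  obtain ⟨C, hC, hb⟩ := exists_error_bound h
  have hA := h.density_pos
  refine ⟨1 + A + 2 * C, by linarith, fun j => ?_⟩
  have h1 := S.one_le_n j
  have h2 : ((j + 1 : ℕ) : ℝ) ≤ S.Nint (S.n j) := by
    have : ((Finset.range (j + 1) : Finset ℕ) : Set ℕ).ncard ≤ {i : ℕ | S.n i ≤ S.n j}.ncard := by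
      apply Set.ncard_le_ncard _ (finite_n_le h _)
      intro i hi
      simp only [coe_range, Set.mem_Iio] at hi
      exact S.mono_n (by omega)
    rw [Set.ncard_coe_finset, Finset.card_range] at this
    exact_mod_cast this
  have h3 := (abs_le.1 (hb (S.n j) (by linarith))).2
  have h4 : (1 + S.n j) ^ θ ≤ 2 * S.n j := by
    calc (1 + S.n j) ^ θ ≤ (1 + S.n j) ^ (1:ℝ) :=
          Real.rpow_le_rpow_of_exponent_le (by linarith) h.lt_one.le
      _ ≤ 2 * S.n j := by rw [Real.rpow_one]; linarith
  have h5 : C * (1 + S.n j) ^ θ ≤ C * (2 * S.n j) := by gcongr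
  push_cast at h2
  nlinarith

lemma n_rpow_neg_le {K : ℝ} (hK : ∀ j : ℕ, (j + 1 : ℝ) ≤ K * S.n j) {σ : ℝ}
    (hσ : 0 ≤ σ) (hK1 : 1 ≤ K) (j : ℕ) : S.n j ^ (-σ) ≤ K ^ σ * (1 / (j + 1 : ℝ) ^ σ) := by
  have hj : (0:ℝ) < j + 1 := by positivity
  have hn := S.n_pos j
  rw [Real.rpow_neg hn.le, ← one_div, mul_one_div, div_le_div_iff₀ (by positivity) (by positivity),
    one_mul, ← Real.mul_rpow (by linarith) hn.le]
  exact Real.rpow_le_rpow hj.le (hK j) hσ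

lemma summable_n_rpow (h : S.WellBehaved θ A Z) {σ : ℝ} (hσ : 1 < σ) :
    Summable fun j : ℕ => S.n j ^ (-σ) := by
  obtain ⟨K, hK1, hK⟩ := exists_n_lower h
  refine Summable.of_nonneg_of_le (fun j => Real.rpow_nonneg (S.n_pos j).le _)
    (fun j => n_rpow_neg_le hK (by linarith) hK1 j) ?_
  apply Summable.mul_left
  have := (Real.summable_one_div_nat_rpow (p := σ)).2 hσ
  simpa using (summable_nat_add_iff 1).2 this

lemma summable_val_rpow (h : S.WellBehaved θ A Z) {σ : ℝ} (hσ : 1 < σ) :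
    Summable fun m => S.val m ^ (-σ) :=
  (S.equiv.summable_iff (f := fun j => S.n j ^ (-σ))).2 (summable_n_rpow h hσ)

lemma norm_val_cpow (S : BeurlingSystem) (m : ℕ →₀ ℕ) (s : ℂ) :
    ‖(S.val m : ℂ) ^ s‖ = S.val m ^ s.re :=
  Complex.norm_cpow_eq_rpow_re_of_pos (S.val_pos m) s

lemma summable_val_cpow (h : S.WellBehaved θ A Z) {s : ℂ} (hs : 1 < s.re) :
    Summable fun m => ‖(S.val m : ℂ) ^ (-s)‖ := by
  simpa [norm_val_cpow] using summable_val_rpow h hs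

lemma zeta_eq_tsum (h : S.WellBehaved θ A Z) {s : ℂ} (hs : 1 < s.re) :
    Z s = ∑' m, (S.val m : ℂ) ^ (-s) := by
  rw [h.zeta.1 s hs, ← S.equiv.tsum_eq]
  rfl

lemma val_add_cpow (S : BeurlingSystem) (x y : ℕ →₀ ℕ) (s : ℂ) :
    (S.val (x + y) : ℂ) ^ s = (S.val x : ℂ) ^ s * (S.val y : ℂ) ^ s := by
  rw [val_add, Complex.ofReal_mul, Complex.mul_cpow_ofReal_nonneg (S.val_pos x).le (S.val_pos y).le]

lemma finite_val_le (h : S.WellBehaved θ A Z) (x : ℝ) : {m | S.val m ≤ x}.Finite :=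
  (finite_n_le h x).preimage S.equiv.injective.injOn

lemma ncard_val_le (S : BeurlingSystem) (x : ℝ) : {m | S.val m ≤ x}.ncard = S.Nint x := by
  rw [Nint, ← Set.ncard_image_of_injective _ S.equiv.injective]
  congr 1
  ext j
  constructor
  · rintro ⟨m, hm, rfl⟩; exact hm
  · intro hj
    exact ⟨S.equiv.symm j, by simpa [val] using hj, by simp⟩

lemma ofReal_zeta (h : S.WellBehaved θ A Z) {σ : ℝ} (hσ : 1 < σ) :
    Z σ = ((∑' m, S.val m ^ (-σ) : ℝ) : ℂ) := by
  rw [zeta_eq_tsum h (by simpa using hσ), Complex.ofReal_tsum]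
  congr 1; ext m
  rw [Complex.ofReal_cpow (S.val_pos m).le]; simp

/-- The zeta sum is `O(1 / (σ - 1))` to the right of `1`. -/
lemma exists_tsum_val_le (h : S.WellBehaved θ A Z) :
    ∃ C : ℝ, 1 ≤ C ∧ ∀ σ : ℝ, 1 < σ → σ ≤ 2 → ∑' m, S.val m ^ (-σ) ≤ C / (σ - 1) := by
  have hcont : ContinuousOn (fun σ : ℝ => ‖Z σ - (A : ℂ) / ((σ : ℂ) - 1)‖) (Set.Icc 1 2) := by
    apply ContinuousOn.norm
    refine (h.zeta.2.continuousOn).comp (f := fun σ : ℝ => (σ : ℂ))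
      Complex.continuous_ofReal.continuousOn ?_
    intro σ hσ
    simp only [Set.mem_ofPred_eq, Complex.ofReal_re]
    linarith [hσ.1, h.lt_one]
  obtain ⟨B, hB⟩ := isCompact_Icc.exists_bound_of_continuousOn hcont
  have hA := h.density_pos
  have hB0 : 0 ≤ B := le_trans (norm_nonneg _) (hB 1 (by simp))
  refine ⟨1 + A + B, by linarith, fun σ h1 h2 => ?_⟩
  have h3 := hB σ ⟨h1.le, h2⟩
  rw [norm_norm] at h3
  have h4 : 0 < σ - 1 := by linarith
  have h5 : ‖(A : ℂ) / ((σ : ℂ) - 1)‖ = A / (σ - 1) := by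
    rw [norm_div, Complex.norm_real, Real.norm_of_nonneg hA.le]
    congr 1
    rw [← Complex.ofReal_one, ← Complex.ofReal_sub, Complex.norm_real, Real.norm_of_nonneg h4.le]
  have h6 : ∑' m, S.val m ^ (-σ) ≤ ‖Z σ‖ := by
    rw [ofReal_zeta h h1, Complex.norm_real]; exact le_abs_self _
  have h7 : ‖Z σ‖ ≤ B + A / (σ - 1) := by
    have := norm_add_le (Z σ - (A : ℂ) / ((σ : ℂ) - 1)) ((A : ℂ) / ((σ : ℂ) - 1))
    rw [sub_add_cancel, h5] at this
    linarith
  have h8 : B ≤ B / (σ - 1) := by rw [le_div_iff₀ h4]; nlinarith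
  have h9 : 0 ≤ 1 / (σ - 1) := by positivity
  calc _ ≤ B + A / (σ - 1) := h6.trans h7
    _ ≤ 1 / (σ - 1) + A / (σ - 1) + B / (σ - 1) := by linarith
    _ = _ := by ring

/-- The number of divisors. -/
noncomputable def dcount (m : ℕ →₀ ℕ) : ℝ := (antidiagonal m).card

/-- The Möbius function. -/
noncomputable def mob (m : ℕ →₀ ℕ) : ℝ :=
  if ∀ j ∈ m.support, m j = 1 then (-1) ^ m.support.card else 0

/-- The coefficients of the product of the zeta function with the Möbius partial sum of
length `X`. -/
noncomputable def mollified (S : BeurlingSystem) (X : ℝ) (m : ℕ →₀ ℕ) : ℝ :=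
  ∑ p ∈ antidiagonal m, if S.val p.2 ≤ X then mob p.2 else 0

open Classical in
/-- The finite set of generalized integers in `(x, y]`. -/
noncomputable def block (S : BeurlingSystem) (x y : ℝ) : Finset (ℕ →₀ ℕ) :=
  if h : {m | x < S.val m ∧ S.val m ≤ y}.Finite then h.toFinset else ∅

/-- A generalized Dirichlet polynomial. -/
noncomputable def dpoly (S : BeurlingSystem) (c : (ℕ →₀ ℕ) → ℝ) (F : Finset (ℕ →₀ ℕ)) (s : ℂ) : ℂ :=
  ∑ m ∈ F, (c m : ℂ) * (S.val m : ℂ) ^ (-s)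

lemma mem_block (h : S.WellBehaved θ A Z) {x y : ℝ} {m : ℕ →₀ ℕ} :
    m ∈ S.block x y ↔ x < S.val m ∧ S.val m ≤ y := by
  have : {m | x < S.val m ∧ S.val m ≤ y}.Finite :=
    (finite_val_le h y).subset fun m hm => hm.2
  rw [block, dif_pos this]; simp

lemma abs_mob_le (m : ℕ →₀ ℕ) : |mob m| ≤ 1 := by
  unfold mob; split_ifs <;> simp

@[simp] lemma mob_zero : mob 0 = 1 := by simp [mob]

lemma one_le_dcount (m : ℕ →₀ ℕ) : 1 ≤ dcount m := by
  have : 0 < (antidiagonal m).card := card_pos.2 ⟨(0, m), by simp⟩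
  unfold dcount
  exact_mod_cast this

lemma sum_mob_antidiagonal {m : ℕ →₀ ℕ} (hm : m ≠ 0) :
    ∑ p ∈ antidiagonal m, mob p.2 = 0 := by
  classical
  have hne : m.support.Nonempty := Finsupp.support_nonempty_iff.2 hm
  have h0 : (∑ t ∈ m.support.powerset, (-1 : ℝ) ^ t.card) = 0 := by
    have := Finset.sum_powerset_neg_one_pow_card_of_nonempty hne
    exact_mod_cast this
  rw [← h0]
  simp only [mob]
  rw [← Finset.sum_filter]
  let ind : Finset ℕ → (ℕ →₀ ℕ) := fun t => Finsupp.indicator t fun _ _ => 1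
  have hind : ∀ t j, ind t j = if j ∈ t then 1 else 0 := by
    intro t j; simp [ind, Finsupp.indicator_apply]
  have hsupp : ∀ t, (ind t).support = t := by
    intro t; ext j; simp [hind]
  refine Finset.sum_nbij' (fun p => p.2.support) (fun t => (m - ind t, ind t)) ?_ ?_ ?_ ?_ ?_
  · rintro ⟨a, b⟩ hp
    simp only [mem_filter, HasAntidiagonal.mem_antidiagonal] at hp
    rw [mem_powerset, ← hp.1]
    intro j hj
    simp only [Finsupp.mem_support_iff, Finsupp.add_apply] at hj ⊢
    omega
  · intro t ht
    rw [mem_powerset] at ht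
    simp only [mem_filter, HasAntidiagonal.mem_antidiagonal]
    refine ⟨?_, ?_⟩
    · ext j
      simp only [Finsupp.add_apply, Finsupp.tsub_apply, hind]
      split_ifs with hj
      · have := Finsupp.mem_support_iff.1 (ht hj); omega
      · omega
    · intro j hj; rw [hsupp] at hj; simp [hind, hj]
  · rintro ⟨a, b⟩ hp
    simp only [mem_filter, HasAntidiagonal.mem_antidiagonal] at hp
    have hb : ind b.support = b := by
      ext j
      rw [hind]
      split_ifs with hj
      · exact (hp.2 j hj).symm
      · simpa using (Finsupp.notMem_support_iff.1 hj).symm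
    simp only [hb]
    ext j
    · simp [← hp.1]
    · rfl
  · intro t ht; exact hsupp t
  · intro p hp; rfl

lemma mollified_zero (S : BeurlingSystem) {X : ℝ} (hX : 1 ≤ X) : S.mollified X 0 = 1 := by
  simp [mollified, hX]

lemma mollified_eq_zero {X : ℝ} {m : ℕ →₀ ℕ} (hm : m ≠ 0)
    (hmX : S.val m ≤ X) : S.mollified X m = 0 := by
  rw [← sum_mob_antidiagonal hm, mollified]
  refine sum_congr rfl fun p hp => if_pos ?_
  rw [HasAntidiagonal.mem_antidiagonal] at hp
  refine le_trans ?_ hmX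
  rw [← hp, val_add]
  exact le_mul_of_one_le_left (S.val_pos _).le (S.one_le_val _)

lemma abs_mollified_le (S : BeurlingSystem) (X : ℝ) (m : ℕ →₀ ℕ) : |S.mollified X m| ≤ dcount m := by
  refine (abs_sum_le_sum_abs _ _).trans ?_
  calc _ ≤ ∑ p ∈ antidiagonal m, (1:ℝ) := by
        refine sum_le_sum fun p _ => ?_
        split_ifs
        · exact abs_mob_le _
        · simp
    _ = dcount m := by simp [dcount]

lemma dcount_add_le (x y : ℕ →₀ ℕ) : dcount (x + y) ≤ dcount x * dcount y := by
  classical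
  have : (antidiagonal (x + y)) ⊆
      (antidiagonal x ×ˢ antidiagonal y).image fun q => q.1 + q.2 := by
    rintro ⟨u, v⟩ h
    rw [HasAntidiagonal.mem_antidiagonal] at h
    have h' : ∀ j, u j + v j = x j + y j := fun j => by
      have := DFunLike.congr_fun h j
      simpa using this
    rw [mem_image]
    refine ⟨((u ⊓ x, x - u ⊓ x), (u - u ⊓ x, y - (u - u ⊓ x))), ?_, ?_⟩
    · simp only [mem_product, HasAntidiagonal.mem_antidiagonal]
      constructor
      · ext j; have := h' j; simp
      · ext j; have := h' j; simp; omega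
    · simp only [Prod.mk_add_mk, Prod.mk.injEq]
      constructor
      · ext j; have := h' j; simp
      · ext j; have := h' j; simp; omega
  have h2 := (card_le_card this).trans card_image_le
  rw [card_product] at h2
  unfold dcount
  exact_mod_cast h2

lemma summable_dcount_mul {w : (ℕ →₀ ℕ) → ℝ} (h0 : ∀ m, 0 ≤ w m) (hw : Summable w)
    (hmul : ∀ x y, w (x + y) ≤ w x * w y) :
    Summable (fun m => dcount m * w m) ∧ ∑' m, dcount m * w m ≤ (∑' m, w m) ^ 2 := by
  have hs := summable_mul_of_summable_norm hw.norm hw.norm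
  have hs2 := summable_sum_mul_antidiagonal_of_summable_mul hs
  have hle : ∀ m, dcount m * w m ≤ ∑ kl ∈ antidiagonal m, w kl.1 * w kl.2 := by
    intro m
    calc dcount m * w m = ∑ kl ∈ antidiagonal m, w m := by simp [dcount]
      _ ≤ _ := sum_le_sum fun p hp => by
        rw [HasAntidiagonal.mem_antidiagonal] at hp
        rw [← hp]; exact hmul _ _
  have hsum : Summable (fun m => dcount m * w m) :=
    Summable.of_nonneg_of_le (fun m => mul_nonneg (by linarith [one_le_dcount m]) (h0 m)) hle hs2
  refine ⟨hsum, ?_⟩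
  rw [pow_two, hw.tsum_mul_tsum_eq_tsum_sum_antidiagonal hw hs]
  exact hsum.tsum_le_tsum hle hs2

lemma summable_dcount (h : S.WellBehaved θ A Z) {σ : ℝ} (hσ : 1 < σ) :
    Summable (fun m => dcount m * S.val m ^ (-σ)) := by
  refine (summable_dcount_mul (fun m => Real.rpow_nonneg (S.val_pos m).le _)
    (summable_val_rpow h hσ) fun x y => ?_).1
  rw [val_add, Real.mul_rpow (S.val_pos x).le (S.val_pos y).le]

lemma tsum_dcount_sq_le (h : S.WellBehaved θ A Z) {σ : ℝ} (hσ : 1 < σ) :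
    Summable (fun m => dcount m ^ 2 * S.val m ^ (-σ)) ∧
    ∑' m, dcount m ^ 2 * S.val m ^ (-σ) ≤ (∑' m, S.val m ^ (-σ)) ^ 4 := by
  have hv : ∀ m, 0 ≤ S.val m ^ (-σ) := fun m => Real.rpow_nonneg (S.val_pos m).le _
  have hd : ∀ m, 0 ≤ dcount m := fun m => by linarith [one_le_dcount m]
  have hadd : ∀ x y, S.val (x + y) ^ (-σ) = S.val x ^ (-σ) * S.val y ^ (-σ) := fun x y => by
    rw [val_add, Real.mul_rpow (S.val_pos x).le (S.val_pos y).le]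
  obtain ⟨h1, h2⟩ := summable_dcount_mul hv (summable_val_rpow h hσ) fun x y => (hadd x y).le
  obtain ⟨h3, h4⟩ := summable_dcount_mul (fun m => mul_nonneg (hd m) (hv m)) h1 fun x y => by
    rw [hadd]
    calc _ ≤ (dcount x * dcount y) * (S.val x ^ (-σ) * S.val y ^ (-σ)) := by
          gcongr
          · exact mul_nonneg (hv x) (hv y)
          · exact dcount_add_le x y
      _ = _ := by ring
  have he : (fun m => dcount m * (dcount m * S.val m ^ (-σ))) =
      fun m => dcount m ^ 2 * S.val m ^ (-σ) := by ext m; ring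
  rw [he] at h3 h4
  refine ⟨h3, h4.trans ?_⟩
  have h5 : 0 ≤ ∑' m, dcount m * S.val m ^ (-σ) := tsum_nonneg fun m => mul_nonneg (hd m) (hv m)
  calc _ ≤ ((∑' m, S.val m ^ (-σ)) ^ 2) ^ 2 := by gcongr
    _ = _ := by ring

lemma rpow_one_div_log {T B : ℝ} (hT : 1 < T) : (T ^ B) ^ (1 / Real.log T) = Real.exp B := by
  have h : Real.log T ≠ 0 := (Real.log_pos hT).ne'
  rw [← Real.rpow_mul (by linarith), Real.rpow_def_of_pos (by linarith)]
  congr 1; field_simp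

lemma eventually_log_ge (C : ℝ) : ∀ᶠ T : ℝ in atTop, C ≤ Real.log T :=
  Real.tendsto_log_atTop.eventually_ge_atTop C

/-- Mean square of the divisor function over dyadic blocks. -/
lemma exists_sum_dcount_sq_le (h : S.WellBehaved θ A Z) (B : ℝ) :
    ∀ᶠ T : ℝ in atTop, ∀ N : ℝ, 1 / 2 ≤ N → 2 * N ≤ T ^ B →
      ∑ m ∈ S.block N (2 * N), dcount m ^ 2 ≤ N * Real.log T ^ 5 := by
  obtain ⟨C, hC, hb⟩ := exists_tsum_val_le h
  filter_upwards [eventually_log_ge 1, eventually_log_ge (C ^ 4 * (2 * Real.exp B)),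
    eventually_gt_atTop 1] with T hT1 hT2 hT N hN hNB
  have hℓ : 0 < Real.log T := by linarith
  set ℓ := Real.log T with hℓdef
  have hσ : 1 < 1 + 1 / ℓ := by simp [hℓ]
  have hσ2 : 1 + 1 / ℓ ≤ 2 := by
    have : 1 / ℓ ≤ 1 := by rw [div_le_one hℓ]; exact hT1
    linarith
  obtain ⟨hs1, hs2⟩ := tsum_dcount_sq_le h hσ
  have hz := hb _ hσ hσ2
  have hz' : C / (1 + 1 / ℓ - 1) = C * ℓ := by field_simp; ring
  rw [hz'] at hz
  have hz0 : 0 ≤ ∑' m, S.val m ^ (-(1 + 1 / ℓ)) :=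
    tsum_nonneg fun m => Real.rpow_nonneg (S.val_pos m).le _
  have hN2 : (2 * N) ^ (1 + 1 / ℓ) ≤ 2 * N * Real.exp B := by
    rw [Real.rpow_add (by linarith), Real.rpow_one]
    gcongr
    rw [← rpow_one_div_log (B := B) hT]
    exact Real.rpow_le_rpow (by linarith) hNB (by positivity)
  calc ∑ m ∈ S.block N (2 * N), dcount m ^ 2
      ≤ ∑ m ∈ S.block N (2 * N), (dcount m ^ 2 * S.val m ^ (-(1 + 1 / ℓ))) * (2 * N) ^ (1 + 1 / ℓ) := by
        refine sum_le_sum fun m hm => ?_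
        rw [mem_block h] at hm
        rw [mul_assoc]
        refine le_mul_of_one_le_right (sq_nonneg _) ?_
        rw [Real.rpow_neg (S.val_pos m).le, ← div_eq_inv_mul,
          one_le_div (Real.rpow_pos_of_pos (S.val_pos m) _)]
        exact Real.rpow_le_rpow (S.val_pos m).le hm.2 (by positivity)
    _ = (∑ m ∈ S.block N (2 * N), dcount m ^ 2 * S.val m ^ (-(1 + 1 / ℓ))) * (2 * N) ^ (1 + 1 / ℓ) := by
        rw [sum_mul]
    _ ≤ (C * ℓ) ^ 4 * (2 * N * Real.exp B) := by
        gcongr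
        refine (hs1.sum_le_tsum _ fun m _ => ?_).trans (hs2.trans ?_)
        · exact mul_nonneg (sq_nonneg _) (Real.rpow_nonneg (S.val_pos m).le _)
        · gcongr
    _ = N * (ℓ ^ 4 * (C ^ 4 * (2 * Real.exp B))) := by ring
    _ ≤ N * (ℓ ^ 4 * ℓ) := by gcongr
    _ = _ := by ring

lemma summable_mollified (h : S.WellBehaved θ A Z) (X : ℝ) {s : ℂ} (hs : 1 < s.re) :
    Summable fun m => ‖(S.mollified X m : ℂ) * (S.val m : ℂ) ^ (-s)‖ := by
  refine Summable.of_nonneg_of_le (fun _ => norm_nonneg _) (fun m => ?_) (summable_dcount h hs)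
  rw [norm_mul, norm_val_cpow, Complex.norm_real, Complex.neg_re]
  exact mul_le_mul_of_nonneg_right (abs_mollified_le S X m) (Real.rpow_nonneg (S.val_pos m).le _)

lemma tsum_mul_tsum_antidiagonal {f g : (ℕ →₀ ℕ) → ℂ} (hf : Summable fun m => ‖f m‖)
    (hg : Summable fun m => ‖g m‖) :
    (∑' m, f m) * ∑' m, g m = ∑' m, ∑ p ∈ antidiagonal m, f p.1 * g p.2 :=
  hf.of_norm.tsum_mul_tsum_eq_tsum_sum_antidiagonal hg.of_norm (summable_mul_of_summable_norm hf hg)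

/-- Multiplication of the zeta function by a Dirichlet series. -/
lemma zeta_mul_tsum (h : S.WellBehaved θ A Z) {s : ℂ} (hs : 1 < s.re) {a : (ℕ →₀ ℕ) → ℝ}
    (ha : ∀ m, |a m| ≤ 1) :
    Z s * ∑' m, (a m : ℂ) * (S.val m : ℂ) ^ (-s) =
      ∑' m, ((∑ p ∈ antidiagonal m, a p.2 : ℝ) : ℂ) * (S.val m : ℂ) ^ (-s) := by
  have h1 := summable_val_cpow h hs
  have h2 : Summable fun m => ‖(a m : ℂ) * (S.val m : ℂ) ^ (-s)‖ := by
    refine Summable.of_nonneg_of_le (fun _ => norm_nonneg _) (fun m => ?_) h1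
    rw [norm_mul, Complex.norm_real]
    exact mul_le_of_le_one_left (norm_nonneg _) (ha m)
  rw [zeta_eq_tsum h hs, tsum_mul_tsum_antidiagonal h1 h2]
  refine tsum_congr fun m => ?_
  rw [Complex.ofReal_sum, sum_mul]
  refine sum_congr rfl fun p hp => ?_
  rw [HasAntidiagonal.mem_antidiagonal] at hp
  rw [← hp, val_add_cpow]; ring

/-- The Dirichlet series of the mollified zeta function. -/
lemma zeta_mul_dpoly_mob (h : S.WellBehaved θ A Z) (X : ℝ) {s : ℂ} (hs : 1 < s.re) :
    Z s * S.dpoly mob (S.block 0 X) s = ∑' m, (S.mollified X m : ℂ) * (S.val m : ℂ) ^ (-s) := by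
  have hd : S.dpoly mob (S.block 0 X) s =
      ∑' m, ((if S.val m ≤ X then mob m else 0 : ℝ) : ℂ) * (S.val m : ℂ) ^ (-s) := by
    rw [tsum_eq_sum (s := S.block 0 X)]
    · refine sum_congr rfl fun m hm => ?_
      rw [if_pos ((mem_block h).1 hm).2]
    · intro m hm
      rw [mem_block h] at hm
      rw [if_neg fun hX => hm ⟨S.val_pos m, hX⟩]; simp
  rw [hd, zeta_mul_tsum h hs (a := fun m => if S.val m ≤ X then mob m else 0)]
  · rfl
  · intro m
    split_ifs
    · exact abs_mob_le m
    · simp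

lemma zeta_mul_tsum_mob (h : S.WellBehaved θ A Z) {s : ℂ} (hs : 1 < s.re) :
    Z s * ∑' m, (mob m : ℂ) * (S.val m : ℂ) ^ (-s) = 1 := by
  rw [zeta_mul_tsum h hs abs_mob_le, tsum_eq_single 0]
  · simp
  · intro m hm
    rw [sum_mob_antidiagonal hm]; simp

/-- The zeta function has no zeros to the right of the line `Re s = 1`. -/
lemma zeta_ne_zero (h : S.WellBehaved θ A Z) {s : ℂ} (hs : 1 < s.re) : Z s ≠ 0 := by
  intro h0
  have key := zeta_mul_tsum_mob h hs
  rw [h0, zero_mul] at key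
  exact zero_ne_one key

open MeasureTheory in
/-- The Dirichlet series as a Mellin integral of the counting function. -/
lemma zeta_eq_integral (h : S.WellBehaved θ A Z) {s : ℂ} (hs : 1 < s.re) :
    Z s = s * ∫ x in Set.Ioi (1:ℝ), (S.Nint x : ℂ) * (x : ℂ) ^ (-s - 1) := by
  have hre : (-s - 1).re < -1 := by simp; linarith
  have hs0 : s ≠ 0 := by rintro rfl; simp at hs; linarith
  set F : ℕ → ℝ → ℂ := fun j => (Set.Ici (S.n j)).indicator fun x => (x : ℂ) ^ (-s - 1) with hF
  have hsub : ∀ j, Set.Ioi (1:ℝ) ∩ Set.Ioi (S.n j) = Set.Ioi (S.n j) := fun j =>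
    Set.inter_eq_right.2 fun x hx => lt_of_le_of_lt (S.one_le_n j) hx
  have hae : ∀ j, (Set.Ici (S.n j)).indicator (fun x : ℝ => (x : ℂ) ^ (-s - 1)) =ᵐ[volume]
      (Set.Ioi (S.n j)).indicator (fun x : ℝ => (x : ℂ) ^ (-s - 1)) := fun j =>
    indicator_ae_eq_of_ae_eq_set Ioi_ae_eq_Ici.symm
  have h_int : ∀ j, Integrable (F j) (volume.restrict (Set.Ioi 1)) := fun j => by
    refine Integrable.congr ?_ (ae_restrict_of_ae (hae j).symm)
    refine (IntegrableOn.integrable_indicator ?_ measurableSet_Ioi).restrict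
    exact integrableOn_Ioi_cpow_of_lt hre (S.n_pos j)
  have hval : ∀ j, ∫ x in Set.Ioi (1:ℝ), F j x = (S.n j : ℂ) ^ (-s) / s := fun j => by
    rw [integral_congr_ae (ae_restrict_of_ae (hae j)), setIntegral_indicator measurableSet_Ioi, hsub,
      integral_Ioi_cpow_of_lt hre (S.n_pos j)]
    have : -s - 1 + 1 = -s := by ring
    rw [this]; field_simp
  have hnorm : ∀ j, ∫ x in Set.Ioi (1:ℝ), ‖F j x‖ = S.n j ^ (-s.re) / s.re := fun j => by
    have h1 : ∀ᵐ x, x ∈ Set.Ioi (1:ℝ) → ‖F j x‖ =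
        (Set.Ioi (S.n j)).indicator (fun x : ℝ => x ^ (-s.re - 1)) x := by
      filter_upwards [hae j] with x hx hx1
      simp only [hF]
      rw [hx, norm_indicator_eq_indicator_norm]
      by_cases hxj : x ∈ Set.Ioi (S.n j)
      · rw [Set.indicator_of_mem hxj, Set.indicator_of_mem hxj,
          Complex.norm_cpow_eq_rpow_re_of_pos (zero_lt_one.trans hx1)]
        simp
      · rw [Set.indicator_of_notMem hxj, Set.indicator_of_notMem hxj]
    rw [setIntegral_congr_ae measurableSet_Ioi h1, setIntegral_indicator measurableSet_Ioi, hsub,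
      integral_Ioi_rpow_of_lt (by linarith) (S.n_pos j)]
    rw [show -s.re - 1 + 1 = -s.re by ring]
    field_simp
  have hsum := hasSum_integral_of_summable_integral_norm h_int
    (by simp_rw [hnorm]; exact (summable_n_rpow h hs).div_const _)
  have htsum : ∀ x : ℝ, ∑' j, F j x = (S.Nint x : ℂ) * (x : ℂ) ^ (-s - 1) := fun x => by
    rw [tsum_eq_sum (s := (finite_n_le h x).toFinset)]
    · rw [Finset.sum_congr rfl (g := fun _ => (x : ℂ) ^ (-s - 1)), Finset.sum_const, Nint,
        Set.ncard_eq_toFinset_card _ (finite_n_le h x), nsmul_eq_mul]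
      intro j hj
      simp only [hF]
      rw [Set.indicator_of_mem]
      simpa using hj
    · intro j hj
      simp only [hF]
      rw [Set.indicator_of_notMem]
      simpa using hj
  simp_rw [htsum, hval] at hsum
  rw [← hsum.tsum_eq, h.zeta.1 s hs, ← tsum_mul_left]
  refine tsum_congr fun j => ?_
  field_simp

/-- The remainder in the counting function. -/
noncomputable def remainder (S : BeurlingSystem) (A : ℝ) : ℝ → ℂ :=
  (Set.Ioi (1:ℝ)).indicator fun x => (((S.Nint x : ℝ) - A * x : ℝ) : ℂ)

open MeasureTheory in
lemma locallyIntegrable_remainder (h : S.WellBehaved θ A Z) : LocallyIntegrable (S.remainder A) := by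
  refine LocallyIntegrable.indicator ?_ measurableSet_Ioi
  have h1 : LocallyIntegrable (fun x : ℝ => (S.Nint x : ℝ) - A * x) := by
    refine LocallyIntegrable.sub (Monotone.locallyIntegrable fun x y hxy => ?_)
      (by fun_prop : Continuous fun x : ℝ => A * x).locallyIntegrable
    exact_mod_cast Nint_mono h hxy
  intro x
  obtain ⟨u, hu, hi⟩ := h1 x
  exact ⟨u, hu, hi.ofReal⟩

lemma remainder_isBigO_top (h : S.WellBehaved θ A Z) :
    S.remainder A =O[atTop] fun x : ℝ => x ^ (-(-θ)) := by
  rw [neg_neg]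
  refine IsBigO.trans ?_ h.count
  refine IsBigO.of_bound 1 (Eventually.of_forall fun x => ?_)
  rw [one_mul, remainder]
  refine (norm_indicator_le_norm_self _ _).trans ?_
  rw [Complex.norm_real]

lemma remainder_isBigO_bot (b : ℝ) :
    S.remainder A =O[nhdsWithin 0 (Set.Ioi 0)] fun x : ℝ => x ^ (-b) := by
  refine IsBigO.of_bound 1 (mem_nhdsWithin_of_mem_nhds ?_)
  filter_upwards [Iio_mem_nhds (zero_lt_one (α := ℝ))] with x hx
  rw [remainder, Set.indicator_of_notMem (by simpa using (le_of_lt hx : x ≤ 1))]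
  simp

lemma mellinConvergent_remainder (h : S.WellBehaved θ A Z) {s : ℂ} (hs : θ < s.re) :
    MellinConvergent (S.remainder A) (-s) :=
  mellinConvergent_of_isBigO_rpow ((locallyIntegrable_remainder h).locallyIntegrableOn _)
    (remainder_isBigO_top h) (by simpa using hs) (remainder_isBigO_bot (-s.re - 1)) (by simp)

lemma differentiableAt_mellin_remainder (h : S.WellBehaved θ A Z) {s : ℂ} (hs : θ < s.re) :
    DifferentiableAt ℂ (fun s => mellin (S.remainder A) (-s)) s := by
  have := mellin_differentiableAt_of_isBigO_rpow (s := -s)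
    ((locallyIntegrable_remainder h).locallyIntegrableOn _)
    (remainder_isBigO_top h) (by simpa using hs) (remainder_isBigO_bot (-s.re - 1)) (by simp)
  exact this.comp s differentiableAt_id.neg

/-- The regular part of the zeta function. -/
noncomputable def regular (A : ℝ) (Z : ℂ → ℂ) (s : ℂ) : ℂ := Z s - (A : ℂ) / (s - 1)

open MeasureTheory in
lemma regular_eq_mellin_of_one_lt (h : S.WellBehaved θ A Z) {s : ℂ} (hs : 1 < s.re) :
    regular A Z s = A + s * mellin (S.remainder A) (-s) := by
  have hs1 : s - 1 ≠ 0 := by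
    intro h0
    rw [sub_eq_zero] at h0
    rw [h0] at hs; simp at hs
  have hI : ∀ x : ℝ, (x : ℂ) ^ (-s - 1) • S.remainder A x =
      (Set.Ioi (1:ℝ)).indicator (fun x : ℝ => (x : ℂ) ^ (-s - 1) *
        (((S.Nint x : ℝ) - A * x : ℝ) : ℂ)) x := fun x => by
    rw [remainder, smul_eq_mul]
    by_cases hx : x ∈ Set.Ioi (1:ℝ)
    · rw [Set.indicator_of_mem hx, Set.indicator_of_mem hx]
    · rw [Set.indicator_of_notMem hx, Set.indicator_of_notMem hx, mul_zero]
  have hsub : Set.Ioi (0:ℝ) ∩ Set.Ioi 1 = Set.Ioi 1 :=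
    Set.inter_eq_right.2 (Set.Ioi_subset_Ioi zero_le_one)
  have hm : mellin (S.remainder A) (-s) = ∫ x in Set.Ioi (1:ℝ), (x : ℂ) ^ (-s - 1) *
        (((S.Nint x : ℝ) - A * x : ℝ) : ℂ) := by
    rw [mellin]
    simp_rw [hI]
    rw [setIntegral_indicator measurableSet_Ioi, hsub]
  have hc : IntegrableOn (fun x : ℝ => (x : ℂ) ^ (-s - 1) *
        (((S.Nint x : ℝ) - A * x : ℝ) : ℂ)) (Set.Ioi 1) := by
    have := mellinConvergent_remainder h (h.lt_one.trans hs)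
    rw [MellinConvergent] at this
    simp_rw [hI] at this
    have h2 := this.mono_set (Set.Ioi_subset_Ioi (zero_le_one (α := ℝ)))
    refine h2.congr_fun (fun x hx => ?_) measurableSet_Ioi
    simp only [Set.indicator_of_mem hx]
  have hre : (-s).re < -1 := by simp; linarith
  have hl : IntegrableOn (fun x : ℝ => (A : ℂ) * (x : ℂ) ^ (-s)) (Set.Ioi 1) :=
    (integrableOn_Ioi_cpow_of_lt hre zero_lt_one).const_mul _
  rw [regular, zeta_eq_integral h hs, hm]
  have hadd : ∫ x in Set.Ioi (1:ℝ), (S.Nint x : ℂ) * (x : ℂ) ^ (-s - 1) =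
      (∫ x in Set.Ioi (1:ℝ), (x : ℂ) ^ (-s - 1) * (((S.Nint x : ℝ) - A * x : ℝ) : ℂ)) +
        ∫ x in Set.Ioi (1:ℝ), (A : ℂ) * (x : ℂ) ^ (-s) := by
    rw [← integral_add hc hl]
    refine setIntegral_congr_fun measurableSet_Ioi fun x hx => ?_
    have hx0 : (x : ℂ) ≠ 0 := by
      have : (0:ℝ) < x := zero_lt_one.trans hx
      exact_mod_cast this.ne'
    have : (x : ℂ) ^ (-s) = x ^ (-s - 1) * x := by
      rw [show (x:ℂ) ^ (-s - 1) * x = x ^ (-s - 1) * (x:ℂ) ^ (1:ℂ) by rw [Complex.cpow_one], ← Complex.cpow_add _ _ hx0]; congr 1; ring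
    simp only [this]
    push_cast; ring
  rw [hadd, integral_const_mul, integral_Ioi_cpow_of_lt hre zero_lt_one]
  have h1s : (-s + 1) ≠ 0 := by
    intro h0; apply hs1; linear_combination -h0
  simp only [Complex.ofReal_one, Complex.one_cpow]
  have : (s - 1) ≠ 0 := hs1
  have e : (-1 : ℂ) / (-s + 1) = 1 / (s - 1) := by
    rw [div_eq_div_iff h1s hs1]; ring
  rw [e]
  field_simp
  ring

lemma isOpen_re_gt (x : ℝ) : IsOpen {s : ℂ | x < s.re} :=
  isOpen_lt continuous_const Complex.continuous_re

lemma isPreconnected_re_gt (x : ℝ) : IsPreconnected {s : ℂ | x < s.re} :=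
  (convex_halfSpace_re_gt x).isPreconnected

lemma analyticOnNhd_regular (h : S.WellBehaved θ A Z) :
    AnalyticOnNhd ℂ (regular A Z) {s : ℂ | θ < s.re} :=
  h.zeta.2.analyticOnNhd (isOpen_re_gt θ)

lemma regular_eq_mellin (h : S.WellBehaved θ A Z) {s : ℂ} (hs : θ < s.re) :
    regular A Z s = A + s * mellin (S.remainder A) (-s) := by
  have h2 : AnalyticOnNhd ℂ (fun s => (A : ℂ) + s * mellin (S.remainder A) (-s)) {s : ℂ | θ < s.re} := by
    refine DifferentiableOn.analyticOnNhd (fun s hs => ?_) (isOpen_re_gt θ)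
    exact ((differentiableAt_const _).add
      (differentiableAt_id.mul (differentiableAt_mellin_remainder h hs))).differentiableWithinAt
  have h2' : (2:ℂ) ∈ {s : ℂ | θ < s.re} := by
    have := h.lt_one
    simp only [Set.mem_ofPred_eq, Complex.re_ofNat]; linarith
  refine (analyticOnNhd_regular h).eqOn_of_preconnected_of_eventuallyEq h2 (isPreconnected_re_gt θ)
    (z₀ := 2) h2' ?_ hs
  filter_upwards [(isOpen_re_gt 1).mem_nhds (show (2:ℂ) ∈ {s : ℂ | 1 < s.re} by simp)] with s hs
  exact regular_eq_mellin_of_one_lt h hs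

open MeasureTheory in
/-- Linear growth of the zeta function in the half-plane of continuation. -/
lemma exists_regular_bound (h : S.WellBehaved θ A Z) {σ₁ : ℝ} (hσ₁ : θ < σ₁) :
    ∃ C : ℝ, 1 ≤ C ∧ ∀ s : ℂ, σ₁ ≤ s.re → ‖regular A Z s‖ ≤ C * (1 + ‖s‖) := by
  have hc := mellinConvergent_remainder h (s := (σ₁ : ℂ)) (by simpa using hσ₁)
  rw [MellinConvergent] at hc
  set M := ∫ x in Set.Ioi (0:ℝ), ‖(x : ℂ) ^ (-(σ₁ : ℂ) - 1) • S.remainder A x‖ with hM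
  have hM0 : 0 ≤ M := integral_nonneg fun _ => norm_nonneg _
  refine ⟨1 + |A| + M, by linarith [abs_nonneg A], fun s hs => ?_⟩
  rw [regular_eq_mellin h (hσ₁.trans_le hs)]
  have hb : ‖mellin (S.remainder A) (-s)‖ ≤ M := by
    rw [mellin]
    refine (norm_integral_le_integral_norm _).trans ?_
    refine setIntegral_mono_on (mellinConvergent_remainder h (hσ₁.trans_le hs)).norm hc.norm
      measurableSet_Ioi fun x hx => ?_
    rw [norm_smul, norm_smul]
    by_cases hx1 : x ∈ Set.Ioi (1:ℝ)
    · gcongr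
      rw [Complex.norm_cpow_eq_rpow_re_of_pos hx, Complex.norm_cpow_eq_rpow_re_of_pos hx]
      refine Real.rpow_le_rpow_of_exponent_le (le_of_lt hx1) ?_
      simpa using hs
    · rw [remainder, Set.indicator_of_notMem hx1]; simp
  calc ‖(A:ℂ) + s * mellin (S.remainder A) (-s)‖ ≤ |A| + ‖s‖ * M := by
        refine (norm_add_le _ _).trans ?_
        rw [norm_mul, Complex.norm_real, Real.norm_eq_abs]
        gcongr
    _ ≤ (1 + |A| + M) * (1 + ‖s‖) := by
        nlinarith [norm_nonneg s, abs_nonneg A, mul_nonneg (norm_nonneg s) (abs_nonneg A)]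

open MeasureTheory in
lemma mellin_remainder_conj (s : ℂ) : mellin (S.remainder A) (-(starRingEnd ℂ) s) =
    (starRingEnd ℂ) (mellin (S.remainder A) (-s)) := by
  rw [mellin, mellin, ← integral_conj]
  refine setIntegral_congr_fun measurableSet_Ioi fun x hx => ?_
  have hx0 : (0:ℝ) < x := hx
  simp only [smul_eq_mul, map_mul]
  congr 1
  · have := Complex.cpow_conj (x : ℂ) (-s - 1)
      (by rw [Complex.arg_ofReal_of_nonneg hx0.le]; exact Real.pi_pos.ne)
    simpa using this
  · rw [remainder]
    by_cases hx1 : x ∈ Set.Ioi (1:ℝ)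
    · rw [Set.indicator_of_mem hx1]; exact (Complex.conj_ofReal _).symm
    · rw [Set.indicator_of_notMem hx1]; simp

lemma norm_zeta_conj (h : S.WellBehaved θ A Z) {s : ℂ} (hs : θ < s.re) :
    ‖Z ((starRingEnd ℂ) s)‖ = ‖Z s‖ := by
  have h1 : ∀ w, Z w = regular A Z w + (A : ℂ) / (w - 1) := fun w => by rw [regular]; ring
  have h2 : Z ((starRingEnd ℂ) s) = (starRingEnd ℂ) (Z s) := by
    rw [h1, h1 s, regular_eq_mellin h hs, regular_eq_mellin h (s := (starRingEnd ℂ) s) (by simpa),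
      mellin_remainder_conj]
    simp
  rw [h2, RCLike.norm_conj]

/-- The zeta function with its pole cleared. -/
noncomputable def cleared (A : ℝ) (Z : ℂ → ℂ) (s : ℂ) : ℂ := (s - 1) * regular A Z s + A

lemma cleared_eq {s : ℂ} (hs : s ≠ 1) : cleared A Z s = (s - 1) * Z s := by
  have : s - 1 ≠ 0 := sub_ne_zero.2 hs
  rw [cleared, regular]; field_simp; ring

lemma analyticOnNhd_cleared (h : S.WellBehaved θ A Z) :
    AnalyticOnNhd ℂ (cleared A Z) {s : ℂ | θ < s.re} := fun s hs =>
  ((analyticAt_id.sub analyticAt_const).mul (analyticOnNhd_regular h s hs)).add analyticAt_const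

lemma differentiableAt_zeta (h : S.WellBehaved θ A Z) {s : ℂ} (hs : θ < s.re) (hs1 : s ≠ 1) :
    DifferentiableAt ℂ Z s := by
  have h1 : Z = fun w => regular A Z w + (A : ℂ) / (w - 1) := by ext w; rw [regular]; ring
  rw [h1]
  refine (analyticOnNhd_regular h s hs).differentiableAt.add ?_
  exact (differentiableAt_const _).div (differentiableAt_id.sub_const 1) (sub_ne_zero.2 hs1)

/-- Jensen's bound for the number of distinct zeros in a disc. -/
lemma card_zeros_le {f : ℂ → ℂ} {c : ℂ} {r R M : ℝ} (hr : 0 < r) (hrR : r < R) (hM : 1 ≤ M)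
    (hf : AnalyticOnNhd ℂ f (Metric.closedBall c R)) (hfc : f c ≠ 0)
    (hb : ∀ z ∈ Metric.sphere c R, ‖f z‖ ≤ M) (F : Finset ℂ)
    (hF : ∀ z ∈ F, f z = 0 ∧ z ∈ Metric.closedBall c r) :
    (F.card : ℝ) ≤ Real.log (M / ‖f c‖) / Real.log (R / r) := by
  have hR : 0 < R := hr.trans hrR
  have key := AnalyticOnNhd.sum_divisor_le (c := c) (r := r) (R := R) (M := M) (f := f)
    (by rwa [abs_of_pos hr]) (by rwa [abs_of_pos hr, abs_of_pos hR]) hM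
    (by rwa [abs_of_pos hR]) hfc (by rwa [abs_of_pos hR])
  rw [abs_of_pos hr] at key
  refine le_trans ?_ key
  have hsub : Metric.closedBall c r ⊆ Metric.closedBall c R := Metric.closedBall_subset_closedBall hrR.le
  have hfr : AnalyticOnNhd ℂ f (Metric.closedBall c r) := hf.mono hsub
  set D := MeromorphicOn.divisor f (Metric.closedBall c r) with hD
  have hfin := D.finiteSupport (isCompact_closedBall c r)
  have hnonneg : ∀ z, 0 ≤ D z := fun z => MeromorphicOn.AnalyticOnNhd.divisor_nonneg hfr z
  have hpos : ∀ z ∈ F, 1 ≤ D z := by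
    intro z hz
    obtain ⟨hz0, hzr⟩ := hF z hz
    have hane : analyticOrderAt f z ≠ ⊤ := by
      intro htop
      rw [analyticOrderAt_eq_top] at htop
      have := hf.eqOn_zero_of_preconnected_of_eventuallyEq_zero
        (convex_closedBall c R).isPreconnected (hsub hzr) htop
      exact hfc (this (Metric.mem_closedBall_self hR.le))
    have hne0 : analyticOrderAt f z ≠ 0 := (hfr z hzr).analyticOrderAt_ne_zero.2 hz0
    rw [hD, MeromorphicOn.AnalyticOnNhd.divisor_apply hfr hzr]
    obtain ⟨n, hn⟩ := ENat.ne_top_iff_exists.1 hane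
    rw [← hn] at hne0 ⊢
    have : n ≠ 0 := by rintro rfl; simp at hne0
    change (1:ℤ) ≤ (n : ℤ)
    exact_mod_cast Nat.one_le_iff_ne_zero.2 this
  classical
  have h1 : ∑ᶠ u, D u = ∑ u ∈ hfin.toFinset ∪ F, D u :=
    finsum_eq_sum_of_support_subset _ (by
      intro z hz
      rw [coe_union]
      exact Or.inl (by simpa using hz))
  have h2 : (F.card : ℤ) ≤ ∑ᶠ u, D u := by
    rw [h1]
    calc (F.card : ℤ) = ∑ u ∈ F, 1 := by simp
      _ ≤ ∑ u ∈ F, D u := sum_le_sum hpos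
      _ ≤ _ := sum_le_sum_of_subset_of_nonneg subset_union_right fun z _ _ => hnonneg z
  exact_mod_cast h2

/-- Lower bound for the zeta function on the line `Re s = 2`. -/
lemma exists_zeta_two_lower (h : S.WellBehaved θ A Z) :
    ∃ κ : ℝ, 0 < κ ∧ ∀ s : ℂ, s.re = 2 → κ ≤ ‖Z s‖ := by
  set W := ∑' m, S.val m ^ (-(2:ℝ)) with hW
  have hs2 := summable_val_rpow h (σ := 2) (by norm_num)
  have hWpos : 0 < W := by
    refine hs2.tsum_pos (fun m => Real.rpow_nonneg (S.val_pos m).le _) 0 ?_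
    simp
  refine ⟨W⁻¹, inv_pos.2 hWpos, fun s hs => ?_⟩
  have hs1 : 1 < s.re := by rw [hs]; norm_num
  have key := zeta_mul_tsum_mob h hs1
  have hb : ‖∑' m, (mob m : ℂ) * (S.val m : ℂ) ^ (-s)‖ ≤ W := by
    refine tsum_of_norm_bounded hs2.hasSum fun m => ?_
    rw [norm_mul, Complex.norm_real, norm_val_cpow, Complex.neg_re, hs]
    exact mul_le_of_le_one_left (Real.rpow_nonneg (S.val_pos m).le _) (abs_mob_le m)
  have h1 : ‖Z s‖ * ‖∑' m, (mob m : ℂ) * (S.val m : ℂ) ^ (-s)‖ = 1 := by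
    rw [← norm_mul, key, norm_one]
  rw [inv_le_iff_one_le_mul₀ hWpos, ← h1]
  gcongr

/-- The number of zeros in a short window. -/
lemma exists_window_count (h : S.WellBehaved θ A Z) {σ₁ : ℝ} (hσ₁ : θ < σ₁) (hσ₁' : σ₁ < 1) :
    ∃ η : ℝ, 0 < η ∧ ∃ C : ℝ, 0 < C ∧ ∀ (t : ℝ) (F : Finset ℂ),
      (∀ z ∈ F, Z z = 0 ∧ z ≠ 1 ∧ σ₁ ≤ z.re ∧ |z.im - t| ≤ η) →
      (F.card : ℝ) ≤ C * Real.log (|t| + 3) := by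
  set η := (σ₁ - θ) / 4 with hη
  have hη0 : 0 < η := by rw [hη]; linarith
  obtain ⟨B, hB, hbound⟩ := exists_regular_bound h (σ₁ := σ₁ - 2 * η) (by rw [hη]; linarith)
  obtain ⟨κ, hκ, hlow⟩ := exists_zeta_two_lower h
  have hθ := h.nonneg
  have hA := h.density_pos
  set r := 2 - σ₁ + η with hr
  set R := 2 - σ₁ + 2 * η with hR
  have hrpos : 0 < r := by rw [hr]; linarith
  have hrR : r < R := by rw [hr, hR]; linarith
  have hlogpos : 0 < Real.log (R / r) := Real.log_pos (by rw [lt_div_iff₀ hrpos]; linarith)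
  have hR2 : R ≤ 3 := by rw [hR, hη]; linarith
  set Q := max ((12 * B + A) / κ) 1 with hQ
  have hQ1 : 1 ≤ Q := le_max_right _ _
  refine ⟨η, hη0, (Real.log Q + 2) / Real.log (R / r), by
    have := Real.log_nonneg hQ1
    positivity, fun t F hF => ?_⟩
  set x := |t| + 3 with hx
  have hx3 : 3 ≤ x := by have := abs_nonneg t; linarith
  set c : ℂ := ⟨2, t⟩ with hc
  have hc1 : c ≠ 1 := by
    intro h0; have := congrArg Complex.re h0; simp [hc] at this
  have hfc : κ ≤ ‖cleared A Z c‖ := by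
    rw [cleared_eq hc1, norm_mul]
    have h1 : 1 ≤ ‖c - 1‖ := by
      refine le_trans ?_ (Complex.abs_re_le_norm _)
      norm_num [hc]
    calc κ ≤ ‖Z c‖ := hlow c rfl
      _ ≤ _ := le_mul_of_one_le_left (norm_nonneg _) h1
  have hre : ∀ z ∈ Metric.closedBall c R, σ₁ - 2 * η ≤ z.re := by
    intro z hz
    rw [mem_closedBall_iff_norm] at hz
    have := (Complex.abs_re_le_norm (z - c)).trans hz
    rw [Complex.sub_re, abs_le] at this
    have h2 : c.re = 2 := rfl
    rw [h2, hR] at this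
    linarith [this.1]
  have han : AnalyticOnNhd ℂ (cleared A Z) (Metric.closedBall c R) :=
    (analyticOnNhd_cleared h).mono fun z hz => by
      have := hre z hz
      simp only [Set.mem_ofPred_eq]
      rw [hη] at this; linarith
  have hsph : ∀ z ∈ Metric.sphere c R, ‖cleared A Z z‖ ≤ (12 * B + A) * x ^ 2 := by
    intro z hz
    have hz' := Metric.sphere_subset_closedBall hz
    have h1 := hbound z (hre z hz')
    have hzc : ‖z‖ ≤ x + 2 := by
      rw [mem_closedBall_iff_norm] at hz'
      have hcn : ‖c‖ ≤ 2 + |t| := by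
        refine (Complex.norm_le_abs_re_add_abs_im c).trans ?_
        simp [hc]
      have : ‖z‖ ≤ ‖c‖ + ‖z - c‖ := by
        have := norm_add_le c (z - c); rwa [add_sub_cancel] at this
      rw [hx]; linarith
    have hz1 : ‖z - 1‖ ≤ x + 3 := by
      refine (norm_sub_le _ _).trans ?_
      rw [norm_one]; linarith
    rw [cleared]
    calc _ ≤ ‖z - 1‖ * ‖regular A Z z‖ + A := by
          refine (norm_add_le _ _).trans ?_
          rw [norm_mul, Complex.norm_real, Real.norm_eq_abs, abs_of_pos hA]
      _ ≤ (x + 3) * (B * (1 + (x + 2))) + A := by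
          gcongr
          exact h1.trans (by gcongr)
      _ ≤ _ := by nlinarith [mul_nonneg (by linarith : (0:ℝ) ≤ B) (by nlinarith : (0:ℝ) ≤ x ^ 2 - 9),
          mul_nonneg (by linarith : (0:ℝ) ≤ B) (by linarith : (0:ℝ) ≤ x - 3), mul_nonneg hA.le (by nlinarith : (0:ℝ) ≤ x ^ 2 - 9)]
  have hfc0 : 0 < ‖cleared A Z c‖ := hκ.trans_le hfc
  have hM : 1 ≤ (12 * B + A) * x ^ 2 := by nlinarith
  have key := card_zeros_le hrpos hrR hM han (by
    rw [← norm_pos_iff]; linarith) hsph F (by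
    intro z hz
    obtain ⟨h1, h2, h3, h4⟩ := hF z hz
    refine ⟨by rw [cleared_eq h2, h1, mul_zero], ?_⟩
    have hz1 : z.re ≤ 1 := by
      by_contra hcon
      exact zeta_ne_zero h (not_le.1 hcon) h1
    rw [mem_closedBall_iff_norm]
    refine (Complex.norm_le_abs_re_add_abs_im _).trans ?_
    have e1 : |(z - c).re| = 2 - z.re := by
      rw [Complex.sub_re, abs_sub_comm]
      exact abs_of_nonneg (by simp only [hc]; linarith)
    have e2 : |(z - c).im| ≤ η := by simpa [hc] using h4
    rw [e1, hr]; linarith)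
  refine key.trans ?_
  rw [div_mul_eq_mul_div]
  gcongr
  have hx1 : 1 ≤ Real.log x := by
    rw [Real.le_log_iff_exp_le (by linarith)]
    have := Real.exp_one_lt_d9; linarith
  calc Real.log ((12 * B + A) * x ^ 2 / ‖cleared A Z c‖) ≤ Real.log (Q * x ^ 2) := by
        refine Real.log_le_log (by positivity) ?_
        rw [div_le_iff₀ (by linarith)]
        have hQκ : 12 * B + A ≤ Q * κ := by
          rw [← div_le_iff₀ hκ]; exact le_max_left _ _
        calc (12 * B + A) * x ^ 2 ≤ Q * κ * x ^ 2 := by gcongr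
          _ = Q * x ^ 2 * κ := by ring
          _ ≤ _ := by gcongr
    _ = Real.log Q + 2 * Real.log x := by
        rw [Real.log_mul (by positivity) (by positivity), Real.log_pow]; norm_num
    _ ≤ _ := by nlinarith [Real.log_nonneg hQ1]

open MeasureTheory in
/-- Integrals over disjoint windows. -/
lemma sum_window_integral_le {ι : Type*} {g : ℝ → ℝ} (hg : Continuous g) (hg0 : ∀ t, 0 ≤ g t)
    {L T : ℝ} (hL : 0 < L) (F : Finset ι) (γ : ι → ℝ)
    (hsep : ∀ x ∈ F, ∀ y ∈ F, x ≠ y → 2 * L ≤ |γ x - γ y|)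
    (hT : ∀ x ∈ F, |γ x| + L ≤ T) (hT0 : 0 ≤ T) :
    ∑ x ∈ F, ∫ t in (γ x - L)..(γ x + L), g t ≤ ∫ t in (-T)..T, g t := by
  have h1 : ∀ x, ∫ t in (γ x - L)..(γ x + L), g t = ∫ t in Set.Ioc (γ x - L) (γ x + L), g t :=
    fun x => intervalIntegral.integral_of_le (by linarith)
  simp_rw [h1]
  rw [intervalIntegral.integral_of_le (by linarith), ← integral_biUnion_finset]
  · refine setIntegral_mono_set hg.integrableOn_Ioc (ae_of_all _ hg0) ?_
    refine LE.le.eventuallyLE ?_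
    intro t ht
    simp only [Set.mem_iUnion] at ht
    obtain ⟨x, hx, ht1, ht2⟩ := ht
    have := hT x hx
    have h3 := neg_abs_le (γ x)
    have h4 := le_abs_self (γ x)
    exact ⟨by linarith, by linarith⟩
  · exact fun _ _ => measurableSet_Ioc
  · intro x hx y hy hxy
    refine Set.disjoint_left.2 fun t ht1 ht2 => ?_
    have := hsep x hx y hy hxy
    rcases le_abs'.1 this with h | h
    · linarith [ht1.2, ht2.1]
    · linarith [ht1.1, ht2.2]
  · exact fun _ _ => hg.integrableOn_Ioc

lemma le_add_rpow {x ε p : ℝ} (hx : 0 ≤ x) (hε : 0 < ε) (hp : 1 ≤ p) :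
    x ≤ ε + ε ^ (1 - p) * x ^ p := by
  rcases le_total x ε with h | h
  · have : 0 ≤ ε ^ (1 - p) * x ^ p := by positivity
    linarith
  · have h1 : 1 ≤ x / ε := (one_le_div hε).2 h
    have h2 : x / ε ≤ (x / ε) ^ p := Real.self_le_rpow_of_one_le h1 hp
    have h3 : ε ^ (1 - p) * x ^ p = ε * (x / ε) ^ p := by
      rw [Real.div_rpow hx hε.le, Real.rpow_sub hε, Real.rpow_one]; ring
    rw [h3]
    have : x = ε * (x / ε) := by field_simp
    nlinarith

lemma sum_window_integral_le_rpow {ι : Type*} {g : ℝ → ℝ} (hg : Continuous g) (hg0 : ∀ t, 0 ≤ g t)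
    {L T ε p : ℝ} (hL : 0 < L) (hε : 0 < ε) (hp : 1 ≤ p) (F : Finset ι) (γ : ι → ℝ)
    (hsep : ∀ x ∈ F, ∀ y ∈ F, x ≠ y → 2 * L ≤ |γ x - γ y|)
    (hT : ∀ x ∈ F, |γ x| + L ≤ T) (hT0 : 0 ≤ T) :
    ∑ x ∈ F, ∫ t in (γ x - L)..(γ x + L), g t ≤
      F.card * (2 * L * ε) + ε ^ (1 - p) * ∫ t in (-T)..T, g t ^ p := by
  have hgp : Continuous fun t => g t ^ p := hg.rpow_const fun t => Or.inr (by linarith)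
  have h1 : ∀ x ∈ F, ∫ t in (γ x - L)..(γ x + L), g t ≤
      2 * L * ε + ε ^ (1 - p) * ∫ t in (γ x - L)..(γ x + L), g t ^ p := by
    intro x _
    rw [← intervalIntegral.integral_const_mul]
    have : 2 * L * ε = ∫ t in (γ x - L)..(γ x + L), ε := by
      rw [intervalIntegral.integral_const, smul_eq_mul]; ring
    rw [this, ← intervalIntegral.integral_add
      (continuous_const.intervalIntegrable _ _) ((hgp.const_mul _).intervalIntegrable _ _)]
    exact intervalIntegral.integral_mono_on (by linarith) (hg.intervalIntegrable _ _)
      ((continuous_const.add (hgp.const_mul _)).intervalIntegrable _ _)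
      fun t _ => le_add_rpow (hg0 t) hε hp
  refine (sum_le_sum h1).trans ?_
  rw [sum_add_distrib, sum_const, nsmul_eq_mul, ← mul_sum]
  gcongr
  exact sum_window_integral_le hgp (fun t => Real.rpow_nonneg (hg0 t) p) hL F γ hsep hT hT0

/-- Counting well-spaced windows in which a function is large on average. -/
lemma card_windows_le {ι : Type*} {g : ℝ → ℝ} (hg : Continuous g) (hg0 : ∀ t, 0 ≤ g t)
    {L T V p : ℝ} (hL : 0 < L) (hV : 0 < V) (hp : 1 ≤ p) (F : Finset ι) (γ : ι → ℝ)
    (hsep : ∀ x ∈ F, ∀ y ∈ F, x ≠ y → 2 * L ≤ |γ x - γ y|)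
    (hT : ∀ x ∈ F, |γ x| + L ≤ T) (hT0 : 0 ≤ T)
    (hbig : ∀ x ∈ F, V ≤ ∫ t in (γ x - L)..(γ x + L), g t) :
    (F.card : ℝ) ≤ 2 * (4 * L) ^ (p - 1) * V ^ (-p) * ∫ t in (-T)..T, g t ^ p := by
  have hε : 0 < V / (4 * L) := by positivity
  have h1 := sum_window_integral_le_rpow hg hg0 hL hε hp F γ hsep hT hT0
  have h2 : F.card * V ≤ ∑ x ∈ F, ∫ t in (γ x - L)..(γ x + L), g t := by
    rw [← nsmul_eq_mul]; exact card_nsmul_le_sum _ _ _ hbig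
  set I := ∫ t in (-T)..T, g t ^ p
  have h3 : 2 * L * (V / (4 * L)) = V / 2 := by field_simp; ring
  rw [h3] at h1
  have h4 : F.card * V ≤ 2 * ((V / (4 * L)) ^ (1 - p) * I) := by linarith
  have h5 : (F.card : ℝ) ≤ 2 * ((V / (4 * L)) ^ (1 - p) * I) / V := by rwa [le_div_iff₀ hV]
  refine h5.trans (le_of_eq ?_)
  rw [Real.div_rpow hV.le (by positivity), Real.rpow_sub hV, Real.rpow_one, Real.rpow_neg hV.le,
    show 1 - p = -(p - 1) by ring, Real.rpow_neg (by positivity)]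
  have : 0 < (4 * L) ^ (p - 1) := by positivity
  have : 0 < V ^ p := by positivity
  field_simp

/-- A maximal well-spaced subset. -/
lemma exists_separated {ι : Type*} (F : Finset ι) (γ : ι → ℝ) (D : ℝ) :
    ∃ R ⊆ F, (∀ x ∈ R, ∀ y ∈ R, x ≠ y → D ≤ |γ x - γ y|) ∧
      ∀ x ∈ F, ∃ y ∈ R, |γ x - γ y| ≤ |D| := by
  classical
  let P := F.powerset.filter fun R => ∀ x ∈ R, ∀ y ∈ R, x ≠ y → D ≤ |γ x - γ y|
  have hP : P.Nonempty := ⟨∅, by simp [P]⟩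
  obtain ⟨R, hR, hmax⟩ := P.exists_max_image card hP
  simp only [P, mem_filter, mem_powerset] at hR hmax
  refine ⟨R, hR.1, hR.2, fun x hx => ?_⟩
  by_contra! hcon
  have hxR : x ∉ R := fun hxR => by
    have := hcon x hxR; simp at this; exact absurd this (not_lt.2 (abs_nonneg D))
  have := hmax (insert x R) ⟨insert_subset hx hR.1, by
    intro u hu v hv huv
    rw [mem_insert] at hu hv
    rcases hu with rfl | hu <;> rcases hv with rfl | hv
    · exact absurd rfl huv
    · exact (le_abs_self D).trans (hcon v hv).le
    · rw [abs_sub_comm]; exact (le_abs_self D).trans (hcon u hu).le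
    · exact hR.2 u hu v hv huv⟩
  rw [card_insert_of_notMem hxR] at this
  omega

/-- If windows of radius `D` contain few points, a set of points is controlled by a
well-spaced subset. -/
lemma exists_separated_card_le {ι : Type*} (F : Finset ι) (γ : ι → ℝ) {D B : ℝ} (hD : 0 ≤ D)
    (hB : ∀ y ∈ F, ∀ G ⊆ F, (∀ x ∈ G, |γ x - γ y| ≤ D) → (G.card : ℝ) ≤ B) :
    ∃ R ⊆ F, (∀ x ∈ R, ∀ y ∈ R, x ≠ y → D ≤ |γ x - γ y|) ∧ (F.card : ℝ) ≤ R.card * B := by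
  classical
  obtain ⟨R, hR, hsep, hcov⟩ := exists_separated F γ D
  refine ⟨R, hR, hsep, ?_⟩
  have hsub : F ⊆ R.biUnion fun y => F.filter fun x => |γ x - γ y| ≤ D := by
    intro x hx
    obtain ⟨y, hy, hxy⟩ := hcov x hx
    rw [abs_of_nonneg hD] at hxy
    exact mem_biUnion.2 ⟨y, hy, mem_filter.2 ⟨hx, hxy⟩⟩
  calc (F.card : ℝ) ≤ ∑ y ∈ R, ((F.filter fun x => |γ x - γ y| ≤ D).card : ℝ) := by
        exact_mod_cast (card_le_card hsub).trans card_biUnion_le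
    _ ≤ ∑ y ∈ R, B := sum_le_sum fun y hy =>
        hB y (hR hy) _ (filter_subset _ _) fun x hx => (mem_filter.1 hx).2
    _ = R.card * B := by rw [sum_const, nsmul_eq_mul]

lemma eventually_log_pow_le_rpow (n : ℕ) {b : ℝ} (hb : 0 < b) :
    ∀ᶠ T : ℝ in atTop, Real.log T ^ n ≤ T ^ b := by
  have := (isLittleO_log_rpow_rpow_atTop (n : ℝ) hb).bound (zero_lt_one)
  filter_upwards [this, eventually_log_ge 0, eventually_ge_atTop 0] with T h1 h2 h3
  rw [one_mul, Real.rpow_natCast, Real.norm_of_nonneg (pow_nonneg h2 n),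
    Real.norm_of_nonneg (Real.rpow_nonneg h3 b)] at h1
  exact h1

/-- Zeros in windows of polylogarithmic length. -/
lemma exists_wide_window_count (h : S.WellBehaved θ A Z) {σ₁ : ℝ} (hσ₁ : θ < σ₁) (hσ₁' : σ₁ < 1)
    (n : ℕ) : ∃ c : ℕ, ∀ᶠ T : ℝ in atTop, ∀ t : ℝ, |t| ≤ T → ∀ F : Finset ℂ,
      (∀ z ∈ F, Z z = 0 ∧ z ≠ 1 ∧ σ₁ ≤ z.re ∧ |z.im - t| ≤ Real.log T ^ n) →
      (F.card : ℝ) ≤ Real.log T ^ c := by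
  obtain ⟨η, hη, C, hC, hcount⟩ := exists_window_count h hσ₁ hσ₁'
  refine ⟨n + 2, ?_⟩
  filter_upwards [eventually_log_ge 1, eventually_log_ge ((2 / η + 1) * (2 * C)),
    eventually_ge_atTop 6, eventually_log_pow_le_rpow n zero_lt_one] with T h1 h2 h6 h3 t ht F hF
  rw [Real.rpow_one] at h3
  set ℓ := Real.log T with hℓ
  set D := ℓ ^ n with hD
  have hD1 : 1 ≤ D := one_le_pow₀ h1
  classical
  set J := ⌊2 * D / η⌋₊ + 1 with hJ
  let f : ℂ → ℕ := fun z => ⌊(z.im - (t - D)) / η⌋₊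
  have hmaps : ∀ z ∈ F, f z ∈ range J := by
    intro z hz
    have := (abs_le.1 (hF z hz).2.2.2).2
    rw [mem_range, hJ, Nat.lt_succ_iff]
    refine Nat.floor_le_floor ?_
    gcongr
    linarith
  rw [card_eq_sum_card_fiberwise hmaps, Nat.cast_sum]
  have hfib : ∀ j ∈ range J, ((F.filter fun z => f z = j).card : ℝ) ≤ C * (2 * ℓ) := by
    intro j hj
    have hjle : (j : ℝ) * η ≤ 2 * D := by
      rw [← le_div_iff₀ hη]
      have : j ≤ ⌊2 * D / η⌋₊ := by rw [mem_range] at hj; omega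
      exact (Nat.le_floor_iff (by positivity)).1 this
    refine (hcount (t - D + j * η) _ ?_).trans ?_
    · intro z hz
      rw [mem_filter] at hz
      obtain ⟨hz1, hz2, hz3, hz4⟩ := hF z hz.1
      refine ⟨hz1, hz2, hz3, ?_⟩
      have h0 : 0 ≤ (z.im - (t - D)) / η := div_nonneg (by linarith [(abs_le.1 hz4).1]) hη.le
      have ha := Nat.floor_le h0
      have hb := Nat.lt_floor_add_one ((z.im - (t - D)) / η)
      have hz5 : ⌊(z.im - (t - D)) / η⌋₊ = j := hz.2
      rw [hz5] at ha hb
      rw [le_div_iff₀ hη] at ha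
      rw [div_lt_iff₀ hη] at hb
      rw [abs_le]
      constructor <;> nlinarith
    · have h4 : |t - D + j * η| ≤ 2 * T := by
        rw [abs_le] at ht ⊢
        have : (0:ℝ) ≤ j * η := by positivity
        constructor <;> linarith [ht.1, ht.2]
      have h5 : Real.log (|t - D + j * η| + 3) ≤ 2 * ℓ := by
        have : Real.log (T ^ 2) = 2 * ℓ := by rw [Real.log_pow]; norm_num [hℓ]
        rw [← this]
        refine Real.log_le_log (by positivity) ?_
        nlinarith
      gcongr
  refine (sum_le_sum hfib).trans ?_
  rw [sum_const, card_range, nsmul_eq_mul, hJ]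
  have hfl : ((⌊2 * D / η⌋₊ + 1 : ℕ) : ℝ) ≤ (2 / η + 1) * D := by
    push_cast
    have := Nat.floor_le (show 0 ≤ 2 * D / η by positivity)
    have e : 2 * D / η = 2 / η * D := by ring
    rw [e] at this ⊢
    nlinarith
  calc _ ≤ ((2 / η + 1) * D) * (C * (2 * ℓ)) := by gcongr
    _ = (((2 / η + 1) * (2 * C)) * ℓ) * D := by ring
    _ ≤ (ℓ * ℓ) * D := by gcongr
    _ = ℓ ^ (n + 2) := by rw [hD]; ring

lemma continuous_zeta_line (h : S.WellBehaved θ A Z) {σ : ℝ} (hσ : θ < σ) (hσ1 : σ ≠ 1) :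
    Continuous fun t : ℝ => Z ((σ : ℂ) + t * Complex.I) := by
  rw [continuous_iff_continuousAt]
  intro t
  have h1 : (σ : ℂ) + t * Complex.I ≠ 1 := by
    intro h0; have := congrArg Complex.re h0; simp at this; exact hσ1 this
  have := (differentiableAt_zeta h (s := (σ : ℂ) + t * Complex.I) (by simpa) h1).continuousAt
  exact ContinuousAt.comp (f := fun t : ℝ => (σ : ℂ) + t * Complex.I) this (by fun_prop)

/-- The moment hypothesis on symmetric intervals. -/
lemma exists_moment_bound (h : S.WellBehaved θ A Z) {k ck : ℝ} (hk : 1 ≤ k)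
    (hmom : ∃ C : ℝ, ∀ T : ℝ, 2 ≤ T →
      (1 / T) * (∫ t in (0:ℝ)..T,
          ‖Z ((((1 + θ) / 2 : ℝ) : ℂ) + Complex.I * (t : ℂ))‖ ^ (2 * k))
        ≤ C * Real.log T ^ ck) :
    ∃ K : ℕ, ∀ᶠ T : ℝ in atTop,
      ∫ t in (-(4 * T))..(4 * T), ‖Z ((((1 + θ) / 2 : ℝ) : ℂ) + t * Complex.I)‖ ^ (2 * k) ≤
        T * Real.log T ^ K := by
  obtain ⟨C, hC⟩ := hmom
  obtain ⟨K, hK⟩ := exists_nat_ge ck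
  have hθ := h.lt_one
  refine ⟨K + 1, ?_⟩
  set g : ℝ → ℝ := fun t => ‖Z ((((1 + θ) / 2 : ℝ) : ℂ) + t * Complex.I)‖ ^ (2 * k) with hg
  have hgc : Continuous g :=
    ((continuous_zeta_line h (by linarith) (by linarith)).norm).rpow_const
      fun t => Or.inr (by linarith)
  have heven : ∀ t, g (-t) = g t := by
    intro t
    simp only [hg]
    rw [← norm_zeta_conj h (s := (((1 + θ) / 2 : ℝ) : ℂ) + t * Complex.I) (by simp; linarith)]
    congr 3
    simp only [map_add, map_mul, Complex.conj_ofReal, Complex.conj_I]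
    push_cast; ring
  filter_upwards [eventually_log_ge 1, eventually_log_ge (8 * (|C| * 2 ^ K)), eventually_ge_atTop 4]
    with T h1 h2 h4
  have hsplit : ∫ t in (-(4 * T))..(4 * T), g t = 2 * ∫ t in (0:ℝ)..(4 * T), g t := by
    rw [← intervalIntegral.integral_add_adjacent_intervals (hgc.intervalIntegrable _ 0)
      (hgc.intervalIntegrable 0 _)]
    have : ∫ t in (-(4 * T))..0, g t = ∫ t in (0:ℝ)..(4 * T), g t := by
      have := intervalIntegral.integral_comp_neg (f := g) (a := 0) (b := 4 * T)
      simp_rw [heven, neg_zero] at this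
      exact this.symm
    rw [this]; ring
  rw [hsplit]
  have h5 := hC (4 * T) (by linarith)
  have h6 : ∫ t in (0:ℝ)..(4 * T), ‖Z ((((1 + θ) / 2 : ℝ) : ℂ) + Complex.I * (t : ℂ))‖ ^ (2 * k) =
      ∫ t in (0:ℝ)..(4 * T), g t := by
    simp only [hg]
    simp_rw [mul_comm Complex.I]
  rw [h6, one_div, inv_mul_le_iff₀ (by linarith)] at h5
  set ℓ := Real.log T with hℓ
  have hlog : Real.log (4 * T) ≤ 2 * ℓ := by
    have : Real.log (T ^ 2) = 2 * ℓ := by rw [Real.log_pow]; norm_num [hℓ]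
    rw [← this]
    refine Real.log_le_log (by positivity) ?_
    nlinarith
  have hlog1 : 1 ≤ Real.log (4 * T) := h1.trans (Real.log_le_log (by linarith) (by linarith))
  have h7 : Real.log (4 * T) ^ ck ≤ (2 * ℓ) ^ K := by
    rw [← Real.rpow_natCast]
    calc Real.log (4 * T) ^ ck ≤ Real.log (4 * T) ^ (K : ℝ) :=
          Real.rpow_le_rpow_of_exponent_le hlog1 hK
      _ ≤ _ := Real.rpow_le_rpow (by linarith) hlog (by positivity)
  calc 2 * ∫ t in (0:ℝ)..(4 * T), g t ≤ 2 * (4 * T * (C * Real.log (4 * T) ^ ck)) := by gcongr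
    _ ≤ 2 * (4 * T * (|C| * (2 * ℓ) ^ K)) := by
        have : 0 ≤ Real.log (4 * T) ^ ck := by positivity
        gcongr
        exact le_abs_self C
    _ = T * ((8 * (|C| * 2 ^ K)) * ℓ ^ K) := by rw [mul_pow]; ring
    _ ≤ T * (ℓ * ℓ ^ K) := by gcongr
    _ = _ := by ring

/-- The number of generalized integers in an interval. -/
lemma exists_card_block_le (h : S.WellBehaved θ A Z) :
    ∃ C : ℝ, 1 ≤ C ∧ ∀ x y : ℝ, 0 ≤ x → x ≤ y →
      ((S.block x y).card : ℝ) ≤ C * ((y - x) + (1 + y) ^ θ) := by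
  obtain ⟨C, hC, hb⟩ := exists_error_bound h
  have hA := h.density_pos
  refine ⟨1 + A + 2 * C, by linarith, fun x y hx hxy => ?_⟩
  have h1 := (abs_le.1 (hb x hx)).1
  have h2 := (abs_le.1 (hb y (hx.trans hxy))).2
  have hmono : (1 + x) ^ θ ≤ (1 + y) ^ θ :=
    Real.rpow_le_rpow (by linarith) (by linarith) h.nonneg
  have hy0 : 0 ≤ (1 + y) ^ θ := Real.rpow_nonneg (by linarith) _
  have hcard : (S.block x y).card + S.Nint x ≤ S.Nint y := by
    rw [← ncard_val_le, ← ncard_val_le, ← Set.ncard_coe_finset,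
      ← Set.ncard_union_eq ?_ (finite_toSet _) (finite_val_le h x)]
    · refine Set.ncard_le_ncard ?_ (finite_val_le h y)
      rintro m (hm | hm)
      · exact ((mem_block h).1 (mem_coe.1 hm)).2
      · exact le_trans hm hxy
    · exact Set.disjoint_left.2 fun m hm hm2 =>
        absurd hm2 (not_le.2 ((mem_block h).1 (mem_coe.1 hm)).1)
  have hcard' : ((S.block x y).card : ℝ) + S.Nint x ≤ S.Nint y := by exact_mod_cast hcard
  nlinarith [mul_nonneg hA.le hy0, mul_nonneg hC.le (sub_nonneg.2 hxy), mul_le_mul_of_nonneg_left hmono hC.le]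

open MeasureTheory in
lemma integral_gaussian_mul_cos {b : ℝ} (hb : 0 < b) (x : ℝ) :
    Integrable (fun t : ℝ => Real.exp (-b * t ^ 2) * Real.cos (t * x)) ∧
    ∫ t : ℝ, Real.exp (-b * t ^ 2) * Real.cos (t * x) =
      Real.sqrt (Real.pi / b) * Real.exp (-x ^ 2 / (4 * b)) := by
  have h_int : Integrable (fun t : ℝ => Real.exp (-b * t ^ 2) * Real.cos (t * x)) := by
    refine (integrable_exp_neg_mul_sq hb).mono' (by fun_prop) (ae_of_all _ fun t => ?_)
    rw [norm_mul, Real.norm_of_nonneg (Real.exp_pos _).le]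
    exact mul_le_of_le_one_right (Real.exp_pos _).le (Real.abs_cos_le_one _)
  refine ⟨h_int, ?_⟩
  have key := fourierIntegral_gaussian (b := (b : ℂ)) (by simpa using hb) (x : ℂ)
  have hI : Integrable (fun t : ℝ => Complex.exp (Complex.I * x * t) * Complex.exp (-b * t ^ 2)) := by
    refine (integrable_exp_neg_mul_sq hb).mono' (by fun_prop) (ae_of_all _ fun t => ?_)
    rw [norm_mul, Complex.norm_exp, Complex.norm_exp]
    simp [← Complex.ofReal_pow]
  have hre := congrArg Complex.re key
  have h1 := integral_re hI
  simp only [RCLike.re_eq_complex_re] at h1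
  rw [← h1] at hre
  have h2 : ∀ t : ℝ, (Complex.exp (Complex.I * x * t) * Complex.exp (-b * t ^ 2)).re =
      Real.exp (-b * t ^ 2) * Real.cos (t * x) := fun t => by
    have e1 : Complex.exp (-b * t ^ 2) = (Real.exp (-b * t ^ 2) : ℂ) := by push_cast; rfl
    rw [e1, Complex.re_mul_ofReal, Complex.exp_re]
    simp
    ring_nf
  simp_rw [h2] at hre
  rw [hre]
  have e2 : ((Real.pi : ℂ) / b) ^ (1 / 2 : ℂ) = (Real.sqrt (Real.pi / b) : ℂ) := by
    rw [Real.sqrt_eq_rpow, Complex.ofReal_cpow (by positivity)]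
    push_cast; rfl
  have e3 : Complex.exp (-(x:ℂ) ^ 2 / (4 * b)) = (Real.exp (-x ^ 2 / (4 * b)) : ℂ) := by push_cast; rfl
  rw [e2, e3, ← Complex.ofReal_mul, Complex.ofReal_re]

lemma norm_sq_exp_sum {ι : Type*} (F : Finset ι) (a l : ι → ℝ) (t : ℝ) :
    ‖∑ m ∈ F, (a m : ℂ) * Complex.exp (-(t * l m * Complex.I))‖ ^ 2 =
      ∑ m ∈ F, ∑ n ∈ F, a m * a n * Real.cos (t * (l m - l n)) := by
  have hre : (∑ m ∈ F, (a m : ℂ) * Complex.exp (-(t * l m * Complex.I))).re =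
      ∑ m ∈ F, a m * Real.cos (t * l m) := by
    rw [Complex.re_sum]
    refine sum_congr rfl fun m _ => ?_
    rw [Complex.re_ofReal_mul, Complex.exp_re]
    simp
  have him : (∑ m ∈ F, (a m : ℂ) * Complex.exp (-(t * l m * Complex.I))).im =
      -∑ m ∈ F, a m * Real.sin (t * l m) := by
    rw [Complex.im_sum, ← sum_neg_distrib]
    refine sum_congr rfl fun m _ => ?_
    rw [Complex.im_ofReal_mul, Complex.exp_im]
    simp
  rw [← Complex.normSq_eq_norm_sq, Complex.normSq_apply, hre, him, neg_mul_neg, sum_mul_sum, sum_mul_sum,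
    ← sum_add_distrib]
  refine sum_congr rfl fun m _ => ?_
  rw [← sum_add_distrib]
  refine sum_congr rfl fun n _ => ?_
  rw [mul_sub, Real.cos_sub]; ring

/-- A Gaussian large sieve. -/
lemma integral_norm_sq_exp_sum_le {ι : Type*} (F : Finset ι) (a l : ι → ℝ) {T B : ℝ} (hT : 0 < T)
    (hB : ∀ m ∈ F, ∑ n ∈ F, Real.exp (-(T * (l m - l n) / 2) ^ 2) ≤ B) :
    ∫ t in (-T)..T, ‖∑ m ∈ F, (a m : ℂ) * Complex.exp (-(t * l m * Complex.I))‖ ^ 2 ≤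
      6 * T * B * ∑ m ∈ F, a m ^ 2 := by
  set b := (T ^ 2)⁻¹ with hb
  have hb0 : 0 < b := by positivity
  set q : ℝ → ℝ := fun t => ‖∑ m ∈ F, (a m : ℂ) * Complex.exp (-(t * l m * Complex.I))‖ ^ 2 with hq
  have hqc : Continuous q := by rw [hq]; fun_prop
  have hq0 : ∀ t, 0 ≤ q t := fun t => by positivity
  have hexp : ∀ t, Real.exp (-b * t ^ 2) * q t =
      ∑ m ∈ F, ∑ n ∈ F, a m * a n * (Real.exp (-b * t ^ 2) * Real.cos (t * (l m - l n))) := by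
    intro t
    simp only [hq]
    rw [norm_sq_exp_sum, mul_sum]
    refine sum_congr rfl fun m _ => ?_
    rw [mul_sum]
    exact sum_congr rfl fun n _ => by ring
  have h_int : MeasureTheory.Integrable fun t => Real.exp (-b * t ^ 2) * q t := by
    simp_rw [hexp]
    exact MeasureTheory.integrable_finsetSum _ fun m _ => MeasureTheory.integrable_finsetSum _ fun n _ =>
      (integral_gaussian_mul_cos hb0 _).1.const_mul _
  have hval : ∫ t, Real.exp (-b * t ^ 2) * q t = ∑ m ∈ F, ∑ n ∈ F, a m * a n *
      (Real.sqrt (Real.pi / b) * Real.exp (-(T * (l m - l n) / 2) ^ 2)) := by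
    simp_rw [hexp]
    rw [MeasureTheory.integral_finsetSum _ fun m _ => MeasureTheory.integrable_finsetSum _ fun n _ =>
      (integral_gaussian_mul_cos hb0 _).1.const_mul _]
    refine sum_congr rfl fun m _ => ?_
    rw [MeasureTheory.integral_finsetSum _ fun n _ => (integral_gaussian_mul_cos hb0 _).1.const_mul _]
    refine sum_congr rfl fun n _ => ?_
    rw [MeasureTheory.integral_const_mul, (integral_gaussian_mul_cos hb0 _).2]
    congr 3
    rw [hb]; field_simp; ring
  have hsq : Real.sqrt (Real.pi / b) ≤ 2 * T := by
    rw [hb, div_inv_eq_mul]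
    refine Real.sqrt_le_iff.2 ⟨by positivity, ?_⟩
    nlinarith [Real.pi_le_four, sq_nonneg T]
  have h1 : ∫ t in (-T)..T, q t ≤ Real.exp 1 * ∫ t, Real.exp (-b * t ^ 2) * q t := by
    rw [intervalIntegral.integral_of_le (by linarith), ← MeasureTheory.integral_const_mul]
    refine (MeasureTheory.setIntegral_mono_on hqc.integrableOn_Ioc (h_int.const_mul _).integrableOn
      measurableSet_Ioc fun t ht => ?_).trans
      (MeasureTheory.setIntegral_le_integral (h_int.const_mul _) (MeasureTheory.ae_of_all _ fun t => ?_))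
    · rw [← mul_assoc, ← Real.exp_add]
      refine le_mul_of_one_le_left (hq0 t) (Real.one_le_exp ?_)
      have : b * t ^ 2 ≤ 1 := by
        rw [hb, inv_mul_le_iff₀ (by positivity), mul_one]
        exact sq_le_sq' ht.1.le ht.2
      linarith
    · have := hq0 t; simp only [Pi.zero_apply]; positivity
  have h2 : ∑ m ∈ F, ∑ n ∈ F, a m * a n *
      (Real.sqrt (Real.pi / b) * Real.exp (-(T * (l m - l n) / 2) ^ 2)) ≤
      (2 * T) * (B * ∑ m ∈ F, a m ^ 2) := by
    set E : ι → ι → ℝ := fun m n => Real.exp (-(T * (l m - l n) / 2) ^ 2) with hE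
    have hsymm : ∀ m n, E m n = E n m := fun m n => by simp only [hE]; congr 1; ring
    calc _ ≤ ∑ m ∈ F, ∑ n ∈ F, (2 * T) * (1 / 2 * (a m ^ 2 * E m n) + 1 / 2 * (a n ^ 2 * E m n)) := by
          refine sum_le_sum fun m _ => sum_le_sum fun n _ => ?_
          have hE0 : 0 < E m n := Real.exp_pos _
          change a m * a n * (Real.sqrt (Real.pi / b) * E m n) ≤ _
          have h3 : a m * a n ≤ 1 / 2 * (a m ^ 2 + a n ^ 2) := by nlinarith [sq_nonneg (a m - a n)]
          have h4 : 0 ≤ Real.sqrt (Real.pi / b) := Real.sqrt_nonneg _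
          calc a m * a n * (Real.sqrt (Real.pi / b) * E m n)
              ≤ 1 / 2 * (a m ^ 2 + a n ^ 2) * (Real.sqrt (Real.pi / b) * E m n) := by gcongr
            _ ≤ 1 / 2 * (a m ^ 2 + a n ^ 2) * (2 * T * E m n) := by gcongr
            _ = _ := by ring
      _ = (2 * T) * (1 / 2 * ∑ m ∈ F, a m ^ 2 * ∑ n ∈ F, E m n +
            1 / 2 * ∑ m ∈ F, ∑ n ∈ F, a n ^ 2 * E m n) := by
          simp only [mul_sum, sum_add_distrib, mul_add]
      _ = (2 * T) * ∑ m ∈ F, a m ^ 2 * ∑ n ∈ F, E m n := by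
          have : ∑ m ∈ F, ∑ n ∈ F, a n ^ 2 * E m n = ∑ m ∈ F, a m ^ 2 * ∑ n ∈ F, E m n := by
            rw [sum_comm]
            refine sum_congr rfl fun m _ => ?_
            rw [mul_sum]
            exact sum_congr rfl fun n _ => by rw [hsymm]
          rw [this]; ring
      _ ≤ (2 * T) * ∑ m ∈ F, a m ^ 2 * B := by
          gcongr with m hm
          exact hB m hm
      _ = _ := by rw [← sum_mul]; ring
  rw [hval] at h1
  have hS : 0 ≤ (2 * T) * (B * ∑ m ∈ F, a m ^ 2) := by
    by_cases hF : F.Nonempty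
    · obtain ⟨m, hm⟩ := hF
      have hB0 : 0 ≤ B := (sum_nonneg fun n _ => (Real.exp_pos _).le).trans (hB m hm)
      have := sum_nonneg fun m (_ : m ∈ F) => sq_nonneg (a m)
      positivity
    · rw [not_nonempty_iff_eq_empty.1 hF]; simp
  have he : Real.exp 1 ≤ 3 := by have := Real.exp_one_lt_d9; linarith
  calc _ ≤ _ := h1
    _ ≤ Real.exp 1 * ((2 * T) * (B * ∑ m ∈ F, a m ^ 2)) := by gcongr
    _ ≤ 3 * ((2 * T) * (B * ∑ m ∈ F, a m ^ 2)) := by gcongr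
    _ = _ := by ring

lemma val_cpow_eq_exp (S : BeurlingSystem) (m : ℕ →₀ ℕ) (t : ℝ) :
    (S.val m : ℂ) ^ (-(t * Complex.I)) = Complex.exp (-(t * Real.log (S.val m) * Complex.I)) := by
  rw [Complex.cpow_def_of_ne_zero (by exact_mod_cast (S.val_pos m).ne'), ← Complex.ofReal_log (S.val_pos m).le]
  congr 1; ring

lemma abs_sub_le_log {x y N : ℝ} (hx : 0 < x) (hy : 0 < y) (hxN : x ≤ 2 * N) (hyN : y ≤ 2 * N) :
    |x - y| / (2 * N) ≤ |Real.log x - Real.log y| := by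
  wlog hxy : y ≤ x generalizing x y
  · rw [abs_sub_comm, abs_sub_comm (Real.log x)]
    exact this hy hx hyN hxN (not_le.1 hxy).le
  have hl : Real.log y ≤ Real.log x := Real.log_le_log hy hxy
  rw [abs_of_nonneg (by linarith), abs_of_nonneg (by linarith)]
  have h1 := Real.one_sub_inv_le_log_of_pos (x := x / y) (by positivity)
  rw [Real.log_div hx.ne' hy.ne', inv_div] at h1
  refine le_trans ?_ h1
  have : 1 - y / x = (x - y) / x := by field_simp
  rw [this]
  gcongr

lemma summable_weights : Summable fun j : ℕ => ((j : ℝ) + 1) * Real.exp (-(j : ℝ)) := by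
  have h1 := Real.summable_pow_mul_exp_neg_nat_mul 1 (r := 1) one_pos
  have h2 := Real.summable_pow_mul_exp_neg_nat_mul 0 (r := 1) one_pos
  refine (h1.add h2).congr fun j => ?_
  simp; ring

/-- The mean value theorem for generalized Dirichlet polynomials. -/
lemma exists_mean_value (h : S.WellBehaved θ A Z) :
    ∃ C : ℝ, 1 ≤ C ∧ ∀ N T : ℝ, 1 / 2 ≤ N → 0 < T → ∀ a : (ℕ →₀ ℕ) → ℝ,
      ∫ t in (-T)..T, ‖S.dpoly a (S.block N (2 * N)) (t * Complex.I)‖ ^ 2 ≤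
        C * (N + T * N ^ θ) * ∑ m ∈ S.block N (2 * N), a m ^ 2 := by
  obtain ⟨C, hC, hcard⟩ := exists_card_block_le h
  set W := ∑' j : ℕ, ((j : ℝ) + 1) * Real.exp (-(j : ℝ)) with hW
  have hW0 : 0 ≤ W := tsum_nonneg fun j => by positivity
  refine ⟨48 * C * W + 1, by nlinarith [mul_nonneg (by linarith : (0:ℝ) ≤ C) hW0],
    fun N T hN hT a => ?_⟩
  have hN0 : 0 < N := by linarith
  set F := S.block N (2 * N) with hF
  have hNθ : 0 ≤ N ^ θ := Real.rpow_nonneg hN0.le _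
  have hrow : ∀ m ∈ F, ∑ n ∈ F,
      Real.exp (-(T * (Real.log (S.val m) - Real.log (S.val n)) / 2) ^ 2) ≤
      8 * C * W * (N / T + N ^ θ) := by
    intro m hm
    have hm' := (mem_block h).1 hm
    set H := 4 * N / T with hH
    have hH0 : 0 < H := by positivity
    let f : (ℕ →₀ ℕ) → ℕ := fun n => ⌊|S.val m - S.val n| / H⌋₊
    have hterm : ∀ n ∈ F, Real.exp (-(T * (Real.log (S.val m) - Real.log (S.val n)) / 2) ^ 2) ≤
        Real.exp (-(f n : ℝ)) := by
      intro n hn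
      have hn' := (mem_block h).1 hn
      have h1 := abs_sub_le_log (S.val_pos m) (S.val_pos n) hm'.2 hn'.2
      have h2 : (f n : ℝ) ≤ |T * (Real.log (S.val m) - Real.log (S.val n)) / 2| := by
        refine (Nat.floor_le (by positivity)).trans ?_
        rw [abs_div, abs_mul, abs_of_pos hT, abs_two]
        calc |S.val m - S.val n| / H = T * (|S.val m - S.val n| / (2 * N)) / 2 := by
              rw [hH]; field_simp; ring
          _ ≤ _ := by gcongr
      have h3 : (f n : ℝ) ≤ (f n : ℝ) ^ 2 := by
        have : f n ≤ f n ^ 2 := Nat.le_self_pow two_ne_zero _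
        exact_mod_cast this
      rw [Real.exp_le_exp, neg_le_neg_iff, ← sq_abs]
      exact h3.trans (by gcongr)
    refine (sum_le_sum hterm).trans ?_
    have hmaps : ∀ n ∈ F, f n ∈ F.image f := fun n hn => mem_image_of_mem f hn
    rw [← sum_fiberwise_of_maps_to hmaps]
    have hfib : ∀ j ∈ F.image f, ∑ n ∈ F with f n = j, Real.exp (-(f n : ℝ)) ≤
        (8 * C * (N / T + N ^ θ)) * (((j : ℝ) + 1) * Real.exp (-(j : ℝ))) := by
      intro j _
      have e1 : ∑ n ∈ F with f n = j, Real.exp (-(f n : ℝ)) =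
          ((F.filter fun n => f n = j).card : ℝ) * Real.exp (-(j : ℝ)) := by
        rw [← nsmul_eq_mul, ← sum_const]
        refine sum_congr rfl fun n hn => ?_
        rw [(mem_filter.1 hn).2]
      rw [e1, ← mul_assoc]
      gcongr
      set x := max (S.val m - H * (j + 1)) 0 with hx
      set y := min (S.val m + H * (j + 1)) (2 * N) with hy
      have hj1 : 0 < H * ((j:ℝ) + 1) := by positivity
      have hmpos := S.val_pos m
      have hxy : x ≤ y := by
        refine max_le (le_min (by linarith) (by linarith [hm'.2])) (le_min (by linarith) (by linarith))
      have hsub : (F.filter fun n => f n = j) ⊆ S.block x y := by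
        intro n hn
        obtain ⟨hn1, hn2⟩ := mem_filter.1 hn
        have hn' := (mem_block h).1 hn1
        have h5 := Nat.lt_floor_add_one (|S.val m - S.val n| / H)
        have h6 : ⌊|S.val m - S.val n| / H⌋₊ = j := hn2
        rw [h6, div_lt_iff₀ hH0] at h5
        have h7 := abs_lt.1 h5
        rw [mem_block h]
        exact ⟨max_lt (by linarith [h7.2]) (S.val_pos n), le_min (by linarith [h7.1]) hn'.2⟩
      have h8 : ((F.filter fun n => f n = j).card : ℝ) ≤ (S.block x y).card := by
        exact_mod_cast card_le_card hsub
      refine h8.trans ((hcard x y (le_max_right _ _) hxy).trans ?_)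
      have h9 : y - x ≤ 2 * (H * (j + 1)) := by
        have := min_le_left (S.val m + H * (j + 1)) (2 * N)
        have := le_max_left (S.val m - H * (j + 1)) 0
        linarith
      have h10 : (1 + y) ^ θ ≤ 4 * N ^ θ := by
        have hy0 : 0 ≤ y := le_min (by linarith) (by linarith)
        calc (1 + y) ^ θ ≤ (4 * N) ^ θ := by
              refine Real.rpow_le_rpow (by linarith) ?_ h.nonneg
              have := min_le_right (S.val m + H * (j + 1)) (2 * N)
              linarith
          _ = 4 ^ θ * N ^ θ := Real.mul_rpow (by norm_num) hN0.le
          _ ≤ 4 ^ (1:ℝ) * N ^ θ := by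
              gcongr
              · norm_num
              · exact h.lt_one.le
          _ = _ := by norm_num
      calc C * (y - x + (1 + y) ^ θ) ≤ C * (2 * (H * (j + 1)) + 4 * N ^ θ) := by gcongr
        _ ≤ C * (2 * (H * (j + 1)) + 8 * N ^ θ * (j + 1)) := by
            have : (0:ℝ) ≤ j := Nat.cast_nonneg j
            refine mul_le_mul_of_nonneg_left ?_ (by linarith)
            nlinarith [mul_nonneg hNθ this]
        _ = _ := by rw [hH]; ring
    refine (sum_le_sum hfib).trans ?_
    rw [← mul_sum]
    have := summable_weights.sum_le_tsum (F.image f) fun j _ => by positivity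
    calc _ ≤ (8 * C * (N / T + N ^ θ)) * W := by gcongr
      _ = _ := by ring
  have key := integral_norm_sq_exp_sum_le F a (fun m => Real.log (S.val m)) hT hrow
  simp only [dpoly, val_cpow_eq_exp]
  refine key.trans ?_
  have hs0 : 0 ≤ ∑ m ∈ F, a m ^ 2 := sum_nonneg fun m _ => sq_nonneg _
  have : 6 * T * (8 * C * W * (N / T + N ^ θ)) = 48 * C * W * (N + T * N ^ θ) := by
    field_simp; ring
  rw [this]
  refine mul_le_mul_of_nonneg_right ?_ hs0
  refine mul_le_mul_of_nonneg_right (by linarith) ?_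
  positivity

/-- Shifting a vertical segment of integration. -/
lemma norm_sub_integral_le {f : ℂ → ℂ} {a b L M : ℝ} (hab : a ≤ b)
    (hf : DifferentiableOn ℂ f (Set.uIcc a b ×ℂ Set.uIcc (-L) L))
    (hM : ∀ x ∈ Set.Icc a b, ‖f (x + (-L : ℝ) * Complex.I)‖ ≤ M ∧ ‖f (x + L * Complex.I)‖ ≤ M) :
    ‖(∫ v in (-L)..L, f (b + v * Complex.I)) - ∫ v in (-L)..L, f (a + v * Complex.I)‖ ≤
      2 * (b - a) * M := by
  have key := Complex.integral_boundary_rect_eq_zero_of_differentiableOn f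
    ((a : ℂ) + (-L : ℝ) * Complex.I) ((b : ℂ) + L * Complex.I) (by simpa using hf)
  simp only [Complex.add_re, Complex.ofReal_re, Complex.mul_re, Complex.I_re, mul_zero,
    Complex.ofReal_im, Complex.I_im, mul_one, sub_self, add_zero, Complex.add_im, Complex.mul_im,
    zero_add, smul_eq_mul] at key
  have h1 : ‖∫ x in a..b, f (x + (-L : ℝ) * Complex.I)‖ ≤ M * |b - a| :=
    intervalIntegral.norm_integral_le_of_norm_le_const fun x hx => by
      rw [Set.uIoc_of_le hab] at hx
      exact (hM x ⟨hx.1.le, hx.2⟩).1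
  have h2 : ‖∫ x in a..b, f (x + L * Complex.I)‖ ≤ M * |b - a| :=
    intervalIntegral.norm_integral_le_of_norm_le_const fun x hx => by
      rw [Set.uIoc_of_le hab] at hx
      exact (hM x ⟨hx.1.le, hx.2⟩).2
  rw [abs_of_nonneg (by linarith)] at h1 h2
  have h3 : ‖Complex.I * ((∫ v in (-L)..L, f (b + v * Complex.I)) -
      ∫ v in (-L)..L, f (a + v * Complex.I))‖ ≤ 2 * (b - a) * M := by
    have : Complex.I * ((∫ v in (-L)..L, f (b + v * Complex.I)) -
        ∫ v in (-L)..L, f (a + v * Complex.I)) =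
        (∫ x in a..b, f (x + L * Complex.I)) - ∫ x in a..b, f (x + (-L : ℝ) * Complex.I) := by
      linear_combination key
    rw [this]
    refine (norm_sub_le _ _).trans ?_
    linarith
  simpa using h3

open MeasureTheory in
lemma norm_integral_sub_le_gaussian {g : ℝ → ℂ} {G L : ℝ} (hL : 0 ≤ L) (hG : 0 ≤ G)
    (h_int : Integrable g) (hg : ∀ v, ‖g v‖ ≤ G * Real.exp (-v ^ 2)) :
    ‖(∫ v, g v) - ∫ v in (-L)..L, g v‖ ≤ 3 * G * Real.exp (-L ^ 2 / 2) := by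
  rw [intervalIntegral.integral_of_le (by linarith), ← setIntegral_univ,
    ← setIntegral_sdiff measurableSet_Ioc h_int.integrableOn (Set.subset_univ _)]
  have hb : Integrable fun v : ℝ => G * Real.exp (-L ^ 2 / 2) * Real.exp (-(1 / 2) * v ^ 2) :=
    (integrable_exp_neg_mul_sq (by norm_num)).const_mul _
  calc ‖∫ v in Set.univ \ Set.Ioc (-L) L, g v‖
      ≤ ∫ v in Set.univ \ Set.Ioc (-L) L, G * Real.exp (-L ^ 2 / 2) * Real.exp (-(1 / 2) * v ^ 2) := by
        refine norm_integral_le_of_norm_le hb.integrableOn ?_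
        refine (ae_restrict_iff' (MeasurableSet.univ.diff measurableSet_Ioc)).2 (ae_of_all _ fun v hv => ?_)
        refine (hg v).trans ?_
        rw [mul_assoc, ← Real.exp_add]
        gcongr
        have : L ^ 2 ≤ v ^ 2 := by
          have h2 := hv.2
          rw [Set.mem_Ioc, not_and_or, not_lt, not_le] at h2
          rcases h2 with h2 | h2 <;> nlinarith
        linarith
    _ ≤ ∫ v, G * Real.exp (-L ^ 2 / 2) * Real.exp (-(1 / 2) * v ^ 2) :=
        setIntegral_le_integral hb (ae_of_all _ fun v => by simp only [Pi.zero_apply]; positivity)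
    _ = G * Real.exp (-L ^ 2 / 2) * Real.sqrt (Real.pi / (1 / 2)) := by
        rw [integral_const_mul, integral_gaussian]
    _ ≤ G * Real.exp (-L ^ 2 / 2) * 3 := by
        gcongr
        refine Real.sqrt_le_iff.2 ⟨by norm_num, ?_⟩
        linarith [Real.pi_le_four]
    _ = _ := by ring

/-- Gaussian weights centred at `N` on the logarithmic scale. -/
noncomputable def weight (S : BeurlingSystem) (N : ℝ) (m : ℕ →₀ ℕ) : ℝ :=
  Real.exp (-Real.log (N / S.val m) ^ 2 / 4)

/-- A smooth zeta sum. -/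
noncomputable def smooth (S : BeurlingSystem) (N t : ℝ) : ℂ :=
  ∑' m, (S.weight N m : ℂ) * (S.val m : ℂ) ^ (-(t * Complex.I))

lemma weight_pos (S : BeurlingSystem) (N : ℝ) (m : ℕ →₀ ℕ) : 0 < S.weight N m := Real.exp_pos _

lemma weight_le {N : ℝ} (hN : 0 < N) (σ : ℝ) (m : ℕ →₀ ℕ) :
    S.weight N m ≤ Real.exp (σ ^ 2) * N ^ σ * S.val m ^ (-σ) := by
  have hm := S.val_pos m
  have h1 : Real.exp (σ ^ 2) * N ^ σ * S.val m ^ (-σ) =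
      Real.exp (σ ^ 2 + σ * Real.log (N / S.val m)) := by
    rw [Real.exp_add, Real.log_div hN.ne' hm.ne', Real.rpow_def_of_pos hN, Real.rpow_def_of_pos hm,
      mul_assoc, ← Real.exp_add]
    congr 2; ring
  rw [h1, weight, Real.exp_le_exp]
  nlinarith [sq_nonneg (Real.log (N / S.val m) / 2 + σ)]

lemma half_le_weight {N : ℝ} (hN : 0 < N) {m : ℕ →₀ ℕ} (h1 : N ≤ S.val m) (h2 : S.val m ≤ 2 * N) :
    1 / 2 ≤ S.weight N m := by
  have hm := S.val_pos m
  have hl : Real.log (N / S.val m) ^ 2 ≤ 1 := by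
    have e1 : Real.log (N / S.val m) ≤ 0 := Real.log_nonpos (by positivity) ((div_le_one hm).2 h1)
    have e2 : -1 ≤ Real.log (N / S.val m) := by
      have : Real.log (1 / 2) ≤ Real.log (N / S.val m) := by
        refine Real.log_le_log (by norm_num) ?_
        rw [le_div_iff₀ hm]; linarith
      rw [one_div, Real.log_inv] at this
      have := Real.log_two_lt_d9
      linarith
    nlinarith
  have : Real.exp (-1 / 4) ≤ S.weight N m := Real.exp_le_exp.2 (by linarith)
  refine le_trans ?_ this
  have := Real.add_one_le_exp (-1 / 4 : ℝ)
  linarith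

lemma summable_weight (h : S.WellBehaved θ A Z) {N : ℝ} (hN : 0 < N) : Summable (S.weight N) :=
  ((summable_val_rpow h (by norm_num : (1:ℝ) < 2)).mul_left (Real.exp (2 ^ 2) * N ^ (2:ℝ))).of_nonneg_of_le
    (fun m => (S.weight_pos N m).le) fun m => weight_le hN 2 m

lemma norm_weight_mul (S : BeurlingSystem) (N t : ℝ) (m : ℕ →₀ ℕ) :
    ‖(S.weight N m : ℂ) * (S.val m : ℂ) ^ (-(t * Complex.I))‖ = S.weight N m := by
  rw [norm_mul, norm_val_cpow, Complex.norm_real, Real.norm_of_nonneg (S.weight_pos N m).le]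
  simp

lemma norm_smooth_le (h : S.WellBehaved θ A Z) {N : ℝ} (hN : 0 < N) (t : ℝ) :
    ‖S.smooth N t‖ ≤ ∑' m, S.weight N m := by
  refine (norm_tsum_le_tsum_norm ?_).trans_eq ?_
  · simpa only [norm_weight_mul] using summable_weight h hN
  · simp only [norm_weight_mul]

open MeasureTheory in
lemma integral_kernel {u : ℝ} : ∫ v : ℝ, Complex.exp ((2 + v * Complex.I) * u + (2 + v * Complex.I) ^ 2) =
    (Real.sqrt Real.pi * Real.exp (-u ^ 2 / 4) : ℝ) := by
  have key := fourierIntegral_gaussian (b := 1) (by simp) ((4 + u : ℝ) : ℂ)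
  have h1 : ∀ v : ℝ, Complex.exp ((2 + v * Complex.I) * u + (2 + v * Complex.I) ^ 2) =
      Complex.exp (4 + 2 * u) *
        (Complex.exp (Complex.I * ((4 + u : ℝ) : ℂ) * v) * Complex.exp (-1 * (v:ℂ) ^ 2)) := fun v => by
    rw [← Complex.exp_add, ← Complex.exp_add]
    congr 1
    push_cast
    linear_combination (v:ℂ) ^ 2 * Complex.I_sq
  simp_rw [h1]
  rw [integral_const_mul, key]
  have e2 : ((Real.pi : ℂ) / 1) ^ (1 / 2 : ℂ) = (Real.sqrt Real.pi : ℂ) := by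
    rw [div_one, Real.sqrt_eq_rpow, Complex.ofReal_cpow Real.pi_pos.le]
    push_cast; rfl
  rw [e2, mul_left_comm, ← Complex.exp_add]
  push_cast
  congr 2
  ring

/-- The kernel whose Mellin transform gives the Gaussian weights. -/
noncomputable def kernel (N : ℝ) (w : ℂ) : ℂ := (N : ℂ) ^ w * Complex.exp (w ^ 2)

lemma norm_kernel {N : ℝ} (hN : 0 < N) (x v : ℝ) :
    ‖kernel N (x + v * Complex.I)‖ = N ^ x * Real.exp (x ^ 2 - v ^ 2) := by
  rw [kernel, norm_mul, Complex.norm_cpow_eq_rpow_re_of_pos hN, Complex.norm_exp]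
  simp [sq]

lemma continuous_kernel_line {N : ℝ} (hN : 0 < N) (x : ℝ) :
    Continuous fun v : ℝ => kernel N (x + v * Complex.I) := by
  unfold kernel
  have : (N : ℂ) ≠ 0 := by exact_mod_cast hN.ne'
  refine Continuous.mul (Continuous.const_cpow (by fun_prop) (Or.inl this)) (by fun_prop)

open MeasureTheory in
lemma integral_zeta_kernel (h : S.WellBehaved θ A Z) {N : ℝ} (hN : 0 < N) (t : ℝ) :
    Integrable (fun v : ℝ => Z ((2 : ℝ) + (t + v : ℝ) * Complex.I) * kernel N ((2 : ℝ) + v * Complex.I)) ∧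
    ∫ v : ℝ, Z ((2 : ℝ) + (t + v : ℝ) * Complex.I) * kernel N ((2 : ℝ) + v * Complex.I) =
      Real.sqrt Real.pi * S.smooth N t := by
  let F : (ℕ →₀ ℕ) → ℝ → ℂ := fun m v =>
    (S.val m : ℂ) ^ (-((2 : ℝ) + (t + v : ℝ) * Complex.I)) * kernel N ((2 : ℝ) + v * Complex.I)
  have hker : Integrable (fun v : ℝ => N ^ (2:ℝ) * Real.exp ((2:ℝ) ^ 2 - v ^ 2)) := by
    refine ((integrable_exp_neg_mul_sq one_pos).const_mul (N ^ (2:ℝ) * Real.exp ((2:ℝ) ^ 2))).congr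
      (ae_of_all _ fun v => ?_)
    simp only
    rw [mul_assoc, ← Real.exp_add]; congr 2; ring
  have hFn : ∀ m v, ‖F m v‖ = S.val m ^ (-2 : ℝ) * (N ^ (2:ℝ) * Real.exp ((2:ℝ) ^ 2 - v ^ 2)) := fun m v => by
    simp only [F]
    rw [norm_mul, norm_val_cpow, norm_kernel hN]
    simp
  have hFc : ∀ m, Continuous (F m) := fun m => by
    have : (S.val m : ℂ) ≠ 0 := by exact_mod_cast (S.val_pos m).ne'
    exact (Continuous.const_cpow (by fun_prop) (Or.inl this)).mul (continuous_kernel_line hN 2)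
  have hFi : ∀ m, Integrable (F m) := fun m =>
    (hker.const_mul (S.val m ^ (-2 : ℝ))).mono' (hFc m).aestronglyMeasurable
      (ae_of_all _ fun v => (hFn m v).le)
  have hsum : Summable fun m => ∫ v, ‖F m v‖ := by
    simp_rw [hFn, integral_const_mul]
    exact (summable_val_rpow h (by norm_num)).mul_right _
  have hs := hasSum_integral_of_summable_integral_norm hFi hsum
  have hZ : ∀ v : ℝ, ∑' m, F m v =
      Z ((2 : ℝ) + (t + v : ℝ) * Complex.I) * kernel N ((2 : ℝ) + v * Complex.I) := fun v => by
    rw [zeta_eq_tsum h (by simp)]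
    simp only [F]
    rw [tsum_mul_right]
  have hF : ∀ m, ∫ v, F m v =
      Real.sqrt Real.pi * ((S.weight N m : ℂ) * (S.val m : ℂ) ^ (-(t * Complex.I))) := fun m => by
    have hm := S.val_pos m
    have hmc : (S.val m : ℂ) ≠ 0 := by exact_mod_cast hm.ne'
    have hNc : (N : ℂ) ≠ 0 := by exact_mod_cast hN.ne'
    have e1 : ∀ v : ℝ, F m v = (S.val m : ℂ) ^ (-(t * Complex.I)) *
        Complex.exp ((2 + v * Complex.I) * (Real.log (N / S.val m) : ℝ) + (2 + v * Complex.I) ^ 2) := fun v => by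
      simp only [F, kernel]
      rw [Complex.cpow_def_of_ne_zero hmc, Complex.cpow_def_of_ne_zero hmc, Complex.cpow_def_of_ne_zero hNc,
        ← Complex.exp_add, ← Complex.exp_add, ← Complex.exp_add, Real.log_div hN.ne' hm.ne',
        ← Complex.ofReal_log hm.le, ← Complex.ofReal_log hN.le]
      congr 1
      push_cast
      ring
    simp_rw [e1]
    rw [integral_const_mul, integral_kernel, weight]
    push_cast
    ring
  simp_rw [hF, hZ] at hs
  refine ⟨?_, ?_⟩
  · have hZb : ∀ v : ℝ, ‖Z ((2 : ℝ) + (t + v : ℝ) * Complex.I)‖ ≤ ∑' m, S.val m ^ (-2 : ℝ) := fun v => by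
      rw [zeta_eq_tsum h (by simp)]
      refine (norm_tsum_le_tsum_norm (summable_val_cpow h (by simp))).trans_eq ?_
      simp [norm_val_cpow]
    refine (hker.const_mul (∑' m, S.val m ^ (-2 : ℝ))).mono' ?_ (ae_of_all _ fun v => ?_)
    · refine Continuous.aestronglyMeasurable (Continuous.mul ?_ (continuous_kernel_line hN 2))
      exact (continuous_zeta_line h (σ := 2) (by linarith [h.lt_one]) (by norm_num)).comp
        (by fun_prop : Continuous fun v : ℝ => t + v)
    · rw [norm_mul, norm_kernel hN]
      exact mul_le_mul_of_nonneg_right (hZb v) (by positivity)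
  · rw [← hs.tsum_eq, tsum_mul_left, smooth]

lemma eventually_mul_exp_le (C B Q : ℝ) :
    ∀ᶠ T : ℝ in atTop, C * T ^ B * Real.exp (-(Real.log T ^ 3) ^ 2 / 2) ≤ T ^ (-Q) := by
  filter_upwards [eventually_log_ge C, eventually_log_ge 1, eventually_log_ge (2 * (1 + |B| + |Q|)),
    eventually_gt_atTop 0] with T h1 h2 h3 hT
  set ℓ := Real.log T with hℓ
  have e1 : C ≤ Real.exp ℓ := h1.trans ((by linarith [Real.add_one_le_exp ℓ]))
  rw [Real.rpow_def_of_pos hT, Real.rpow_def_of_pos hT, ← hℓ]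
  calc C * Real.exp (ℓ * B) * Real.exp (-(ℓ ^ 3) ^ 2 / 2)
      ≤ Real.exp ℓ * Real.exp (ℓ * B) * Real.exp (-(ℓ ^ 3) ^ 2 / 2) := by gcongr
    _ = Real.exp (ℓ + ℓ * B + -(ℓ ^ 3) ^ 2 / 2) := by rw [← Real.exp_add, ← Real.exp_add]
    _ ≤ Real.exp (ℓ * -Q) := by
        rw [Real.exp_le_exp]
        have h4 : ℓ * (2 * (1 + |B| + |Q|)) ≤ ℓ * ℓ := by gcongr
        have h5 : ℓ * B ≤ ℓ * |B| := by gcongr; exact le_abs_self B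
        have h6 : ℓ * Q ≤ ℓ * |Q| := by gcongr; exact le_abs_self Q
        have h7 : ℓ ^ 2 ≤ ℓ ^ 6 := pow_le_pow_right₀ h2 (by norm_num)
        nlinarith

lemma exists_zeta_bound (h : S.WellBehaved θ A Z) {σ₁ : ℝ} (hσ₁ : θ < σ₁) :
    ∃ C : ℝ, 1 ≤ C ∧ ∀ s : ℂ, σ₁ ≤ s.re → 1 ≤ |s.im| → ‖Z s‖ ≤ C * (1 + ‖s‖) := by
  obtain ⟨C, hC, hb⟩ := exists_regular_bound h hσ₁
  have hA := h.density_pos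
  refine ⟨C + A, by linarith, fun s hs hi => ?_⟩
  have h1 : Z s = regular A Z s + (A : ℂ) / (s - 1) := by rw [regular]; ring
  have h2 : 1 ≤ ‖s - 1‖ := by
    have := Complex.abs_im_le_norm (s - 1)
    simp at this; linarith
  have h3 : ‖(A : ℂ) / (s - 1)‖ ≤ A := by
    rw [norm_div, Complex.norm_real, Real.norm_of_nonneg hA.le]
    exact div_le_self hA.le h2
  rw [h1]
  refine (norm_add_le _ _).trans ?_
  have := hb s hs
  nlinarith [norm_nonneg s]

lemma half_add_mem (h : S.WellBehaved θ A Z) : θ < (1 + θ) / 2 ∧ (1 + θ) / 2 < 1 ∧ 0 < (1 + θ) / 2 := by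
  have := h.nonneg; have := h.lt_one
  refine ⟨by linarith, by linarith, by linarith⟩

lemma norm_zeta_two_line_le (h : S.WellBehaved θ A Z) (t : ℝ) :
    ‖Z ((2 : ℝ) + t * Complex.I)‖ ≤ ∑' m, S.val m ^ (-2 : ℝ) := by
  rw [zeta_eq_tsum h (by simp)]
  refine (norm_tsum_le_tsum_norm (summable_val_cpow h (by simp))).trans_eq ?_
  simp [norm_val_cpow]

lemma rpow_le_sq_mul {N x : ℝ} (hN : 1 / 2 ≤ N) (hx0 : 0 ≤ x) (hx : x ≤ 2) : N ^ x ≤ 4 * N ^ 2 := by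
  calc N ^ x ≤ (2 * N) ^ x := Real.rpow_le_rpow (by linarith) (by linarith) hx0
    _ ≤ (2 * N) ^ (2:ℝ) := Real.rpow_le_rpow_of_exponent_le (by linarith) hx
    _ = _ := by rw [Real.rpow_two]; ring

lemma exists_tsum_weight_le (h : S.WellBehaved θ A Z) (B : ℝ) :
    ∃ C : ℝ, 1 ≤ C ∧ ∀ᶠ T : ℝ in atTop, ∀ N : ℝ, 1 / 2 ≤ N → N ≤ T ^ B →
      ∑' m, S.weight N m ≤ C * N * Real.log T := by
  obtain ⟨C, hC, hb⟩ := exists_tsum_val_le h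
  refine ⟨C * Real.exp 4 * Real.exp |B|, ?_, ?_⟩
  · have h1 : 1 ≤ Real.exp 4 := Real.one_le_exp (by norm_num)
    have h2 : 1 ≤ Real.exp |B| := Real.one_le_exp (abs_nonneg _)
    exact one_le_mul_of_one_le_of_one_le (one_le_mul_of_one_le_of_one_le hC h1) h2
  filter_upwards [eventually_log_ge 1, eventually_gt_atTop 1] with T hℓ hT N hN hNT
  set ℓ := Real.log T with hℓd
  have hN0 : 0 < N := by linarith
  set σ := 1 + 1 / ℓ with hσ
  have hℓ0 : 0 < ℓ := by linarith
  have hσ1 : 1 < σ := by rw [hσ]; have : 0 < 1 / ℓ := by positivity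
                         linarith
  have hσ2 : σ ≤ 2 := by rw [hσ]; have : 1 / ℓ ≤ 1 := (div_le_one hℓ0).2 hℓ
                         linarith
  have h1 : ∑' m, S.weight N m ≤ Real.exp (σ ^ 2) * N ^ σ * ∑' m, S.val m ^ (-σ) := by
    rw [← tsum_mul_left]
    exact (summable_weight h hN0).tsum_le_tsum (fun m => weight_le hN0 σ m)
      ((summable_val_rpow h hσ1).mul_left _)
  have h2 := hb σ hσ1 hσ2
  have h3 : C / (σ - 1) = C * ℓ := by rw [hσ]; field_simp; ring
  have h4 : N ^ σ ≤ N * Real.exp |B| := by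
    rw [hσ, Real.rpow_add hN0, Real.rpow_one]
    gcongr
    calc N ^ (1 / ℓ) ≤ (T ^ B) ^ (1 / ℓ) := Real.rpow_le_rpow hN0.le hNT (by positivity)
      _ = Real.exp B := rpow_one_div_log hT
      _ ≤ _ := Real.exp_le_exp.2 (le_abs_self B)
  have h5 : Real.exp (σ ^ 2) ≤ Real.exp 4 := Real.exp_le_exp.2 (by nlinarith)
  have h6 : 0 ≤ ∑' m, S.val m ^ (-σ) := tsum_nonneg fun m => Real.rpow_nonneg (S.val_pos m).le _
  rw [h3] at h2
  calc _ ≤ _ := h1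
    _ ≤ Real.exp 4 * (N * Real.exp |B|) * (C * ℓ) := by gcongr
    _ = _ := by ring

lemma eventually_norm_smooth_le (h : S.WellBehaved θ A Z) (B Q : ℝ) :
    ∀ᶠ T : ℝ in atTop, ∀ N : ℝ, 1 / 2 ≤ N → N ≤ T ^ B → ∀ t : ℝ, 2 * Real.log T ^ 3 ≤ |t| → |t| ≤ 3 * T →
      ‖S.smooth N t‖ ≤ 3 * N ^ ((1 + θ) / 2) *
        (∫ u in (t - Real.log T ^ 3)..(t + Real.log T ^ 3), ‖Z (((1 + θ) / 2 : ℝ) + u * Complex.I)‖) +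
        T ^ (-Q) := by
  obtain ⟨hσθ, hσ1, hσ0⟩ := half_add_mem h
  set σ := (1 + θ) / 2 with hσ
  obtain ⟨C, hC, hb⟩ := exists_zeta_bound h hσθ
  set M₂ := ∑' m, S.val m ^ (-2 : ℝ) with hM₂
  have hM0 : 0 ≤ M₂ := tsum_nonneg fun m => Real.rpow_nonneg (S.val_pos m).le _
  filter_upwards [eventually_mul_exp_le ((12 * M₂ + 128 * C) * Real.exp 4) (1 + 2 * B) Q, eventually_log_ge 1,
    eventually_ge_atTop 1, eventually_log_pow_le_rpow 3 one_pos] with T hE hℓ hT hLT N hN hNB t ht htT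
  set L := Real.log T ^ 3 with hL
  rw [Real.rpow_one] at hLT
  have hL1 : 1 ≤ L := one_le_pow₀ hℓ
  have hN0 : 0 < N := by linarith
  obtain ⟨h_int, hval⟩ := integral_zeta_kernel h hN0 t
  set f : ℂ → ℂ := fun w => Z (w + t * Complex.I) * kernel N w with hf
  have hfg : ∀ x v : ℝ, f (x + v * Complex.I) = Z (x + (t + v : ℝ) * Complex.I) * kernel N (x + v * Complex.I) := by
    intro x v
    simp only [hf]
    congr 2
    push_cast; ring
  simp_rw [← hfg 2] at h_int hval
  have hNsq : N ^ 2 ≤ T ^ (2 * B) := by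
    calc N ^ 2 ≤ (T ^ B) ^ 2 := by gcongr
      _ = _ := by rw [← Real.rpow_natCast, ← Real.rpow_mul (by linarith)]; congr 1; push_cast; ring
  set e := Real.exp (-L ^ 2 / 2) with he
  have hk : ∀ x v : ℝ, 0 ≤ x → x ≤ 2 → ‖kernel N (x + v * Complex.I)‖ ≤ 4 * N ^ 2 * Real.exp 4 * Real.exp (-v ^ 2) := by
    intro x v hx0 hx2
    rw [norm_kernel hN0, mul_assoc, ← Real.exp_add]
    gcongr
    · exact rpow_le_sq_mul hN hx0 hx2
    · nlinarith
  have h1 := norm_integral_sub_le_gaussian (L := L) (G := M₂ * (4 * N ^ 2 * Real.exp 4)) (by linarith)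
    (by positivity) h_int (fun v => by
      rw [hfg, norm_mul, mul_assoc]
      exact mul_le_mul (norm_zeta_two_line_le h _) (hk 2 v (by norm_num) le_rfl) (norm_nonneg _) hM0)
  have h2 := norm_sub_integral_le (f := f) (a := σ) (b := 2) (L := L)
    (M := C * (8 * T) * (4 * N ^ 2 * Real.exp 4 * Real.exp (-L ^ 2))) (by linarith) (by
      intro w hw
      rw [Complex.mem_reProdIm, Set.uIcc_of_le (by linarith), Set.uIcc_of_le (by linarith)] at hw
      refine DifferentiableAt.differentiableWithinAt (DifferentiableAt.mul ?_ ?_)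
      · refine (differentiableAt_zeta h (s := w + t * Complex.I) ?_ ?_).comp w
          (differentiableAt_id.add_const _)
        · simp; linarith [hw.1.1]
        · intro h0
          have h3 := congrArg Complex.im h0
          simp at h3
          have h4 : t = -w.im := by linarith
          rw [h4, abs_neg] at ht
          have := abs_le.2 hw.2
          linarith
      · unfold kernel
        have : (N : ℂ) ≠ 0 := by exact_mod_cast hN0.ne'
        exact (differentiableAt_id.const_cpow (Or.inl this)).mul (by fun_prop))
    (by
      intro x hx
      have haux : ∀ v : ℝ, |v| = L → ‖f (x + v * Complex.I)‖ ≤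
          C * (8 * T) * (4 * N ^ 2 * Real.exp 4 * Real.exp (-L ^ 2)) := by
        intro v hv
        rw [hfg, norm_mul]
        have h3 : |t| - |v| ≤ |t + v| := by
          have := abs_sub_abs_le_abs_sub t (-v); rwa [abs_neg, sub_neg_eq_add] at this
        have h4 := abs_add_le t v
        have h5 := hb (x + (t + v : ℝ) * Complex.I) (by simpa using hx.1) (by
          simp only [Complex.add_im, Complex.ofReal_im, Complex.mul_im, Complex.ofReal_re, Complex.I_im,
            Complex.I_re, mul_one, mul_zero, add_zero, zero_add]
          linarith)
        have h6 : ‖(x : ℂ) + (t + v : ℝ) * Complex.I‖ ≤ |x| + |t + v| := by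
          refine (norm_add_le _ _).trans_eq ?_
          rw [norm_mul, Complex.norm_I, mul_one, Complex.norm_real, Complex.norm_real]
          rfl
        have h7 := hk x v (by linarith [hx.1]) hx.2
        rw [show v ^ 2 = L ^ 2 by rw [← sq_abs, hv]] at h7
        have h8 : |x| ≤ 2 := abs_le.2 ⟨by linarith [hx.1], hx.2⟩
        refine mul_le_mul (h5.trans ?_) h7 (norm_nonneg _) (by positivity)
        gcongr
        linarith
      exact ⟨haux (-L) (by rw [abs_neg, abs_of_nonneg (by linarith)]), haux L (abs_of_nonneg (by linarith))⟩)
  have h3 : ‖∫ v in (-L)..L, f (σ + v * Complex.I)‖ ≤ 3 * N ^ σ *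
      ∫ u in (t - L)..(t + L), ‖Z ((σ : ℝ) + u * Complex.I)‖ := by
    have e1 : ∫ u in (t - L)..(t + L), ‖Z ((σ : ℝ) + u * Complex.I)‖ =
        ∫ v in (-L)..L, ‖Z ((σ : ℝ) + (t + v : ℝ) * Complex.I)‖ := by
      rw [intervalIntegral.integral_comp_add_left (fun u : ℝ => ‖Z ((σ : ℝ) + u * Complex.I)‖) t]
      congr 1
    have hc := continuous_zeta_line h hσθ hσ1.ne
    rw [e1, ← intervalIntegral.integral_const_mul]
    refine intervalIntegral.norm_integral_le_of_norm_le (by linarith) ?_ ?_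
    · refine MeasureTheory.ae_of_all _ fun v _ => ?_
      rw [hfg, norm_mul, mul_comm (3 * N ^ σ), norm_kernel hN0, mul_comm 3]
      gcongr
      have : Real.exp (σ ^ 2 - v ^ 2) ≤ Real.exp 1 := Real.exp_le_exp.2 (by nlinarith)
      linarith [Real.exp_one_lt_d9]
    · refine Continuous.intervalIntegrable ?_ _ _
      exact continuous_const.mul ((hc.comp (by fun_prop : Continuous fun v : ℝ => t + v)).norm)
  have h4 : ‖S.smooth N t‖ ≤ ‖∫ v : ℝ, f ((2 : ℝ) + v * Complex.I)‖ := by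
    rw [hval, norm_mul, Complex.norm_real, Real.norm_of_nonneg (Real.sqrt_nonneg _)]
    refine le_mul_of_one_le_left (norm_nonneg _) (Real.one_le_sqrt.2 ?_)
    linarith [Real.pi_gt_three]
  have h5 : ‖∫ v : ℝ, f ((2 : ℝ) + v * Complex.I)‖ ≤
      3 * (M₂ * (4 * N ^ 2 * Real.exp 4)) * e +
      2 * (2 - σ) * (C * (8 * T) * (4 * N ^ 2 * Real.exp 4 * Real.exp (-L ^ 2))) +
      ‖∫ v in (-L)..L, f (σ + v * Complex.I)‖ := by
    refine le_trans ?_ (add_le_add (add_le_add h1 h2) le_rfl)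
    refine le_trans (le_of_eq ?_) (norm_add₃_le)
    congr 1; ring
  have h6 : 3 * (M₂ * (4 * N ^ 2 * Real.exp 4)) * e +
      2 * (2 - σ) * (C * (8 * T) * (4 * N ^ 2 * Real.exp 4 * Real.exp (-L ^ 2))) ≤ T ^ (-Q) := by
    refine le_trans ?_ hE
    have e1 : Real.exp (-L ^ 2) ≤ e := Real.exp_le_exp.2 (by nlinarith)
    have e2 : N ^ 2 ≤ T * N ^ 2 := le_mul_of_one_le_left (by positivity) hT
    have e3 : T * N ^ 2 ≤ T ^ (1 + 2 * B) := by
      rw [Real.rpow_add (by linarith), Real.rpow_one]; gcongr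
    calc _ ≤ 3 * (M₂ * (4 * (T * N ^ 2) * Real.exp 4)) * e +
        2 * 2 * (C * (8 * T) * (4 * N ^ 2 * Real.exp 4 * e)) := by
          gcongr
          linarith
      _ = ((12 * M₂ + 128 * C) * Real.exp 4) * (T * N ^ 2) * e := by ring
      _ ≤ _ := by gcongr
  linarith

lemma exists_phase (z : ℂ) : ∃ x : ℂ, ‖x‖ ≤ 1 ∧ x * z = ‖z‖ := by
  by_cases hz : z = 0
  · exact ⟨0, by simp, by simp [hz]⟩
  · have h0 : (‖z‖ : ℂ) ≠ 0 := by exact_mod_cast norm_ne_zero_iff.2 hz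
    refine ⟨(starRingEnd ℂ) z / ‖z‖, ?_, ?_⟩
    · rw [norm_div, RCLike.norm_conj, Complex.norm_real, norm_norm]
      exact div_self_le_one _
    · rw [div_mul_eq_mul_div, ← Complex.normSq_eq_conj_mul_self, Complex.normSq_eq_norm_sq]
      push_cast
      field_simp

/-- The duality principle for large values of Dirichlet polynomials. -/
lemma sq_sum_norm_dpoly_le (h : S.WellBehaved θ A Z) {N : ℝ} (hN : 0 < N) (a : (ℕ →₀ ℕ) → ℝ)
    {ι : Type*} (F : Finset ι) (τ : ι → ℝ) :
    (∑ r ∈ F, ‖S.dpoly a (S.block N (2 * N)) (τ r * Complex.I)‖) ^ 2 ≤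
      2 * (∑ m ∈ S.block N (2 * N), a m ^ 2) * ∑ r ∈ F, ∑ q ∈ F, ‖S.smooth N (τ r - τ q)‖ := by
  choose x hx1 hx2 using fun r => exists_phase (S.dpoly a (S.block N (2 * N)) (τ r * Complex.I))
  set K := S.block N (2 * N) with hK
  let P : (ℕ →₀ ℕ) → ℂ := fun m => ∑ r ∈ F, x r * (S.val m : ℂ) ^ (-(τ r * Complex.I))
  have e1 : ((∑ r ∈ F, ‖S.dpoly a K (τ r * Complex.I)‖ : ℝ) : ℂ) = ∑ m ∈ K, (a m : ℂ) * P m := by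
    push_cast
    simp_rw [← hx2, dpoly, P, mul_sum]
    rw [sum_comm]
    exact sum_congr rfl fun m _ => sum_congr rfl fun r _ => by ring
  have e2 : ∑ r ∈ F, ‖S.dpoly a K (τ r * Complex.I)‖ ≤ ∑ m ∈ K, |a m| * ‖P m‖ := by
    have h0 : 0 ≤ ∑ r ∈ F, ‖S.dpoly a K (τ r * Complex.I)‖ := sum_nonneg fun _ _ => norm_nonneg _
    calc _ = ‖((∑ r ∈ F, ‖S.dpoly a K (τ r * Complex.I)‖ : ℝ) : ℂ)‖ := by
          rw [Complex.norm_real, Real.norm_of_nonneg h0]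
      _ ≤ _ := by
          rw [e1]
          refine (norm_sum_le _ _).trans_eq (sum_congr rfl fun m _ => ?_)
          rw [norm_mul, Complex.norm_real, Real.norm_eq_abs]
  have hPP : ∀ m, ((S.weight N m * ‖P m‖ ^ 2 : ℝ) : ℂ) = ∑ r ∈ F, ∑ q ∈ F, x r * (starRingEnd ℂ) (x q) *
      ((S.weight N m : ℂ) * (S.val m : ℂ) ^ (-((τ r - τ q : ℝ) * Complex.I))) := by
    intro m
    have : ((‖P m‖ ^ 2 : ℝ) : ℂ) = P m * (starRingEnd ℂ) (P m) := by
      rw [Complex.mul_conj, Complex.normSq_eq_norm_sq]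
    rw [Complex.ofReal_mul, this]
    simp only [P, map_sum]
    rw [sum_mul_sum, mul_sum]
    simp only [mul_sum]
    refine sum_congr rfl fun r _ => sum_congr rfl fun q _ => ?_
    rw [val_cpow_eq_exp, val_cpow_eq_exp, val_cpow_eq_exp, map_mul, ← Complex.exp_conj]
    have : Complex.exp (-((τ r - τ q : ℝ) * (Real.log (S.val m) : ℂ) * Complex.I)) =
        Complex.exp (-((τ r) * (Real.log (S.val m) : ℂ) * Complex.I)) *
          Complex.exp ((starRingEnd ℂ) (-((τ q) * (Real.log (S.val m) : ℂ) * Complex.I))) := by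
      rw [← Complex.exp_add]
      congr 1
      simp
      ring
    rw [this]
    ring
  have hsum : HasSum (fun m => ((S.weight N m * ‖P m‖ ^ 2 : ℝ) : ℂ))
      (∑ r ∈ F, ∑ q ∈ F, x r * (starRingEnd ℂ) (x q) * S.smooth N (τ r - τ q)) := by
    simp_rw [hPP]
    refine hasSum_sum fun r _ => hasSum_sum fun q _ => HasSum.mul_left _ ?_
    refine Summable.hasSum (Summable.of_norm ?_)
    simpa only [norm_weight_mul] using summable_weight h hN
  have hsumr := Complex.hasSum_re hsum
  simp only [Complex.ofReal_re] at hsumr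
  have e3 : ∑ m ∈ K, ‖P m‖ ^ 2 ≤ 2 * ∑ r ∈ F, ∑ q ∈ F, ‖S.smooth N (τ r - τ q)‖ := by
    calc ∑ m ∈ K, ‖P m‖ ^ 2 ≤ ∑ m ∈ K, 2 * (S.weight N m * ‖P m‖ ^ 2) := by
          refine sum_le_sum fun m hm => ?_
          have hm' := (mem_block h).1 hm
          have := half_le_weight hN hm'.1.le hm'.2
          nlinarith [sq_nonneg ‖P m‖]
      _ = 2 * ∑ m ∈ K, S.weight N m * ‖P m‖ ^ 2 := by rw [mul_sum]
      _ ≤ 2 * (∑ r ∈ F, ∑ q ∈ F, x r * (starRingEnd ℂ) (x q) * S.smooth N (τ r - τ q)).re := by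
          gcongr
          exact sum_le_hasSum K (fun m _ => mul_nonneg (S.weight_pos N m).le (sq_nonneg _)) hsumr
      _ ≤ _ := by
          gcongr
          refine (Complex.re_le_norm _).trans ((norm_sum_le _ _).trans (sum_le_sum fun r _ =>
            (norm_sum_le _ _).trans (sum_le_sum fun q _ => ?_)))
          rw [norm_mul, norm_mul, RCLike.norm_conj]
          exact mul_le_of_le_one_left (norm_nonneg _) (mul_le_one₀ (hx1 r) (norm_nonneg _) (hx1 q))
  calc _ ≤ (∑ m ∈ K, |a m| * ‖P m‖) ^ 2 := by
        gcongr
    _ ≤ (∑ m ∈ K, |a m| ^ 2) * ∑ m ∈ K, ‖P m‖ ^ 2 := sum_mul_sq_le_sq_mul_sq _ _ _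
    _ ≤ (∑ m ∈ K, |a m| ^ 2) * (2 * ∑ r ∈ F, ∑ q ∈ F, ‖S.smooth N (τ r - τ q)‖) := by gcongr
    _ = _ := by simp_rw [sq_abs]; ring

set_option maxHeartbeats 800000 in
/-- A large value theorem of Halász type under a moment hypothesis. -/
lemma exists_large_values (h : S.WellBehaved θ A Z) {k ck : ℝ} (hk : 1 ≤ k)
    (hmom : ∃ C : ℝ, ∀ T : ℝ, 2 ≤ T →
      (1 / T) * (∫ t in (0:ℝ)..T,
          ‖Z ((((1 + θ) / 2 : ℝ) : ℂ) + Complex.I * (t : ℂ))‖ ^ (2 * k))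
        ≤ C * Real.log T ^ ck) (B : ℝ) :
    ∃ c : ℕ, ∀ᶠ T : ℝ in atTop, ∀ N V : ℝ, 1 / 2 ≤ N → N ≤ T ^ B → 0 < V →
      ∀ a : (ℕ →₀ ℕ) → ℝ, ∑ m ∈ S.block N (2 * N), a m ^ 2 ≤ T ^ B * V ^ 2 →
      ∀ (F : Finset ℂ) (τ : ℂ → ℝ), (∀ x ∈ F, |τ x| ≤ 3 / 2 * T) →
      (∀ x ∈ F, ∀ y ∈ F, x ≠ y → 2 * Real.log T ^ 3 ≤ |τ x - τ y|) →
      (∀ x ∈ F, V ≤ ‖S.dpoly a (S.block N (2 * N)) (τ x * Complex.I)‖) →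
      (F.card : ℝ) ≤ Real.log T ^ c * ((∑ m ∈ S.block N (2 * N), a m ^ 2) * N / V ^ 2 +
        T * ((∑ m ∈ S.block N (2 * N), a m ^ 2) * N ^ ((1 + θ) / 2) / V ^ 2) ^ (2 * k)) := by
  obtain ⟨hσθ, hσ1, hσ0⟩ := half_add_mem h
  set σ := (1 + θ) / 2 with hσ
  obtain ⟨K, hKm⟩ := exists_moment_bound h hk hmom
  obtain ⟨C, hC, hw⟩ := exists_tsum_weight_le h B
  have hk2 : 0 ≤ 2 * k - 1 := by linarith
  obtain ⟨c, hc⟩ := exists_nat_ge (4 * (2 * k - 1) + K + 3 : ℝ)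
  refine ⟨c, ?_⟩
  filter_upwards [hKm, hw, eventually_norm_smooth_le h B (B + 1), eventually_log_ge 1, eventually_log_ge (48 : ℝ),
    eventually_log_ge (4 * C), eventually_ge_atTop 8, eventually_log_pow_le_rpow 3 one_pos]
    with T hmomT hwT hsm hℓ hℓ48 hℓC hT hLT N V hN hNB hV a hG F τ hτ hsep hbig
  set ℓ := Real.log T with hℓd
  set L := ℓ ^ 3 with hL
  rw [Real.rpow_one] at hLT
  have hL1 : 1 ≤ L := one_le_pow₀ hℓ
  have hN0 : 0 < N := by linarith
  have hT0 : 0 < T := by linarith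
  set G := ∑ m ∈ S.block N (2 * N), a m ^ 2 with hGd
  have hG0 : 0 ≤ G := sum_nonneg fun _ _ => sq_nonneg _
  have hNσ : 0 < N ^ σ := Real.rpow_pos_of_pos hN0 _
  obtain ⟨R, hR⟩ : ∃ R : ℝ, R = F.card := ⟨_, rfl⟩
  rw [← hR]
  have hR0 : 0 ≤ R := hR ▸ Nat.cast_nonneg _
  rcases hR0.eq_or_lt with hR0' | hRpos
  · rw [← hR0']; positivity
  have hdual := sq_sum_norm_dpoly_le h hN0 a F τ
  have hlow : R * V ≤ ∑ r ∈ F, ‖S.dpoly a (S.block N (2 * N)) (τ r * Complex.I)‖ := by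
    rw [hR, ← nsmul_eq_mul]
    exact card_nsmul_le_sum F _ V hbig
  have h1 : (R * V) ^ 2 ≤ 2 * G * ∑ r ∈ F, ∑ q ∈ F, ‖S.smooth N (τ r - τ q)‖ :=
    (by gcongr : (R * V) ^ 2 ≤ _).trans hdual
  have hGpos : 0 < G := by
    rcases hG0.eq_or_lt with h0 | h0
    · rw [← h0] at h1
      have : 0 < (R * V) ^ 2 := by positivity
      linarith
    · exact h0
  set ε := V ^ 2 / (48 * G * N ^ σ * L) with hε
  have hε0 : 0 < ε := by positivity
  have hg := (continuous_zeta_line h hσθ hσ1.ne).norm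
  have hrow : ∀ q ∈ F, ∑ r ∈ F, ‖S.smooth N (τ r - τ q)‖ ≤ C * N * ℓ + (3 * N ^ σ *
      (R * (2 * L * ε) + ε ^ (1 - 2 * k) * (T * ℓ ^ K)) + R * T ^ (-(B + 1))) := by
    classical
    intro q hq
    rw [← add_sum_erase F _ hq]
    refine add_le_add ((norm_smooth_le h hN0 _).trans (hwT N hN hNB)) ?_
    have hstep : ∀ r ∈ F.erase q, ‖S.smooth N (τ r - τ q)‖ ≤ 3 * N ^ σ *
        (∫ u in (τ r - τ q - L)..(τ r - τ q + L), ‖Z ((σ : ℝ) + u * Complex.I)‖) + T ^ (-(B + 1)) := by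
      intro r hr
      obtain ⟨hrq, hrF⟩ := mem_erase.1 hr
      refine hsm N hN hNB _ (hsep r hrF q hq hrq) ?_
      have := abs_sub (τ r) (τ q)
      linarith [hτ r hrF, hτ q hq]
    refine (sum_le_sum hstep).trans ?_
    rw [sum_add_distrib, ← mul_sum, sum_const, nsmul_eq_mul]
    have hcard : ((F.erase q).card : ℝ) ≤ R := by
      rw [hR]; exact_mod_cast card_erase_le
    have hwin := sum_window_integral_le_rpow (T := 4 * T) hg (fun t => norm_nonneg _) (by linarith : 0 < L) hε0
      (by linarith : 1 ≤ 2 * k) (F.erase q) (fun r => τ r - τ q) (by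
        intro x hx y hy hxy
        rw [sub_sub_sub_cancel_right]
        exact hsep x (mem_of_mem_erase hx) y (mem_of_mem_erase hy) hxy) (by
        intro x hx
        have := abs_sub (τ x) (τ q)
        linarith [hτ x (mem_of_mem_erase hx), hτ q hq]) (by linarith)
    gcongr
    refine hwin.trans ?_
    gcongr
  have h2 : ∑ r ∈ F, ∑ q ∈ F, ‖S.smooth N (τ r - τ q)‖ ≤ R * (C * N * ℓ + (3 * N ^ σ *
      (R * (2 * L * ε) + ε ^ (1 - 2 * k) * (T * ℓ ^ K)) + R * T ^ (-(B + 1)))) := by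
    rw [sum_comm]
    have := sum_le_card_nsmul F _ _ hrow
    rwa [nsmul_eq_mul, ← hR] at this
  have h3 : (R * V) ^ 2 ≤ 2 * G * (R * (C * N * ℓ + (3 * N ^ σ *
      (R * (2 * L * ε) + ε ^ (1 - 2 * k) * (T * ℓ ^ K)) + R * T ^ (-(B + 1))))) :=
    h1.trans (by gcongr)
  have h4 : 2 * G * (3 * N ^ σ * (2 * L * ε)) = V ^ 2 / 4 := by
    rw [hε]; field_simp; norm_num
  have h5 : 2 * G * T ^ (-(B + 1)) ≤ V ^ 2 / 4 := by
    calc 2 * G * T ^ (-(B + 1)) ≤ 2 * (T ^ B * V ^ 2) * T ^ (-(B + 1)) := by gcongr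
      _ = 2 * V ^ 2 * (T ^ B * T ^ (-(B + 1))) := by ring
      _ = 2 * V ^ 2 * T⁻¹ := by
          rw [← Real.rpow_add hT0]
          congr 1
          rw [← Real.rpow_neg_one]; congr 1; ring
      _ ≤ _ := by
          rw [← div_eq_mul_inv, div_le_div_iff₀ hT0 (by norm_num)]
          nlinarith [sq_nonneg V]
  have h6 : R * V ^ 2 ≤ 4 * G * (C * N * ℓ + 3 * N ^ σ * (ε ^ (1 - 2 * k) * (T * ℓ ^ K))) := by
    have e1 : R * (R * V ^ 2) ≤ R * (2 * G * (C * N * ℓ + 3 * N ^ σ * (ε ^ (1 - 2 * k) * (T * ℓ ^ K))) +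
        R * (2 * G * (3 * N ^ σ * (2 * L * ε)) + 2 * G * T ^ (-(B + 1)))) := by
      refine le_trans (le_of_eq ?_) (h3.trans (le_of_eq ?_)) <;> ring
    have e2 := le_of_mul_le_mul_left e1 hRpos
    rw [h4] at e2
    have : R * (V ^ 2 / 4 + 2 * G * T ^ (-(B + 1))) ≤ R * (V ^ 2 / 4 + V ^ 2 / 4) := by gcongr
    linarith
  set D := G * N ^ σ / V ^ 2 with hD
  have hD0 : 0 < D := by positivity
  have h7 : ε ^ (1 - 2 * k) = (48 * L) ^ (2 * k - 1) * D ^ (2 * k - 1) := by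
    rw [← Real.mul_rpow (by positivity) hD0.le, show (1 - 2 * k) = -(2 * k - 1) by ring,
      Real.rpow_neg hε0.le, ← Real.inv_rpow hε0.le]
    congr 1
    rw [hε, hD]; field_simp
  have h8 : R ≤ 4 * C * ℓ * (G * N / V ^ 2) + 12 * (48 * L) ^ (2 * k - 1) * ℓ ^ K * (T * D ^ (2 * k)) := by
    have e0 : D ^ (2 * k) = D * D ^ (2 * k - 1) := by
      rw [Real.rpow_sub_one hD0.ne']; field_simp
    have : R ≤ 4 * G * (C * N * ℓ + 3 * N ^ σ * (ε ^ (1 - 2 * k) * (T * ℓ ^ K))) / V ^ 2 := by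
      rw [le_div_iff₀ (by positivity)]; exact h6
    refine this.trans (le_of_eq ?_)
    rw [h7, e0, hD]
    field_simp
    ring
  have hℓ0 : 0 < ℓ := by linarith
  have hcp : ∀ x : ℝ, x ≤ c → ℓ ^ x ≤ ℓ ^ c := fun x hx => by
    rw [← Real.rpow_natCast]; exact Real.rpow_le_rpow_of_exponent_le hℓ hx
  have h9 : 4 * C * ℓ ≤ ℓ ^ c := by
    have : (0:ℝ) ≤ K := Nat.cast_nonneg _
    refine le_trans ?_ (hcp 2 (by linarith))
    rw [Real.rpow_two, sq]; exact mul_le_mul_of_nonneg_right hℓC hℓ0.le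
  have h10 : 12 * (48 * L) ^ (2 * k - 1) * ℓ ^ K ≤ ℓ ^ c := by
    have e1 : 48 * L ≤ ℓ ^ (4 : ℝ) := by
      rw [show (4:ℝ) = (4 : ℕ) by norm_num, Real.rpow_natCast, hL, pow_succ' ℓ 3]
      gcongr
    calc _ ≤ ℓ * (ℓ ^ (4 : ℝ)) ^ (2 * k - 1) * ℓ ^ (K : ℝ) := by
          rw [Real.rpow_natCast]
          have e2 : (12:ℝ) ≤ ℓ := by linarith only [hℓ48]
          gcongr
      _ = ℓ ^ (1 + 4 * (2 * k - 1) + K) := by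
          rw [← Real.rpow_mul hℓ0.le, Real.rpow_add hℓ0, Real.rpow_add hℓ0, Real.rpow_one]
      _ ≤ _ := hcp _ (by linarith)
  calc R ≤ _ := h8
    _ ≤ ℓ ^ c * (G * N / V ^ 2) + ℓ ^ c * (T * D ^ (2 * k)) := by gcongr
    _ = _ := by ring

/-- A Cauchy estimate on a rectangle. -/
lemma norm_le_rect_integral {f : ℂ → ℂ} {a b β L M : ℝ} (ha : a < β) (hb : β < b) (hbL : b - β ≤ L)
    (hf : DifferentiableOn ℂ f (Set.Icc a b ×ℂ Set.Icc (-L) L))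
    (hM : ∀ x ∈ Set.Icc a b, ‖f (x + (-L : ℝ) * Complex.I)‖ ≤ M ∧ ‖f (x + L * Complex.I)‖ ≤ M) :
    ‖f β‖ ≤ 1 / (β - a) * (∫ v in (-L)..L, ‖f (a + v * Complex.I)‖) +
      1 / (b - β) * (∫ v in (-L)..L, ‖f (b + v * Complex.I)‖) + 2 * (b - a) * M / L := by
  have hL : 0 < L := by linarith
  have hβa : 0 < β - a := by linarith
  have hbβ : 0 < b - β := by linarith
  let q : ℂ → ℂ := fun z => (z - β)⁻¹
  have hcont : ContinuousOn f (Set.Icc a b ×ℂ Set.Icc (-L) L) := hf.continuousOn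
  have hnhds : Set.Icc a b ×ℂ Set.Icc (-L) L ∈ nhds (β : ℂ) := by
    refine mem_of_superset (IsOpen.mem_nhds (isOpen_Ioo.reProdIm isOpen_Ioo (s := Set.Ioo a b)
      (t := Set.Ioo (-L) L)) ?_) (Set.inter_subset_inter (Set.preimage_mono Set.Ioo_subset_Icc_self)
        (Set.preimage_mono Set.Ioo_subset_Icc_self))
    rw [Complex.mem_reProdIm]
    simp [ha, hb, hL]
  have hd : DifferentiableOn ℂ (dslope f β) (Set.Icc a b ×ℂ Set.Icc (-L) L) :=
    (Complex.differentiableOn_dslope hnhds).2 hf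
  have key := Complex.integral_boundary_rect_eq_zero_of_differentiableOn (dslope f β)
    ((a : ℂ) + (-L : ℝ) * Complex.I) ((b : ℂ) + L * Complex.I) (by
      simpa [Set.uIcc_of_le (by linarith : a ≤ b), Set.uIcc_of_le (by linarith : -L ≤ L)] using hd)
  simp only [Complex.add_re, Complex.ofReal_re, Complex.mul_re, Complex.I_re, mul_zero,
    Complex.ofReal_im, Complex.I_im, mul_one, sub_self, add_zero, Complex.add_im, Complex.mul_im,
    zero_add, smul_eq_mul] at key
  have hds : ∀ z : ℂ, z ≠ β → dslope f β z = f z * q z - f β * q z := fun z hz => by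
    rw [dslope_of_ne _ hz, slope_def_field]
    simp only [q]
    rw [div_eq_mul_inv]; ring
  have hvne : ∀ x v : ℝ, x ≠ β → (x : ℂ) + v * Complex.I ≠ β := fun x v hx h0 => by
    have := congrArg Complex.re h0
    simp at this; exact hx this
  have hhne : ∀ x v : ℝ, v ≠ 0 → (x : ℂ) + v * Complex.I ≠ β := fun x v hv h0 => by
    have := congrArg Complex.im h0
    simp at this; exact hv this
  have hqc : ContinuousOn q {z | z ≠ β} := by
    refine ContinuousOn.inv₀ (by fun_prop) fun z hz => sub_ne_zero.2 hz
  have vert : ∀ x : ℝ, x ∈ Set.Icc a b → x ≠ β →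
      (IntervalIntegrable (fun v : ℝ => f (x + v * Complex.I)) MeasureTheory.volume (-L) L ∧
      (∫ v in (-L)..L, dslope f β (x + v * Complex.I)) =
        (∫ v in (-L)..L, f (x + v * Complex.I) * q (x + v * Complex.I)) -
          f β * ∫ v in (-L)..L, q (x + v * Complex.I)) := by
    intro x hx hxβ
    have e1 : ContinuousOn (fun v : ℝ => f (x + v * Complex.I)) (Set.uIcc (-L) L) := by
      refine hcont.comp (by fun_prop) fun v hv => ?_
      rw [Set.uIcc_of_le (by linarith)] at hv
      rw [Complex.mem_reProdIm]; simpa using ⟨hx, hv⟩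
    have e2 : ContinuousOn (fun v : ℝ => q (x + v * Complex.I)) (Set.uIcc (-L) L) :=
      hqc.comp (by fun_prop) fun v _ => hvne x v hxβ
    refine ⟨e1.intervalIntegrable, ?_⟩
    rw [← intervalIntegral.integral_const_mul, ← intervalIntegral.integral_sub]
    · exact intervalIntegral.integral_congr fun v _ => hds _ (hvne x v hxβ)
    · exact (e1.mul e2).intervalIntegrable
    · exact (e2.const_mul _).intervalIntegrable
  have horiz : ∀ v : ℝ, v ∈ Set.Icc (-L) L → v ≠ 0 →
      (∫ x in a..b, dslope f β (x + v * Complex.I)) =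
        (∫ x in a..b, f (x + v * Complex.I) * q (x + v * Complex.I)) -
          f β * ∫ x in a..b, q (x + v * Complex.I) := by
    intro v hv hv0
    have e1 : ContinuousOn (fun x : ℝ => f (x + v * Complex.I)) (Set.uIcc a b) := by
      refine hcont.comp (by fun_prop) fun x hx => ?_
      rw [Set.uIcc_of_le (by linarith)] at hx
      rw [Complex.mem_reProdIm]; simpa using ⟨hx, hv⟩
    have e2 : ContinuousOn (fun x : ℝ => q (x + v * Complex.I)) (Set.uIcc a b) :=
      hqc.comp (by fun_prop) fun x _ => hhne x v hv0
    rw [← intervalIntegral.integral_const_mul, ← intervalIntegral.integral_sub]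
    · exact intervalIntegral.integral_congr fun x _ => hds _ (hhne x v hv0)
    · exact (e1.mul e2).intervalIntegrable
    · exact (e2.const_mul _).intervalIntegrable
  have hLne : L ≠ 0 := hL.ne'
  obtain ⟨hia, va⟩ := vert a ⟨le_rfl, by linarith⟩ ha.ne
  obtain ⟨hib, vb⟩ := vert b ⟨by linarith, le_rfl⟩ hb.ne'
  rw [va, vb, horiz (-L) ⟨le_rfl, by linarith⟩ (by simpa using hLne),
    horiz L ⟨by linarith, le_rfl⟩ hLne] at key
  set Wb := ∫ v in (-L)..L, q (b + v * Complex.I)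
  set Wa := ∫ v in (-L)..L, q (a + v * Complex.I)
  set Wd := ∫ x in a..b, q (x + (-L : ℝ) * Complex.I)
  set Wu := ∫ x in a..b, q (x + L * Complex.I)
  set Fb := ∫ v in (-L)..L, f (b + v * Complex.I) * q (b + v * Complex.I)
  set Fa := ∫ v in (-L)..L, f (a + v * Complex.I) * q (a + v * Complex.I)
  set Fd := ∫ x in a..b, f (x + (-L : ℝ) * Complex.I) * q (x + (-L : ℝ) * Complex.I)
  set Fu := ∫ x in a..b, f (x + L * Complex.I) * q (x + L * Complex.I)
  have hW : f β * (Wb - Wa - Complex.I * Wd + Complex.I * Wu) =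
      Fb - Fa - Complex.I * Fd + Complex.I * Fu := by
    linear_combination Complex.I * key + (f β * Wb - f β * Wa - Fb + Fa) * Complex.I_sq
  have hqre : ∀ x v : ℝ, (q (x + v * Complex.I)).re = (x - β) / ((x - β) ^ 2 + v ^ 2) := fun x v => by
    simp only [q]
    rw [Complex.inv_re, Complex.normSq_apply]
    simp
    ring
  have hqim : ∀ x v : ℝ, (q (x + v * Complex.I)).im = -v / ((x - β) ^ 2 + v ^ 2) := fun x v => by
    simp only [q]
    rw [Complex.inv_im, Complex.normSq_apply]
    simp
    ring
  have hqv : ∀ x : ℝ, x ≠ β → IntervalIntegrable (fun v : ℝ => q (x + v * Complex.I))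
      MeasureTheory.volume (-L) L := fun x hx =>
    (hqc.comp (by fun_prop) fun v _ => hvne x v hx).intervalIntegrable
  have hqh : ∀ v : ℝ, v ≠ 0 → IntervalIntegrable (fun x : ℝ => q (x + v * Complex.I))
      MeasureTheory.volume a b := fun v hv =>
    (hqc.comp (by fun_prop) fun x _ => hhne x v hv).intervalIntegrable
  have hWb : 1 ≤ Wb.re := by
    have e1 : Wb.re = ∫ v in (-L)..L, (q (b + v * Complex.I)).re :=
      (intervalIntegral.intervalIntegral_re (𝕜 := ℂ) (hqv b hb.ne')).symm
    have hpos : ∀ v : ℝ, 0 < (b - β) ^ 2 + v ^ 2 := fun v => by positivity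
    have hc : Continuous fun v : ℝ => (b - β) / ((b - β) ^ 2 + v ^ 2) :=
      Continuous.div (by fun_prop) (by fun_prop) fun v => (hpos v).ne'
    simp_rw [hqre] at e1
    rw [e1]
    calc (1:ℝ) = ∫ v in (-(b - β))..(b - β), 1 / (2 * (b - β)) := by
          rw [intervalIntegral.integral_const, smul_eq_mul]; field_simp; ring
      _ ≤ ∫ v in (-(b - β))..(b - β), (b - β) / ((b - β) ^ 2 + v ^ 2) := by
          refine intervalIntegral.integral_mono_on (by linarith) (by simp) (hc.intervalIntegrable _ _) ?_
          intro v hv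
          rw [div_le_div_iff₀ (by positivity) (hpos v)]
          have := sq_le_sq' hv.1 hv.2
          nlinarith
      _ ≤ _ := by
          refine intervalIntegral.integral_mono_interval (by linarith) (by linarith) hbL
            (MeasureTheory.ae_of_all _ fun v => ?_) (hc.intervalIntegrable _ _)
          exact (div_pos hbβ (hpos v)).le
  have hWa : Wa.re ≤ 0 := by
    have e1 : Wa.re = ∫ v in (-L)..L, (q (a + v * Complex.I)).re :=
      (intervalIntegral.intervalIntegral_re (𝕜 := ℂ) (hqv a ha.ne)).symm
    simp_rw [hqre] at e1
    rw [e1, ← neg_nonneg, ← intervalIntegral.integral_neg]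
    refine intervalIntegral.integral_nonneg (by linarith) fun v _ => ?_
    rw [← neg_div]
    exact div_nonneg (by linarith) (by positivity)
  have hWd : 0 ≤ Wd.im := by
    have e1 : Wd.im = ∫ x in a..b, (q (x + (-L : ℝ) * Complex.I)).im :=
      (intervalIntegral.intervalIntegral_im (𝕜 := ℂ) (hqh (-L) (by simpa using hLne))).symm
    simp_rw [hqim] at e1
    rw [e1]
    exact intervalIntegral.integral_nonneg (by linarith) fun v _ =>
      div_nonneg (by linarith) (by positivity)
  have hWu : Wu.im ≤ 0 := by
    have e1 : Wu.im = ∫ x in a..b, (q (x + L * Complex.I)).im :=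
      (intervalIntegral.intervalIntegral_im (𝕜 := ℂ) (hqh L hLne)).symm
    simp_rw [hqim] at e1
    rw [e1, ← neg_nonneg, ← intervalIntegral.integral_neg]
    refine intervalIntegral.integral_nonneg (by linarith) fun v _ => ?_
    rw [← neg_div]
    exact div_nonneg (by linarith) (by positivity)
  have hW1 : 1 ≤ ‖Wb - Wa - Complex.I * Wd + Complex.I * Wu‖ := by
    refine le_trans ?_ (Complex.re_le_norm _)
    simp
    linarith
  have hqn : ∀ z : ℂ, ∀ r : ℝ, 0 < r → r ≤ ‖z - β‖ → ‖q z‖ ≤ 1 / r := fun z r hr hz => by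
    simp only [q]
    rw [norm_inv, one_div]
    exact inv_anti₀ hr hz
  have hvb : ∀ x : ℝ, x ≠ β → IntervalIntegrable (fun v : ℝ => f (x + v * Complex.I)) MeasureTheory.volume (-L) L →
      ‖∫ v in (-L)..L, f (x + v * Complex.I) * q (x + v * Complex.I)‖ ≤
      1 / |x - β| * ∫ v in (-L)..L, ‖f (x + v * Complex.I)‖ := by
    intro x hx hi
    rw [← intervalIntegral.integral_const_mul]
    refine intervalIntegral.norm_integral_le_of_norm_le (by linarith) (MeasureTheory.ae_of_all _ fun v _ => ?_)
      (hi.norm.const_mul _)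
    rw [norm_mul, mul_comm]
    gcongr
    refine hqn _ _ (abs_pos.2 (sub_ne_zero.2 hx)) ?_
    have := Complex.abs_re_le_norm ((x : ℂ) + v * Complex.I - β)
    simpa using this
  have hhb : ∀ v : ℝ, |v| = L → (∀ x ∈ Set.Icc a b, ‖f (x + v * Complex.I)‖ ≤ M) →
      ‖∫ x in a..b, f (x + v * Complex.I) * q (x + v * Complex.I)‖ ≤ M * (1 / L) * (b - a) := by
    intro v hv hM'
    rw [← abs_of_pos (by linarith : 0 < b - a)]
    refine intervalIntegral.norm_integral_le_of_norm_le_const fun x hx => ?_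
    rw [Set.uIoc_of_le (by linarith)] at hx
    have hx' : x ∈ Set.Icc a b := ⟨hx.1.le, hx.2⟩
    rw [norm_mul]
    refine mul_le_mul (hM' x hx') (hqn _ _ hL ?_) (norm_nonneg _) ((norm_nonneg _).trans (hM' x hx'))
    have := Complex.abs_im_le_norm ((x : ℂ) + v * Complex.I - β)
    simp [hv] at this
    exact this
  have b1 := hvb b hb.ne' hib
  have b2 := hvb a ha.ne hia
  have b3 := hhb (-L) (by rw [abs_neg, abs_of_pos hL]) fun x hx => (hM x hx).1
  have b4 := hhb L (abs_of_pos hL) fun x hx => (hM x hx).2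
  rw [abs_of_pos hbβ] at b1
  rw [abs_of_neg (by linarith), neg_sub] at b2
  calc ‖f β‖ ≤ ‖f β‖ * ‖Wb - Wa - Complex.I * Wd + Complex.I * Wu‖ :=
        le_mul_of_one_le_right (norm_nonneg _) hW1
    _ = ‖Fb - Fa - Complex.I * Fd + Complex.I * Fu‖ := by rw [← norm_mul, hW]
    _ ≤ ‖Fb‖ + ‖Fa‖ + ‖Fd‖ + ‖Fu‖ := by
        refine (norm_add_le _ _).trans (add_le_add ((norm_sub_le _ _).trans
          (add_le_add (norm_sub_le _ _) ?_)) ?_) <;> simp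
    _ ≤ _ := by
        have : 2 * (b - a) * M / L = M * (1 / L) * (b - a) + M * (1 / L) * (b - a) := by ring
        rw [this]
        linarith

set_option maxHeartbeats 1000000 in
/-- A smoothed version of `norm_le_rect_integral`. -/
lemma eventually_norm_le_smoothed (Q B q : ℝ) (hB : 0 ≤ B) (hq : 0 ≤ q) :
    ∀ᶠ T : ℝ in atTop, ∀ (f : ℂ → ℂ) (a b β Y : ℝ), 1 ≤ Y → Y ≤ T ^ B → a < β → β ≤ a + 1 → β + 1 ≤ b →
      b - a ≤ 2 + q * Real.log T →
      DifferentiableOn ℂ f (Set.Icc a b ×ℂ Set.Icc (-Real.log T ^ 3) (Real.log T ^ 3)) →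
      (∀ x ∈ Set.Icc a b, ‖f (x + (-Real.log T ^ 3 : ℝ) * Complex.I)‖ ≤ T ^ Q ∧
        ‖f (x + (Real.log T ^ 3 : ℝ) * Complex.I)‖ ≤ T ^ Q) →
      ‖f β‖ ≤ 3 / (β - a) * Y ^ (a - β) *
          (∫ v in (-Real.log T ^ 3)..(Real.log T ^ 3), ‖f (a + v * Complex.I)‖) +
        Real.exp ((2 + q) ^ 2) * Y ^ (b - β) *
          (∫ v in (-Real.log T ^ 3)..(Real.log T ^ 3), ‖f (b + v * Complex.I)‖) + T⁻¹ := by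
  obtain ⟨K, hK⟩ : ∃ K : ℝ, K = |Q| + 1 + (2 + q) * B + (2 + q) ^ 2 + 2 * (2 + q) := ⟨_, rfl⟩
  have hK1 : 1 ≤ K := by
    have := abs_nonneg Q
    have : 0 ≤ (2 + q) * B := by positivity
    nlinarith
  filter_upwards [eventually_log_ge K, eventually_gt_atTop 1] with T hT hT1
  intro f a b β Y hY1 hYB haβ hβa hβb hba hf hM
  have hT0 : 0 < T := by linarith
  have hY0 : 0 < Y := by linarith
  have hlY0 : 0 ≤ Real.log Y := Real.log_nonneg hY1
  have hlY : Real.log Y ≤ B * Real.log T := by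
    rw [← Real.log_rpow hT0]
    exact Real.log_le_log hY0 hYB
  have hTQ : T ^ Q = Real.exp (Q * Real.log T) := by
    rw [Real.rpow_def_of_pos hT0, mul_comm]
  have hTi : T⁻¹ = Real.exp (-Real.log T) := by
    rw [Real.exp_neg, Real.exp_log hT0]
  have hYr : ∀ r : ℝ, Y ^ r = Real.exp (r * Real.log Y) := fun r => by
    rw [Real.rpow_def_of_pos hY0, mul_comm]
  rw [hTQ] at hM
  rw [hTi, hYr, hYr]
  generalize Real.log T = l at *
  generalize Real.log Y = y at *
  have hl1 : 1 ≤ l := hK1.trans hT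
  have hl0 : 0 < l := by linarith
  have hneg : -l ^ 3 = -(l ^ 3) := rfl
  have hba' : b - a ≤ (2 + q) * l := by nlinarith
  have hbβ' : b - β ≤ (2 + q) * l := by linarith
  have hKl : (2 + q) * l ≤ l ^ 3 := by
    have h1 : 2 + q ≤ K := by
      have := abs_nonneg Q
      have : 0 ≤ (2 + q) * B := by positivity
      nlinarith
    have h2 : l * l ≤ l ^ 3 := by nlinarith [mul_pos hl0 hl0]
    nlinarith
  let E : ℂ → ℂ := fun z => Complex.exp ((z - β) * y + (z - β) ^ 2 / (l : ℂ) ^ 2)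
  have hE : ∀ x v : ℝ, ‖E (x + v * Complex.I)‖ =
      Real.exp ((x - β) * y + ((x - β) ^ 2 - v ^ 2) / l ^ 2) := fun x v => by
    simp only [E, Complex.norm_exp]
    have : ((x : ℂ) + v * Complex.I - β) * y + ((x : ℂ) + v * Complex.I - β) ^ 2 / (l : ℂ) ^ 2 =
        (((x - β) * y + ((x - β) ^ 2 - v ^ 2) / l ^ 2 : ℝ) : ℂ) +
          ((v * y + 2 * (x - β) * v / l ^ 2 : ℝ) : ℂ) * Complex.I := by
      push_cast
      linear_combination ((v : ℂ) ^ 2 / (l : ℂ) ^ 2) * Complex.I_sq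
    rw [this, Complex.add_re, Complex.ofReal_re, Complex.re_ofReal_mul, Complex.I_re, mul_zero,
      add_zero]
  have hEβ : E β = 1 := by simp [E]
  have hEd : Differentiable ℂ E := by
    simp only [E]; fun_prop
  set M : ℝ := Real.exp (Q * l + ((2 + q) * B * l ^ 2 + (2 + q) ^ 2 - l ^ 4)) with hMdef
  have hsq : ∀ x ∈ Set.Icc a b, (x - β) ^ 2 ≤ (2 + q) ^ 2 * l ^ 2 := fun x hx => by
    rw [← mul_pow]
    refine sq_le_sq' ?_ ?_
    · nlinarith [hx.1]
    · linarith [hx.2]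
  have hhor : ∀ x ∈ Set.Icc a b, ∀ v : ℝ, v ^ 2 = (l ^ 3) ^ 2 → ‖f (x + v * Complex.I)‖ ≤ Real.exp (Q * l) →
      ‖f (x + v * Complex.I) * E (x + v * Complex.I)‖ ≤ M := by
    intro x hx v hv hfv
    rw [norm_mul, hE, hMdef, Real.exp_add (Q * l)]
    refine mul_le_mul hfv (Real.exp_le_exp.2 ?_) (Real.exp_nonneg _) (Real.exp_nonneg _)
    have h1 : (x - β) * y ≤ (2 + q) * B * l ^ 2 :=
      calc (x - β) * y ≤ ((2 + q) * l) * y :=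
            mul_le_mul_of_nonneg_right (by linarith [hx.2]) hlY0
        _ ≤ ((2 + q) * l) * (B * l) := by gcongr
        _ = _ := by ring
    have h2 : ((x - β) ^ 2 - v ^ 2) / l ^ 2 ≤ (2 + q) ^ 2 - l ^ 4 := by
      rw [div_le_iff₀ (by positivity), hv]
      nlinarith [hsq x hx]
    linarith
  have key := norm_le_rect_integral (f := fun z => f z * E z) (a := a) (b := b) (β := β) (L := l ^ 3)
    (M := M) haβ (by linarith) (by linarith) (hf.mul hEd.differentiableOn) (fun x hx =>
      ⟨hhor x hx (-l ^ 3) (by ring) (hM x hx).1, hhor x hx (l ^ 3) rfl (hM x hx).2⟩)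
  rw [hEβ, mul_one] at key
  have hvert : ∀ x ∈ Set.Icc a b, ∀ G : ℝ, (∀ v : ℝ, ‖E (x + v * Complex.I)‖ ≤ G) →
      (∫ v in (-(l ^ 3))..(l ^ 3), ‖f (x + v * Complex.I) * E (x + v * Complex.I)‖) ≤
        G * ∫ v in (-(l ^ 3))..(l ^ 3), ‖f (x + v * Complex.I)‖ := by
    intro x hx G hG
    have hl3 : -(l ^ 3) ≤ l ^ 3 := by have := pow_pos hl0 3; linarith
    have e1 : ContinuousOn (fun v : ℝ => f (x + v * Complex.I)) (Set.uIcc (-(l ^ 3)) (l ^ 3)) := by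
      refine hf.continuousOn.comp (by fun_prop) fun v hv => ?_
      rw [Set.uIcc_of_le hl3] at hv
      rw [Complex.mem_reProdIm]; simpa using ⟨hx, hv⟩
    have e2 : Continuous (fun v : ℝ => E (x + v * Complex.I)) := hEd.continuous.comp (by fun_prop)
    rw [← intervalIntegral.integral_const_mul]
    refine intervalIntegral.integral_mono_on hl3 (e1.mul e2.continuousOn).norm.intervalIntegrable
      (e1.norm.intervalIntegrable.const_mul G) fun v _ => ?_
    rw [norm_mul, mul_comm]
    exact mul_le_mul_of_nonneg_right (hG v) (norm_nonneg _)
  have hva := hvert a ⟨le_rfl, by linarith⟩ (3 * Real.exp ((a - β) * y)) fun v => by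
    rw [hE, Real.exp_add, mul_comm]
    refine mul_le_mul_of_nonneg_right ?_ (Real.exp_nonneg _)
    refine (Real.exp_le_exp.2 ?_).trans (Real.exp_one_lt_d9.le.trans (by norm_num))
    rw [div_le_one (by positivity)]
    nlinarith [sq_nonneg v]
  have hvb := hvert b ⟨by linarith, le_rfl⟩ (Real.exp ((2 + q) ^ 2) * Real.exp ((b - β) * y)) fun v => by
    rw [hE, Real.exp_add, mul_comm]
    refine mul_le_mul_of_nonneg_right (Real.exp_le_exp.2 ?_) (Real.exp_nonneg _)
    rw [div_le_iff₀ (by positivity)]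
    nlinarith [sq_nonneg v, hsq b ⟨by linarith, le_rfl⟩]
  have hMs : 2 * (b - a) * M / l ^ 3 ≤ Real.exp (-l) := by
    have h1 : 2 * (b - a) / l ^ 3 ≤ Real.exp (2 * (2 + q)) := by
      refine le_trans ?_ ((Real.add_one_le_exp _).trans' (by linarith : 2 * (2 + q) ≤ _))
      rw [div_le_iff₀ (by positivity)]
      have : l ≤ l ^ 3 := by nlinarith [mul_pos hl0 hl0]
      nlinarith
    calc 2 * (b - a) * M / l ^ 3 = 2 * (b - a) / l ^ 3 * M := by ring
      _ ≤ Real.exp (2 * (2 + q)) * M := by gcongr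
      _ ≤ Real.exp (-l) := by
        rw [hMdef, ← Real.exp_add]
        refine Real.exp_le_exp.2 ?_
        have h2 : Q * l ≤ |Q| * l := mul_le_mul_of_nonneg_right (le_abs_self Q) hl0.le
        have h3 : l ^ 4 ≥ K * l ^ 2 := by
          rw [show l ^ 4 = l ^ 2 * l ^ 2 by ring]
          have : K ≤ l ^ 2 := by nlinarith
          exact mul_le_mul_of_nonneg_right this (by positivity)
        have h4 : l ≤ l ^ 2 := by nlinarith
        have h5 : |Q| * l ≤ |Q| * l ^ 2 := by gcongr
        have h6 : (2 + q) ^ 2 ≤ (2 + q) ^ 2 * l ^ 2 := le_mul_of_one_le_right (by positivity) (by nlinarith)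
        have h7 : 2 * (2 + q) ≤ 2 * (2 + q) * l ^ 2 := le_mul_of_one_le_right (by positivity) (by nlinarith)
        rw [hK] at h3
        linarith
  have i1 : 0 ≤ ∫ v in (-(l ^ 3))..(l ^ 3), ‖f (b + v * Complex.I)‖ :=
    intervalIntegral.integral_nonneg (by have := pow_pos hl0 3; linarith) fun _ _ => norm_nonneg _
  refine key.trans (add_le_add (add_le_add ?_ ?_) hMs)
  · calc _ ≤ 1 / (β - a) * (3 * Real.exp ((a - β) * y) * ∫ v in (-(l ^ 3))..(l ^ 3), ‖f (a + v * Complex.I)‖) :=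
          mul_le_mul_of_nonneg_left hva (by have : 0 < β - a := by linarith
                                            positivity)
      _ = _ := by ring
  · calc _ ≤ 1 * (Real.exp ((2 + q) ^ 2) * Real.exp ((b - β) * y) *
            ∫ v in (-(l ^ 3))..(l ^ 3), ‖f (b + v * Complex.I)‖) := by
          refine mul_le_mul ?_ hvb (intervalIntegral.integral_nonneg
            (by have := pow_pos hl0 3; linarith) fun _ _ => norm_nonneg _) zero_le_one
          rw [div_le_one (by linarith)]
          linarith
      _ = _ := by ring

lemma differentiable_dpoly (S : BeurlingSystem) (c : (ℕ →₀ ℕ) → ℝ) (F : Finset (ℕ →₀ ℕ)) :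
    Differentiable ℂ (S.dpoly c F) := by
  have : S.dpoly c F = fun s => ∑ m ∈ F, (c m : ℂ) * Complex.exp (Complex.log (S.val m) * (-s)) := by
    ext s
    refine sum_congr rfl fun m _ => ?_
    rw [Complex.cpow_def_of_ne_zero (by exact_mod_cast (S.val_pos m).ne')]
  rw [this]
  fun_prop

lemma continuous_dpoly_line (S : BeurlingSystem) (c : (ℕ →₀ ℕ) → ℝ) (F : Finset (ℕ →₀ ℕ)) (σ : ℝ) :
    Continuous fun t : ℝ => S.dpoly c F ((σ : ℂ) + t * Complex.I) :=
  (differentiable_dpoly S c F).continuous.comp (by fun_prop)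

lemma dcount_tsum_nonneg (S : BeurlingSystem) : 0 ≤ ∑' m, dcount m * S.val m ^ (-2 : ℝ) :=
  tsum_nonneg fun m => mul_nonneg (by linarith [one_le_dcount m]) (Real.rpow_nonneg (S.val_pos m).le _)

lemma norm_dpoly_block_le (h : S.WellBehaved θ A Z) {c : (ℕ →₀ ℕ) → ℝ} (hc : ∀ m, |c m| ≤ dcount m)
    (x y : ℝ) {s : ℂ} (hs : 0 ≤ s.re) :
    ‖S.dpoly c (S.block x y) s‖ ≤ y ^ 2 * ∑' m, dcount m * S.val m ^ (-2 : ℝ) := by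
  have hd : ∀ m, 0 ≤ dcount m := fun m => by linarith [one_le_dcount m]
  have hv : ∀ m, 0 ≤ S.val m ^ (-2 : ℝ) := fun m => Real.rpow_nonneg (S.val_pos m).le _
  calc ‖S.dpoly c (S.block x y) s‖
      ≤ ∑ m ∈ S.block x y, ‖(c m : ℂ) * (S.val m : ℂ) ^ (-s)‖ := norm_sum_le _ _
    _ ≤ ∑ m ∈ S.block x y, y ^ 2 * (dcount m * S.val m ^ (-2 : ℝ)) := by
        refine sum_le_sum fun m hm => ?_
        rw [norm_mul, norm_val_cpow, Complex.norm_real, Complex.neg_re]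
        have h1 : S.val m ^ (-s.re) ≤ 1 := Real.rpow_le_one_of_one_le_of_nonpos (S.one_le_val m) (by linarith)
        have h2 : 1 ≤ y ^ 2 * S.val m ^ (-2 : ℝ) := by
          rw [Real.rpow_neg (S.val_pos m).le, Real.rpow_two, ← div_eq_mul_inv,
            one_le_div (pow_pos (S.val_pos m) 2)]
          have := (mem_block h).1 hm
          exact pow_le_pow_left₀ (S.val_pos m).le this.2 2
        calc ‖c m‖ * S.val m ^ (-s.re) ≤ dcount m * 1 :=
              mul_le_mul (hc m) h1 (Real.rpow_nonneg (S.val_pos m).le _) (hd m)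
          _ ≤ dcount m * (y ^ 2 * S.val m ^ (-2 : ℝ)) := mul_le_mul_of_nonneg_left h2 (hd m)
          _ = _ := by ring
    _ ≤ _ := by
        rw [← mul_sum]
        refine mul_le_mul_of_nonneg_left ?_ (by positivity)
        exact (summable_dcount h (by norm_num)).sum_le_tsum _ fun m _ => mul_nonneg (hd m) (hv m)

lemma abs_mob_le_dcount (m : ℕ →₀ ℕ) : |mob m| ≤ dcount m := (abs_mob_le m).trans (one_le_dcount m)

lemma dpoly_block_zero_eq (h : S.WellBehaved θ A Z) (c : (ℕ →₀ ℕ) → ℝ) {X : ℝ} (hX : 0 < X) (s : ℂ) (J : ℕ) :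
    S.dpoly c (S.block 0 (2 ^ J * X)) s =
      S.dpoly c (S.block 0 X) s + ∑ j ∈ range J, S.dpoly c (S.block (2 ^ j * X) (2 * (2 ^ j * X))) s := by
  classical
  induction J with
  | zero => rw [range_zero, sum_empty, add_zero, pow_zero, one_mul]
  | succ J ih =>
    rw [sum_range_succ, ← add_assoc, ← ih]
    have h2 : (2 : ℝ) * (2 ^ J * X) = 2 ^ (J + 1) * X := by ring
    have hle : (2 : ℝ) ^ J * X ≤ 2 ^ (J + 1) * X := by
      have : (0:ℝ) < 2 ^ J * X := by positivity
      linarith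
    have : S.block 0 (2 ^ (J + 1) * X) =
        S.block 0 (2 ^ J * X) ∪ S.block (2 ^ J * X) (2 * (2 ^ J * X)) := by
      ext m
      rw [mem_union, mem_block h, mem_block h, mem_block h, h2]
      have := S.val_pos m
      constructor
      · rintro ⟨a, b⟩
        rcases le_or_gt (S.val m) (2 ^ J * X) with h1 | h1
        · exact Or.inl ⟨a, h1⟩
        · exact Or.inr ⟨h1, b⟩
      · rintro (⟨a, b⟩ | ⟨a, b⟩)
        · exact ⟨a, b.trans hle⟩
        · exact ⟨this, b⟩
    rw [this, dpoly, sum_union]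
    · rfl
    · rw [Finset.disjoint_left]
      intro m hm hm'
      exact absurd ((mem_block h).1 hm).2 (not_le.2 ((mem_block h).1 hm').1)

lemma dpoly_mollified_eq (h : S.WellBehaved θ A Z) {X : ℝ} (hX : 1 ≤ X) (s : ℂ) (J : ℕ) :
    S.dpoly (S.mollified X) (S.block 0 (2 ^ J * X)) s =
      1 + ∑ j ∈ range J, S.dpoly (S.mollified X) (S.block (2 ^ j * X) (2 * (2 ^ j * X))) s := by
  rw [dpoly_block_zero_eq h _ (by linarith), add_left_inj, dpoly, sum_eq_single 0]
  · simp [mollified_zero S hX]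
  · intro m hm hm0
    rw [mollified_eq_zero hm0 ((mem_block h).1 hm).2]; simp
  · intro h0
    exact absurd ((mem_block h).2 ⟨S.val_pos 0, by simpa using hX⟩) h0

lemma norm_zeta_mul_sub_le (h : S.WellBehaved θ A Z) (X : ℝ) {W : ℝ} (hW : 0 < W) {s : ℂ} (hs : 2 ≤ s.re) :
    ‖Z s * S.dpoly mob (S.block 0 X) s - S.dpoly (S.mollified X) (S.block 0 W) s‖ ≤
      W ^ (2 - s.re) * ∑' m, dcount m * S.val m ^ (-2 : ℝ) := by
  have hs1 : 1 < s.re := by linarith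
  have hd : ∀ m, 0 ≤ dcount m := fun m => by linarith [one_le_dcount m]
  have hv : ∀ m, 0 ≤ S.val m ^ (-2 : ℝ) := fun m => Real.rpow_nonneg (S.val_pos m).le _
  have hsum := summable_mollified h X hs1
  have hsd := summable_dcount h (σ := 2) (by norm_num)
  have e1 := hsum.of_norm.sum_add_tsum_subtype_compl (S.block 0 W)
  rw [zeta_mul_dpoly_mob h X hs1, ← e1, dpoly, add_sub_cancel_left]
  have hpt : ∀ m : {m // m ∉ S.block 0 W},
      ‖(S.mollified X m : ℂ) * (S.val m : ℂ) ^ (-s)‖ ≤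
        W ^ (2 - s.re) * (dcount m.1 * S.val m.1 ^ (-2 : ℝ)) := by
    rintro ⟨m, hm⟩
    have hmW : W ≤ S.val m := by
      by_contra! hlt
      exact hm ((mem_block h).2 ⟨S.val_pos m, hlt.le⟩)
    rw [norm_mul, norm_val_cpow, Complex.norm_real, Complex.neg_re]
    have h1 : S.val m ^ (-s.re) = S.val m ^ (2 - s.re) * S.val m ^ (-2 : ℝ) := by
      rw [← Real.rpow_add (S.val_pos m)]; congr 1; ring
    rw [h1]
    calc _ ≤ dcount m * (W ^ (2 - s.re) * S.val m ^ (-2 : ℝ)) := by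
          refine mul_le_mul (abs_mollified_le S X m) (mul_le_mul_of_nonneg_right
            (Real.rpow_le_rpow_of_nonpos hW hmW (by linarith)) (hv m))
            (mul_nonneg (Real.rpow_nonneg (S.val_pos m).le _) (hv m)) (hd m)
      _ = _ := by ring
  have hsub : Summable fun m : {m // m ∉ S.block 0 W} => dcount m.1 * S.val m.1 ^ (-2 : ℝ) :=
    hsd.subtype _
  refine (tsum_of_norm_bounded (hsub.mul_left _).hasSum hpt).trans ?_
  rw [tsum_mul_left]
  refine mul_le_mul_of_nonneg_left ?_ (Real.rpow_nonneg hW.le _)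
  exact hsd.tsum_subtype_le (fun m => dcount m * S.val m ^ (-2 : ℝ)) {m | m ∉ S.block 0 W} fun m => mul_nonneg (hd m) (hv m)

lemma integral_comp_line (f : ℂ → ℝ) (σ γ L : ℝ) :
    ∫ v in (-L)..L, f ((σ : ℂ) + v * Complex.I + γ * Complex.I) =
      ∫ u in (γ - L)..(γ + L), f ((σ : ℂ) + u * Complex.I) := by
  have := intervalIntegral.integral_comp_add_right (a := -L) (b := L)
    (fun u : ℝ => f ((σ : ℂ) + u * Complex.I)) γ
  rw [show γ - L = -L + γ by ring, add_comm γ L, ← this]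
  refine intervalIntegral.integral_congr fun v _ => ?_
  show f _ = f _
  congr 1
  push_cast
  ring

lemma eventually_norm_block_le (h : S.WellBehaved θ A Z) {B : ℝ} (hB : 0 ≤ B) :
    ∀ᶠ T : ℝ in atTop, ∀ X N β γ : ℝ, 1 ≤ N → N ≤ T ^ B → (1 + θ) / 2 < β → β ≤ 1 →
      ‖S.dpoly (S.mollified X) (S.block N (2 * N)) (β + γ * Complex.I)‖ ≤
        3 / (β - (1 + θ) / 2) * N ^ ((1 + θ) / 2 - β) *
          (∫ u in (γ - Real.log T ^ 3)..(γ + Real.log T ^ 3),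
            ‖S.dpoly (S.mollified X) (S.block N (2 * N)) ((((1 + θ) / 2 : ℝ) : ℂ) + u * Complex.I)‖) +
        Real.exp 4 * N ^ (2 - β) *
          (∫ u in (γ - Real.log T ^ 3)..(γ + Real.log T ^ 3),
            ‖S.dpoly (S.mollified X) (S.block N (2 * N)) (((2 : ℝ) : ℂ) + u * Complex.I)‖) + T⁻¹ := by
  obtain ⟨hσθ, hσ1, hσ0⟩ := half_add_mem h
  have h0 := h.nonneg
  set S₂ := ∑' m, dcount m * S.val m ^ (-2 : ℝ)
  have hS₂ : 0 ≤ S₂ := dcount_tsum_nonneg S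
  filter_upwards [eventually_norm_le_smoothed (2 * B + 1) B 0 hB le_rfl, eventually_ge_atTop (4 * S₂),
    eventually_gt_atTop 1] with T hT hTS hT1 X N β γ hN hNB hβ hβ1
  have hT0 : 0 < T := by linarith
  have hbd : ∀ x : ℝ, 0 ≤ x → ∀ v : ℝ, ‖S.dpoly (S.mollified X) (S.block N (2 * N))
      (x + v * Complex.I + γ * Complex.I)‖ ≤ T ^ (2 * B + 1) := by
    intro x hx v
    refine (norm_dpoly_block_le h (abs_mollified_le S X) _ _ (by simpa)).trans ?_
    rw [Real.rpow_add hT0, Real.rpow_one]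
    calc (2 * N) ^ 2 * S₂ = N ^ 2 * (4 * S₂) := by ring
      _ ≤ (T ^ B) ^ 2 * T := by gcongr
      _ = T ^ (2 * B) * T := by
        rw [← Real.rpow_natCast, ← Real.rpow_mul hT0.le]; congr 2; push_cast; ring
  have key := hT (fun w => S.dpoly (S.mollified X) (S.block N (2 * N)) (w + γ * Complex.I))
    ((1 + θ) / 2) 2 β N hN hNB hβ (by linarith) (by linarith) (by linarith)
    ((differentiable_dpoly _ _ _).comp (differentiable_id.add_const _)).differentiableOn
    (fun x hx => ⟨hbd x (hσ0.le.trans hx.1) _, hbd x (hσ0.le.trans hx.1) _⟩)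
  rw [integral_comp_line (fun s => ‖S.dpoly (S.mollified X) (S.block N (2 * N)) s‖),
    integral_comp_line (fun s => ‖S.dpoly (S.mollified X) (S.block N (2 * N)) s‖)] at key
  rwa [show ((2:ℝ) + 0) ^ 2 = 4 by norm_num] at key

set_option maxHeartbeats 1000000 in
lemma eventually_norm_mollified_sub_le (h : S.WellBehaved θ A Z) {B : ℝ} (hB : 0 ≤ B) :
    ∀ᶠ T : ℝ in atTop, ∀ X Y W β γ : ℝ, 1 ≤ X → X ≤ Y → Y ≤ T ^ B → 3 * Y ≤ W → W ≤ 6 * Y →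
      (1 + θ) / 2 < β → β ≤ 1 → 2 * Real.log T ^ 3 ≤ |γ| → |γ| ≤ T →
      ‖Z (β + γ * Complex.I) * S.dpoly mob (S.block 0 X) (β + γ * Complex.I) -
          S.dpoly (S.mollified X) (S.block 0 W) (β + γ * Complex.I)‖ ≤
        3 / (β - (1 + θ) / 2) * Y ^ ((1 + θ) / 2 - β) *
          (∫ u in (γ - Real.log T ^ 3)..(γ + Real.log T ^ 3),
            ‖Z ((((1 + θ) / 2 : ℝ) : ℂ) + u * Complex.I) *
                S.dpoly mob (S.block 0 X) ((((1 + θ) / 2 : ℝ) : ℂ) + u * Complex.I) -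
              S.dpoly (S.mollified X) (S.block 0 W) ((((1 + θ) / 2 : ℝ) : ℂ) + u * Complex.I)‖) +
        1 / 16 := by
  obtain ⟨hσθ, hσ1, hσ0⟩ := half_add_mem h
  have h0 := h.nonneg
  obtain ⟨C, hC, hZb⟩ := exists_zeta_bound h hσθ
  set S₂ := ∑' m, dcount m * S.val m ^ (-2 : ℝ)
  have hS₂ : 0 ≤ S₂ := dcount_tsum_nonneg S
  obtain ⟨q, hq⟩ : ∃ q : ℝ, q = 2 * B + 2 := ⟨_, rfl⟩
  have hq0 : 0 ≤ q := by rw [hq]; linarith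
  filter_upwards [eventually_norm_le_smoothed (2 * B + 3) B q hB hq0,
    eventually_ge_atTop (4 * (C * S₂) + 36 * S₂), eventually_ge_atTop 32,
    eventually_ge_atTop (64 * (Real.exp ((2 + q) ^ 2) * S₂)), eventually_ge_atTop (6 + q),
    eventually_log_ge 1, eventually_log_pow_le_rpow 3 one_pos] with T hT hT1 hT32 hT3 hT4 hl hl3
    X Y W β γ hX hXY hYB hYW hWY hβ hβ1 hγ hγT
  have hT0 : 0 < T := by linarith
  have hY : 1 ≤ Y := hX.trans hXY
  have hW : 0 < W := by linarith
  rw [Real.rpow_one] at hl3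
  set L := Real.log T ^ 3 with hL
  have hlL : Real.log T ≤ L := by
    rw [hL]; nlinarith [mul_nonneg (by linarith : 0 ≤ Real.log T) (by linarith : 0 ≤ Real.log T)]
  have hL1 : 1 ≤ L := hl.trans hlL
  let f : ℂ → ℂ := fun s => Z s * S.dpoly mob (S.block 0 X) s - S.dpoly (S.mollified X) (S.block 0 W) s
  have hbd : ∀ x ∈ Set.Icc ((1 + θ) / 2) (2 + q * Real.log T), ∀ v : ℝ, |v| = L →
      ‖f (x + v * Complex.I + γ * Complex.I)‖ ≤ T ^ (2 * B + 3) := by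
    intro x hx v hv
    set s : ℂ := x + v * Complex.I + γ * Complex.I with hs
    have hsre : s.re = x := by simp [hs]
    have hsim : s.im = v + γ := by simp [hs]
    have hx0 : 0 ≤ x := hσ0.le.trans hx.1
    have him : 1 ≤ |s.im| := by
      rw [hsim]
      have := abs_sub_abs_le_abs_sub γ (-v)
      rw [abs_neg, hv, sub_neg_eq_add, add_comm] at this
      linarith
    have hsn : 1 + ‖s‖ ≤ 2 * T ^ 2 := by
      have h1 := Complex.norm_le_abs_re_add_abs_im s
      rw [hsre, hsim, abs_of_nonneg hx0] at h1
      have h2 := abs_add_le v γ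
      have h3 : q * Real.log T ≤ q * T := by gcongr; linarith
      have h4 := hx.2
      rw [hv] at h2
      nlinarith
    have hX2 : ‖S.dpoly mob (S.block 0 X) s‖ ≤ (T ^ B) ^ 2 * S₂ := by
      refine (norm_dpoly_block_le h abs_mob_le_dcount 0 X (by rwa [hsre])).trans ?_
      have : X ≤ T ^ B := hXY.trans hYB
      gcongr
    have hW2 : ‖S.dpoly (S.mollified X) (S.block 0 W) s‖ ≤ (6 * T ^ B) ^ 2 * S₂ := by
      refine (norm_dpoly_block_le h (abs_mollified_le S X) 0 W (by rwa [hsre])).trans ?_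
      have : W ≤ 6 * T ^ B := by linarith
      gcongr
    have hZs : ‖Z s‖ ≤ C * (2 * T ^ 2) :=
      (hZb s (by rw [hsre]; exact hx.1) him).trans (by gcongr)
    calc ‖f s‖ ≤ ‖Z s‖ * ‖S.dpoly mob (S.block 0 X) s‖ + ‖S.dpoly (S.mollified X) (S.block 0 W) s‖ := by
          rw [← norm_mul]; exact norm_sub_le _ _
      _ ≤ C * (2 * T ^ 2) * ((T ^ B) ^ 2 * S₂) + (6 * T ^ B) ^ 2 * S₂ := by gcongr
      _ = (T ^ B) ^ 2 * (2 * (C * S₂) * T ^ 2 + 36 * S₂) := by ring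
      _ ≤ (T ^ B) ^ 2 * T ^ 3 := by
        have hCS : 0 ≤ C * S₂ := by positivity
        have : 1 ≤ T ^ 2 := by nlinarith
        gcongr
        calc _ ≤ (4 * (C * S₂) + 36 * S₂) * T ^ 2 := by nlinarith
          _ ≤ T * T ^ 2 := by gcongr
          _ = T ^ 3 := by ring
      _ = T ^ (2 * B + 3) := by
        rw [Real.rpow_add hT0, ← Real.rpow_natCast, ← Real.rpow_mul hT0.le, ← Real.rpow_natCast]
        congr 2; push_cast; ring
  have hfd : DifferentiableOn ℂ (fun w => f (w + γ * Complex.I))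
      (Set.Icc ((1 + θ) / 2) (2 + q * Real.log T) ×ℂ Set.Icc (-L) L) := by
    intro w hw
    rw [Complex.mem_reProdIm] at hw
    refine DifferentiableAt.differentiableWithinAt ?_
    refine DifferentiableAt.comp (g := f) w ?_ (differentiableAt_id.add_const _)
    refine DifferentiableAt.sub (DifferentiableAt.mul (differentiableAt_zeta h ?_ ?_)
      (differentiable_dpoly _ _ _ _)) (differentiable_dpoly _ _ _ _)
    · have := hw.1.1
      simp
      linarith
    · intro h1
      have h2 := congrArg Complex.im h1
      simp at h2
      have h3 : |γ| = |w.im| := by rw [show γ = -w.im by linarith, abs_neg]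
      have h4 := abs_le.2 hw.2
      linarith
  have key := hT (fun w => f (w + γ * Complex.I)) ((1 + θ) / 2) (2 + q * Real.log T) β Y hY hYB hβ
    (by linarith) (by nlinarith) (by linarith) hfd (fun x hx => ⟨hbd x hx _ (by
      show |(-L)| = L
      rw [abs_neg, abs_of_pos (by linarith)]), hbd x hx _ (abs_of_pos (by linarith))⟩)
  have hneg : -Real.log T ^ 3 = -L := rfl
  rw [integral_comp_line (fun s => ‖f s‖), integral_comp_line (fun s => ‖f s‖)] at key
  refine key.trans ?_
  rw [add_assoc]
  refine add_le_add le_rfl ?_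
  have h_int : ∫ u in (γ - L)..(γ + L), ‖f (((2 + q * Real.log T : ℝ) : ℂ) + u * Complex.I)‖ ≤
      2 * L * (W ^ (-(q * Real.log T)) * S₂) := by
    have h1 := intervalIntegral.norm_integral_le_of_norm_le_const (a := γ - L) (b := γ + L)
      (f := fun u : ℝ => ‖f (((2 + q * Real.log T : ℝ) : ℂ) + u * Complex.I)‖)
      (C := W ^ (-(q * Real.log T)) * S₂) fun u _ => by
        rw [norm_norm]
        have := norm_zeta_mul_sub_le h X hW (s := ((2 + q * Real.log T : ℝ) : ℂ) + u * Complex.I)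
          (by simp; nlinarith)
        rwa [show (((2 + q * Real.log T : ℝ) : ℂ) + u * Complex.I).re = 2 + q * Real.log T by simp,
          show 2 - (2 + q * Real.log T) = -(q * Real.log T) by ring] at this
    rw [show γ + L - (γ - L) = 2 * L by ring, abs_of_pos (by linarith : 0 < 2 * L), mul_comm _ (2 * L)] at h1
    exact (Real.le_norm_self _).trans h1
  have hql : 0 ≤ q * Real.log T := by positivity
  have hYc : Y ^ (2 + q * Real.log T - β) * W ^ (-(q * Real.log T)) ≤ (T ^ 2)⁻¹ := by
    have h1 : W ^ (-(q * Real.log T)) ≤ Y ^ (-(q * Real.log T)) * T ^ (-q) := by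
      calc W ^ (-(q * Real.log T)) ≤ (Y * 3) ^ (-(q * Real.log T)) :=
            Real.rpow_le_rpow_of_nonpos (by positivity) (by linarith) (by linarith)
        _ = Y ^ (-(q * Real.log T)) * 3 ^ (-(q * Real.log T)) := Real.mul_rpow (by linarith) (by norm_num)
        _ ≤ _ := by
          refine mul_le_mul_of_nonneg_left ?_ (Real.rpow_nonneg (by linarith) _)
          calc (3:ℝ) ^ (-(q * Real.log T)) ≤ (Real.exp 1) ^ (-(q * Real.log T)) :=
                Real.rpow_le_rpow_of_nonpos (Real.exp_pos _)
                  (Real.exp_one_lt_d9.le.trans (by norm_num)) (by linarith)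
            _ = T ^ (-q) := by
              rw [← Real.exp_mul, Real.rpow_def_of_pos hT0]; congr 1; ring
    calc _ ≤ Y ^ (2 + q * Real.log T - β) * (Y ^ (-(q * Real.log T)) * T ^ (-q)) :=
          mul_le_mul_of_nonneg_left h1 (Real.rpow_nonneg (by linarith) _)
      _ = Y ^ (2 - β) * T ^ (-q) := by
          rw [← mul_assoc, ← Real.rpow_add (by linarith)]; congr 2; ring
      _ ≤ Y ^ (2 : ℝ) * T ^ (-q) := by
          refine mul_le_mul_of_nonneg_right ?_ (Real.rpow_nonneg hT0.le _)
          exact Real.rpow_le_rpow_of_exponent_le hY (by linarith)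
      _ ≤ (T ^ B) ^ (2 : ℝ) * T ^ (-q) := by
          refine mul_le_mul_of_nonneg_right ?_ (Real.rpow_nonneg hT0.le _)
          exact Real.rpow_le_rpow (by linarith) hYB (by norm_num)
      _ = (T ^ 2)⁻¹ := by
          rw [← Real.rpow_mul hT0.le, ← Real.rpow_add hT0, ← Real.rpow_natCast, ← Real.rpow_neg hT0.le]
          congr 1; rw [hq]; push_cast; ring
  have hTi : T⁻¹ ≤ 1 / 32 := by rw [one_div]; exact inv_anti₀ (by norm_num) hT32
  have hYp : 0 ≤ Y ^ (2 + q * Real.log T - β) := Real.rpow_nonneg (by linarith) _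
  have hE := Real.exp_nonneg ((2 + q) ^ 2)
  have h2 : Real.exp ((2 + q) ^ 2) * Y ^ (2 + q * Real.log T - β) *
      (∫ u in (γ - L)..(γ + L), ‖f (((2 + q * Real.log T : ℝ) : ℂ) + u * Complex.I)‖) ≤ 1 / 32 := by
    calc _ ≤ Real.exp ((2 + q) ^ 2) * Y ^ (2 + q * Real.log T - β) *
          (2 * L * (W ^ (-(q * Real.log T)) * S₂)) := by gcongr
      _ = 2 * L * (Real.exp ((2 + q) ^ 2) * S₂) *
          (Y ^ (2 + q * Real.log T - β) * W ^ (-(q * Real.log T))) := by ring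
      _ ≤ 2 * T * (Real.exp ((2 + q) ^ 2) * S₂) * (T ^ 2)⁻¹ := by gcongr
      _ ≤ 1 / 32 := by
        rw [← div_eq_mul_inv, div_le_iff₀ (by positivity)]
        nlinarith
  linarith

lemma exists_dyadic {X Y : ℝ} (hX : 1 ≤ X) (hXY : X ≤ Y) :
    ∃ J : ℕ, 3 * Y ≤ 2 ^ J * X ∧ 2 ^ J * X ≤ 6 * Y ∧ (J : ℝ) ≤ 2 * Real.log (6 * Y) ∧
      ∀ j < J, (2 : ℝ) ^ j * X ≤ 6 * Y := by
  have hX0 : 0 < X := by linarith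
  obtain ⟨n, hn1, hn2⟩ := exists_nat_pow_near (x := 3 * Y / X) (y := 2)
    (by rw [le_div_iff₀ hX0]; linarith) one_lt_two
  rw [le_div_iff₀ hX0] at hn1
  rw [div_lt_iff₀ hX0] at hn2
  have h6 : (2 : ℝ) ^ (n + 1) * X ≤ 6 * Y := by rw [pow_succ]; linarith
  refine ⟨n + 1, hn2.le, h6, ?_, fun j hj => le_trans ?_ h6⟩
  · have h1 : (2 : ℝ) ^ (n + 1) ≤ 6 * Y := by
      refine le_trans ?_ h6
      exact le_mul_of_one_le_right (by positivity) hX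
    have h2 := Real.log_le_log (by positivity) h1
    rw [Real.log_pow] at h2
    have := Real.log_two_gt_d9
    have h3 : (0:ℝ) ≤ ((n + 1 : ℕ) : ℝ) := Nat.cast_nonneg _
    nlinarith
  · gcongr
    norm_num

set_option maxHeartbeats 1000000 in
/-- Zeros force large values of the mollified zeta function or of a Dirichlet polynomial. -/
lemma eventually_large_of_zero (h : S.WellBehaved θ A Z) {B : ℝ} (hB : 0 ≤ B) :
    ∀ᶠ T : ℝ in atTop, ∀ (X Y α : ℝ) (ρ : ℂ), 1 ≤ X → X ≤ Y → Y ≤ T ^ B →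
      Real.log T ^ 6 ≤ Y ^ (α - (1 + θ) / 2) → α ≤ ρ.re → ρ.re ≤ 1 → Z ρ = 0 →
      2 * Real.log T ^ 3 ≤ |ρ.im| → |ρ.im| ≤ T →
      (Y ^ (α - (1 + θ) / 2) ≤ Real.log T ^ 4 *
        ∫ u in (ρ.im - Real.log T ^ 3)..(ρ.im + Real.log T ^ 3),
          ‖Z ((((1 + θ) / 2 : ℝ) : ℂ) + u * Complex.I)‖ *
            ‖S.dpoly mob (S.block 0 X) ((((1 + θ) / 2 : ℝ) : ℂ) + u * Complex.I)‖) ∨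
      ∃ (j : ℕ) (σ : ℝ), (j : ℝ) ≤ Real.log T ^ 2 ∧ 2 ^ j * X ≤ 6 * Y ∧ (σ = (1 + θ) / 2 ∨ σ = 2) ∧
        (2 ^ j * X) ^ (α - σ) ≤ Real.log T ^ 4 *
          ∫ u in (ρ.im - Real.log T ^ 3)..(ρ.im + Real.log T ^ 3),
            ‖S.dpoly (S.mollified X) (S.block (2 ^ j * X) (2 * (2 ^ j * X)))
              ((σ : ℂ) + u * Complex.I)‖ := by
  obtain ⟨hσθ, hσ1, hσ0⟩ := half_add_mem h
  filter_upwards [eventually_norm_block_le h (by linarith : 0 ≤ B + 1),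
    eventually_norm_mollified_sub_le h hB, eventually_ge_atTop 6,
    eventually_log_ge (2 * (30 * B + Real.exp 4 + 1) + 1), eventually_log_ge (4 + 2 * B),
    eventually_log_ge 3, eventually_log_pow_le_rpow 3 one_pos] with T hD hM hT6 hlK hlJ hl3 hlT
    X Y α ρ hX hXY hYB hYα hα hρ1 hZρ hγ hγT
  have hT0 : 0 < T := by linarith
  have hY1 : 1 ≤ Y := hX.trans hXY
  have hY0 : 0 < Y := by linarith
  rw [Real.rpow_one] at hlT
  have hlogY : Real.log Y ≤ B * Real.log T := by
    rw [← Real.log_rpow hT0]; exact Real.log_le_log hY0 hYB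
  set l := Real.log T with hl
  have hl0 : 0 < l := by linarith
  set σ0 := (1 + θ) / 2 with hσ0d
  have hP0 : 0 < Y ^ (α - σ0) := Real.rpow_pos_of_pos hY0 _
  have hδ1 : 1 ≤ (α - σ0) * Real.log Y := by
    rw [← Real.log_rpow hY0, Real.le_log_iff_exp_le hP0]
    refine le_trans ?_ hYα
    refine Real.exp_one_lt_d9.le.trans ?_
    have : l ≤ l ^ 6 := le_self_pow₀ (by linarith) (by norm_num)
    linarith
  have hlY0 := Real.log_nonneg hY1
  have hασ : σ0 < α := by nlinarith
  have hβ : σ0 < ρ.re := by linarith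
  have hδ : 3 / (ρ.re - σ0) ≤ 3 * B * l := by
    rw [div_le_iff₀ (by linarith)]
    have h1 : (α - σ0) * Real.log Y ≤ (ρ.re - σ0) * (B * l) := by gcongr
    linarith
  have hBl : 0 ≤ 3 * B * l := by positivity
  obtain ⟨J, hJ3, hJ6, hJl, hJN⟩ := exists_dyadic hX hXY
  have hJ2 : (J : ℝ) ≤ l ^ 2 := by
    refine hJl.trans ?_
    rw [Real.log_mul (by norm_num) hY0.ne']
    have h6 : Real.log 6 ≤ 2 := by
      rw [Real.log_le_iff_le_exp (by norm_num)]
      have : Real.exp 2 = Real.exp 1 ^ 2 := by rw [← Real.exp_nat_mul]; norm_num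
      rw [this]
      have := Real.exp_one_gt_d9
      nlinarith
    nlinarith
  by_contra! hcon
  obtain ⟨hF, hblk⟩ := hcon
  set γ := ρ.im with hγd
  have hρ : ((ρ.re : ℂ) + γ * Complex.I) = ρ := Complex.re_add_im ρ
  let N : ℕ → ℝ := fun j => 2 ^ j * X
  let D : ℕ → ℂ → ℂ := fun j => S.dpoly (S.mollified X) (S.block (N j) (2 * N j))
  have hN1 : ∀ j, 1 ≤ N j := fun j => one_le_mul_of_one_le_of_one_le (one_le_pow₀ one_le_two) hX
  have hNT : ∀ j < J, N j ≤ T ^ (B + 1) := fun j hj => by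
    refine (hJN j hj).trans ?_
    rw [Real.rpow_add hT0, Real.rpow_one]
    nlinarith [Real.rpow_pos_of_pos hT0 B]
  have hjl : ∀ j < J, (j : ℝ) ≤ l ^ 2 := fun j hj => le_trans (by exact_mod_cast hj.le) hJ2
  have hI0 : ∀ j < J, l ^ 4 * ∫ u in (γ - l ^ 3)..(γ + l ^ 3), ‖D j ((σ0 : ℂ) + u * Complex.I)‖ ≤ N j ^ (α - σ0) :=
    fun j hj => (hblk j σ0 (hjl j hj) (hJN j hj) (Or.inl rfl)).le
  have hI2 : ∀ j < J, l ^ 4 * ∫ u in (γ - l ^ 3)..(γ + l ^ 3), ‖D j (((2:ℝ) : ℂ) + u * Complex.I)‖ ≤ N j ^ (α - 2) :=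
    fun j hj => (hblk j 2 (hjl j hj) (hJN j hj) (Or.inr rfl)).le
  have hl4 : 0 < l ^ 4 := by positivity
  have hlow : γ - l ^ 3 ≤ γ + l ^ 3 := by have := pow_pos hl0 3; linarith
  have hinn : ∀ f : ℝ → ℂ, 0 ≤ ∫ u in (γ - l ^ 3)..(γ + l ^ 3), ‖f u‖ := fun f =>
    intervalIntegral.integral_nonneg hlow fun _ _ => norm_nonneg _
  -- the blocks at the zero
  have hDj : ∀ j ∈ range J, ‖D j ρ‖ ≤ (3 * B * l + Real.exp 4) / l ^ 4 + T⁻¹ := by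
    intro j hj
    rw [mem_range] at hj
    have hNp : 0 < N j := by linarith [hN1 j]
    have key := hD X (N j) ρ.re γ (hN1 j) (hNT j hj) hβ hρ1
    rw [hρ] at key
    refine key.trans ?_
    rw [add_div]
    have hle1 : N j ^ (α - ρ.re) ≤ 1 := Real.rpow_le_one_of_one_le_of_nonpos (hN1 j) (by linarith)
    have term : ∀ σ I G : ℝ, 0 ≤ G → l ^ 4 * I ≤ N j ^ (α - σ) → G * N j ^ (σ - ρ.re) * I ≤ G / l ^ 4 := by
      intro σ I G hG hI
      rw [le_div_iff₀ hl4]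
      have hp := Real.rpow_pos_of_pos hNp (σ - ρ.re)
      calc G * N j ^ (σ - ρ.re) * I * l ^ 4 = G * (N j ^ (σ - ρ.re) * (l ^ 4 * I)) := by ring
        _ ≤ G * (N j ^ (σ - ρ.re) * N j ^ (α - σ)) := by gcongr
        _ = G * N j ^ (α - ρ.re) := by rw [← Real.rpow_add hNp]; congr 2; ring
        _ ≤ G := mul_le_of_le_one_right hG hle1
    refine add_le_add (add_le_add ?_ (term 2 _ _ (Real.exp_nonneg _) (hI2 j hj))) le_rfl
    refine (term σ0 _ _ (by have : 0 < ρ.re - σ0 := by linarith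
                            positivity) (hI0 j hj)).trans ?_
    gcongr
  -- the mollified zeta function
  have hmain := hM X Y (2 ^ J * X) ρ.re γ hX hXY hYB hJ3 hJ6 hβ hρ1 hγ hγT
  rw [hρ, hZρ, zero_mul, zero_sub, norm_neg] at hmain
  set IF := ∫ u in (γ - l ^ 3)..(γ + l ^ 3), ‖Z ((σ0 : ℂ) + u * Complex.I)‖ *
      ‖S.dpoly mob (S.block 0 X) ((σ0 : ℂ) + u * Complex.I)‖ with hIF
  have h_int : (∫ u in (γ - l ^ 3)..(γ + l ^ 3),
      ‖Z ((σ0 : ℂ) + u * Complex.I) * S.dpoly mob (S.block 0 X) ((σ0 : ℂ) + u * Complex.I) -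
        S.dpoly (S.mollified X) (S.block 0 (2 ^ J * X)) ((σ0 : ℂ) + u * Complex.I)‖) ≤
      IF + (2 * l ^ 3 + ∑ j ∈ range J, ∫ u in (γ - l ^ 3)..(γ + l ^ 3), ‖D j ((σ0 : ℂ) + u * Complex.I)‖) := by
    have c1 := continuous_zeta_line h hσθ hσ1.ne
    have c2 := continuous_dpoly_line S mob (S.block 0 X) σ0
    have c3 := continuous_dpoly_line S (S.mollified X) (S.block 0 (2 ^ J * X)) σ0
    have c4 : ∀ j, Continuous fun u : ℝ => D j ((σ0 : ℂ) + u * Complex.I) := fun j =>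
      continuous_dpoly_line S (S.mollified X) _ σ0
    have c5 : Continuous fun u : ℝ => ∑ j ∈ range J, ‖D j ((σ0 : ℂ) + u * Complex.I)‖ :=
      continuous_finsetSum _ fun j _ => (c4 j).norm
    have c6 : Continuous fun u : ℝ => ‖Z ((σ0 : ℂ) + u * Complex.I)‖ *
        ‖S.dpoly mob (S.block 0 X) ((σ0 : ℂ) + u * Complex.I)‖ := c1.norm.mul c2.norm
    have c7 : Continuous fun u : ℝ => (1 + ∑ j ∈ range J, ‖D j ((σ0 : ℂ) + u * Complex.I)‖) :=
      continuous_const.add c5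
    calc _ ≤ ∫ u in (γ - l ^ 3)..(γ + l ^ 3), (‖Z ((σ0 : ℂ) + u * Complex.I)‖ *
            ‖S.dpoly mob (S.block 0 X) ((σ0 : ℂ) + u * Complex.I)‖ +
            (1 + ∑ j ∈ range J, ‖D j ((σ0 : ℂ) + u * Complex.I)‖)) := by
          refine intervalIntegral.integral_mono_on hlow (((c1.mul c2).sub c3).norm.intervalIntegrable _ _)
            ((c6.add c7).intervalIntegrable _ _) fun u _ => ?_
          refine (norm_sub_le _ _).trans (add_le_add (norm_mul _ _).le ?_)
          rw [dpoly_mollified_eq h hX]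
          refine (norm_add_le _ _).trans (add_le_add (by simp) (norm_sum_le _ _))
      _ = _ := by
          rw [intervalIntegral.integral_add (c6.intervalIntegrable _ _) (c7.intervalIntegrable _ _),
            intervalIntegral.integral_add (by simp) (c5.intervalIntegrable _ _),
            intervalIntegral.integral_finsetSum fun j _ => (c4 j).norm.intervalIntegrable _ _,
            intervalIntegral.integral_const, smul_eq_mul]
          ring
  have hsumI : ∑ j ∈ range J, ∫ u in (γ - l ^ 3)..(γ + l ^ 3), ‖D j ((σ0 : ℂ) + u * Complex.I)‖ ≤
      l ^ 2 * (6 * Y ^ (α - σ0) / l ^ 4) := by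
    calc _ ≤ ∑ j ∈ range J, 6 * Y ^ (α - σ0) / l ^ 4 := by
          refine sum_le_sum fun j hj => ?_
          rw [mem_range] at hj
          rw [le_div_iff₀ hl4, mul_comm]
          refine (hI0 j hj).trans ?_
          calc N j ^ (α - σ0) ≤ (6 * Y) ^ (α - σ0) :=
                Real.rpow_le_rpow (by linarith [hN1 j]) (hJN j hj) (by linarith)
            _ = 6 ^ (α - σ0) * Y ^ (α - σ0) := Real.mul_rpow (by norm_num) hY0.le
            _ ≤ 6 ^ (1 : ℝ) * Y ^ (α - σ0) := by
              gcongr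
              · norm_num
              · linarith
            _ = _ := by rw [Real.rpow_one]
      _ = J * (6 * Y ^ (α - σ0) / l ^ 4) := by rw [sum_const, card_range, nsmul_eq_mul]
      _ ≤ _ := by gcongr
  have hD' : ‖S.dpoly (S.mollified X) (S.block 0 (2 ^ J * X)) ρ‖ ≤ 27 * B / l + 1 / 16 := by
    refine hmain.trans (add_le_add ?_ le_rfl)
    have hYr : Y ^ (σ0 - ρ.re) ≤ (Y ^ (α - σ0))⁻¹ := by
      rw [← Real.rpow_neg hY0.le]
      exact Real.rpow_le_rpow_of_exponent_le hY1 (by linarith)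
    have hYr0 := Real.rpow_pos_of_pos hY0 (σ0 - ρ.re)
    generalize Y ^ (α - σ0) = P at *
    have htot : IF + (2 * l ^ 3 + ∑ j ∈ range J, ∫ u in (γ - l ^ 3)..(γ + l ^ 3), ‖D j ((σ0 : ℂ) + u * Complex.I)‖) ≤
        9 * P / l ^ 2 := by
      have t1 : IF ≤ P / l ^ 2 := by
        rw [le_div_iff₀ (by positivity)]
        have : 0 ≤ IF := intervalIntegral.integral_nonneg hlow fun _ _ => by positivity
        have h2 : l ^ 2 ≤ l ^ 4 := pow_le_pow_right₀ (by linarith) (by norm_num)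
        nlinarith
      have t2 : 2 * l ^ 3 ≤ 2 * P / l ^ 2 := by
        rw [le_div_iff₀ (by positivity)]
        have : l ^ 5 ≤ l ^ 6 := pow_le_pow_right₀ (by linarith) (by norm_num)
        nlinarith
      have t3 : l ^ 2 * (6 * P / l ^ 4) = 6 * P / l ^ 2 := by field_simp
      rw [t3] at hsumI
      calc _ ≤ P / l ^ 2 + (2 * P / l ^ 2 + 6 * P / l ^ 2) := by gcongr
        _ = _ := by ring
    have h3δ : 0 ≤ 3 / (ρ.re - σ0) := by
      have : 0 < ρ.re - σ0 := by linarith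
      positivity
    calc _ ≤ 3 * B * l * P⁻¹ * (9 * P / l ^ 2) := by
          refine mul_le_mul (mul_le_mul hδ hYr hYr0.le hBl) (h_int.trans htot) (hinn _) (by positivity)
      _ = 27 * B / l := by field_simp; ring
  have hone : (1 : ℝ) ≤ ‖S.dpoly (S.mollified X) (S.block 0 (2 ^ J * X)) ρ‖ + ∑ j ∈ range J, ‖D j ρ‖ := by
    rw [dpoly_mollified_eq h hX]
    have := norm_sub_le (1 + ∑ j ∈ range J, D j ρ) (∑ j ∈ range J, D j ρ)
    rw [add_sub_cancel_right, norm_one] at this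
    exact this.trans (add_le_add le_rfl (norm_sum_le _ _))
  have hsumD : ∑ j ∈ range J, ‖D j ρ‖ ≤ (3 * B + Real.exp 4 + 1) / l := by
    calc _ ≤ ∑ j ∈ range J, ((3 * B * l + Real.exp 4) / l ^ 4 + T⁻¹) := sum_le_sum hDj
      _ = J * ((3 * B * l + Real.exp 4) / l ^ 4 + T⁻¹) := by rw [sum_const, card_range, nsmul_eq_mul]
      _ ≤ l ^ 2 * ((3 * B * l + Real.exp 4 * l) / l ^ 4 + (l ^ 3)⁻¹) := by
        gcongr
        exact le_mul_of_one_le_right (Real.exp_nonneg _) (by linarith)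
      _ = _ := by field_simp
  have hfin : (30 * B + Real.exp 4 + 1) / l < 1 / 2 := by
    rw [div_lt_iff₀ hl0]; linarith
  have : 27 * B / l + (3 * B + Real.exp 4 + 1) / l = (30 * B + Real.exp 4 + 1) / l := by ring
  linarith

lemma dpoly_shift (S : BeurlingSystem) (c : (ℕ →₀ ℕ) → ℝ) (F : Finset (ℕ →₀ ℕ)) (σ t : ℝ) :
    S.dpoly c F ((σ : ℂ) + t * Complex.I) = S.dpoly (fun m => c m * S.val m ^ (-σ)) F (t * Complex.I) := by
  refine sum_congr rfl fun m _ => ?_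
  have h0 : (S.val m : ℂ) ≠ 0 := by exact_mod_cast (S.val_pos m).ne'
  rw [neg_add, Complex.cpow_add _ _ h0, Complex.ofReal_mul, Complex.ofReal_cpow (S.val_pos m).le]
  push_cast
  ring

lemma eventually_sum_sq_le (h : S.WellBehaved θ A Z) (B : ℝ) :
    ∀ᶠ T : ℝ in atTop, ∀ N σ : ℝ, 1 / 2 ≤ N → N ≤ T ^ B → 0 ≤ σ → ∀ c : (ℕ →₀ ℕ) → ℝ,
      (∀ m, |c m| ≤ dcount m) →
      ∑ m ∈ S.block N (2 * N), (c m * S.val m ^ (-σ)) ^ 2 ≤ N ^ (1 - 2 * σ) * Real.log T ^ 5 := by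
  filter_upwards [exists_sum_dcount_sq_le h (B + 1), eventually_ge_atTop 2] with T hT hT2 N σ hN hNB hσ c hc
  have hN0 : 0 < N := by linarith
  have hT0 : 0 < T := by linarith
  have h1 := hT N hN (by
    rw [Real.rpow_add hT0, Real.rpow_one]
    nlinarith [Real.rpow_pos_of_pos hT0 B])
  calc _ ≤ ∑ m ∈ S.block N (2 * N), N ^ (-(2 * σ)) * dcount m ^ 2 := by
        refine sum_le_sum fun m hm => ?_
        have hv := S.val_pos m
        have hb := (mem_block h).1 hm
        rw [mul_pow, mul_comm, ← Real.rpow_natCast (S.val m ^ (-σ)), ← Real.rpow_mul hv.le]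
        refine mul_le_mul ?_ ?_ (sq_nonneg _) (Real.rpow_nonneg hN0.le _)
        · rw [show -σ * ((2 : ℕ) : ℝ) = -(2 * σ) by push_cast; ring]
          exact Real.rpow_le_rpow_of_nonpos hN0 hb.1.le (by linarith)
        · exact sq_le_sq' (by linarith [(abs_le.1 (hc m)).1]) (abs_le.1 (hc m)).2
    _ = N ^ (-(2 * σ)) * ∑ m ∈ S.block N (2 * N), dcount m ^ 2 := by rw [mul_sum]
    _ ≤ N ^ (-(2 * σ)) * (N * Real.log T ^ 5) :=
        mul_le_mul_of_nonneg_left h1 (Real.rpow_nonneg hN0.le _)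
    _ = _ := by
        rw [sub_eq_add_neg, Real.rpow_add hN0, Real.rpow_one]; ring

/-- The mean square of a Dirichlet polynomial over a dyadic block. -/
lemma exists_mean_square_le (h : S.WellBehaved θ A Z) (B : ℝ) :
    ∀ᶠ T : ℝ in atTop, ∀ N σ : ℝ, 1 / 2 ≤ N → N ≤ T ^ B → 0 ≤ σ → ∀ c : (ℕ →₀ ℕ) → ℝ,
      (∀ m, |c m| ≤ dcount m) →
      ∫ t in (-(2 * T))..(2 * T), ‖S.dpoly c (S.block N (2 * N)) ((σ : ℂ) + t * Complex.I)‖ ^ 2 ≤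
        Real.log T ^ 6 * ((N + T * N ^ θ) * N ^ (1 - 2 * σ)) := by
  obtain ⟨C, hC, hmv⟩ := exists_mean_value h
  filter_upwards [eventually_sum_sq_le h B, eventually_gt_atTop 0, eventually_log_ge (2 * C)] with
    T hT hT0 hl N σ hN hNB hσ c hc
  have hN0 : 0 < N := by linarith
  have hl0 : 0 < Real.log T := by linarith
  simp_rw [dpoly_shift]
  have hNθ := Real.rpow_pos_of_pos hN0 θ
  have hNσ := Real.rpow_pos_of_pos hN0 (1 - 2 * σ)
  refine (hmv N (2 * T) hN (by linarith) _).trans ?_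
  calc _ ≤ C * (N + 2 * T * N ^ θ) * (N ^ (1 - 2 * σ) * Real.log T ^ 5) := by
        gcongr
        exact hT N σ hN hNB hσ c hc
    _ ≤ C * (2 * (N + T * N ^ θ)) * (N ^ (1 - 2 * σ) * Real.log T ^ 5) := by
        gcongr
        linarith
    _ = (2 * C) * Real.log T ^ 5 * ((N + T * N ^ θ) * N ^ (1 - 2 * σ)) := by ring
    _ ≤ Real.log T * Real.log T ^ 5 * ((N + T * N ^ θ) * N ^ (1 - 2 * σ)) := by gcongr
    _ = _ := by ring

/-- Counting by mean values. -/
lemma eventually_card_le_mean_value (h : S.WellBehaved θ A Z) (B : ℝ) :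
    ∀ᶠ T : ℝ in atTop, ∀ N σ V : ℝ, 1 / 2 ≤ N → N ≤ T ^ B → 0 ≤ σ → 0 < V → ∀ c : (ℕ →₀ ℕ) → ℝ,
      (∀ m, |c m| ≤ dcount m) → ∀ F : Finset ℂ, (∀ x ∈ F, |x.im| ≤ T) →
      (∀ x ∈ F, ∀ y ∈ F, x ≠ y → 4 * Real.log T ^ 3 ≤ |x.im - y.im|) →
      (∀ x ∈ F, V ≤ ∫ u in (x.im - Real.log T ^ 3)..(x.im + Real.log T ^ 3),
        ‖S.dpoly c (S.block N (2 * N)) ((σ : ℂ) + u * Complex.I)‖) →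
      (F.card : ℝ) ≤ Real.log T ^ 10 * ((N + T * N ^ θ) * N ^ (1 - 2 * σ) / V ^ 2) := by
  filter_upwards [exists_mean_square_le h B, eventually_gt_atTop 0, eventually_log_ge 8,
    eventually_log_pow_le_rpow 3 one_pos] with T hT hT0 hl hlT N σ V hN hNB hσ hV c hc F hF hsep hbig
  rw [Real.rpow_one] at hlT
  have hl0 : 0 < Real.log T := by linarith
  have hL : 0 < Real.log T ^ 3 := by positivity
  have key := card_windows_le (continuous_dpoly_line S c (S.block N (2 * N)) σ).norm
    (fun _ => norm_nonneg _) hL hV one_le_two F Complex.im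
    (fun x hx y hy hxy => by linarith [hsep x hx y hy hxy]) (T := 2 * T)
    (fun x hx => by linarith [hF x hx]) (by linarith) hbig
  simp_rw [Real.rpow_two] at key
  refine key.trans ?_
  rw [show (2:ℝ) - 1 = 1 by norm_num, Real.rpow_one, Real.rpow_neg hV.le, Real.rpow_two]
  calc _ ≤ 2 * (4 * Real.log T ^ 3) * (V ^ 2)⁻¹ *
        (Real.log T ^ 6 * ((N + T * N ^ θ) * N ^ (1 - 2 * σ))) := by
        gcongr
        exact hT N σ hN hNB hσ c hc
    _ = 8 * Real.log T ^ 9 * ((N + T * N ^ θ) * N ^ (1 - 2 * σ) / V ^ 2) := by ring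
    _ ≤ Real.log T * Real.log T ^ 9 * ((N + T * N ^ θ) * N ^ (1 - 2 * σ) / V ^ 2) := by
        have : 0 < N := by linarith
        have := Real.rpow_pos_of_pos this θ
        have := Real.rpow_pos_of_pos ‹0 < N› (1 - 2 * σ)
        gcongr
    _ = _ := by ring

/-- Counting by the large value estimate. -/
lemma exists_card_le_large_values (h : S.WellBehaved θ A Z) {k ck : ℝ} (hk : 1 ≤ k)
    (hmom : ∃ C : ℝ, ∀ T : ℝ, 2 ≤ T →
      (1 / T) * (∫ t in (0:ℝ)..T, ‖Z ((((1 + θ) / 2 : ℝ) : ℂ) + Complex.I * (t : ℂ))‖ ^ (2 * k)) ≤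
        C * Real.log T ^ ck) (B : ℝ) :
    ∃ n : ℕ, ∀ᶠ T : ℝ in atTop, ∀ N σ V : ℝ, 1 / 2 ≤ N → N ≤ T ^ B → 0 ≤ σ → 0 < V →
      N ^ (1 - 2 * σ) ≤ T ^ B * V ^ 2 → ∀ c : (ℕ →₀ ℕ) → ℝ,
      (∀ m, |c m| ≤ dcount m) → ∀ (F : Finset ℂ) (τ : ℂ → ℝ), (∀ x ∈ F, |τ x| ≤ 3 / 2 * T) →
      (∀ x ∈ F, ∀ y ∈ F, x ≠ y → 2 * Real.log T ^ 3 ≤ |τ x - τ y|) →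
      (∀ x ∈ F, V ≤ ‖S.dpoly c (S.block N (2 * N)) ((σ : ℂ) + τ x * Complex.I)‖) →
      (F.card : ℝ) ≤ Real.log T ^ n * (N ^ (2 - 2 * σ) / V ^ 2 +
        T * (N ^ (1 - 2 * σ + (1 + θ) / 2) / V ^ 2) ^ (2 * k)) := by
  obtain ⟨n, hn⟩ := exists_large_values h hk hmom (|B| + 1)
  obtain ⟨K, hK⟩ := exists_nat_ge (2 * k)
  refine ⟨n + 5 * (K + 1), ?_⟩
  filter_upwards [hn, eventually_sum_sq_le h B, eventually_ge_atTop 1, eventually_log_ge 1,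
    eventually_log_pow_le_rpow 5 one_pos] with T hT hS hT1 hl hl5 N σ V hN hNB hσ hV hNV c hc F τ hτ hsep hbig
  rw [Real.rpow_one] at hl5
  have hT0 : 0 < T := by linarith
  have hN0 : 0 < N := by linarith
  have hl0 : 0 < Real.log T := by linarith
  have hsum := hS N σ hN hNB hσ c hc
  have hB1 : T ^ B ≤ T ^ (|B|) := Real.rpow_le_rpow_of_exponent_le hT1 (le_abs_self B)
  simp_rw [dpoly_shift] at hbig
  set s := ∑ m ∈ S.block N (2 * N), (c m * S.val m ^ (-σ)) ^ 2 with hs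
  have hs0 : 0 ≤ s := sum_nonneg fun _ _ => sq_nonneg _
  have key := hT N V hN (hNB.trans (hB1.trans (Real.rpow_le_rpow_of_exponent_le hT1 (by linarith)))) hV _
    (by
      rw [Real.rpow_add hT0, Real.rpow_one]
      calc s ≤ N ^ (1 - 2 * σ) * Real.log T ^ 5 := hsum
        _ ≤ (T ^ B * V ^ 2) * T := by gcongr
        _ ≤ (T ^ |B| * V ^ 2) * T := by gcongr
        _ = _ := by ring) F τ hτ hsep hbig
  refine key.trans ?_
  rw [pow_add, mul_assoc]
  gcongr
  have hN1 := Real.rpow_pos_of_pos hN0 (1 - 2 * σ)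
  have hq : 1 ≤ Real.log T ^ 5 := one_le_pow₀ hl
  have hq2 : (Real.log T ^ 5) ^ (2 * k) ≤ Real.log T ^ (5 * (K + 1)) := by
    rw [pow_mul, ← Real.rpow_natCast (Real.log T ^ 5) (K + 1)]
    exact Real.rpow_le_rpow_of_exponent_le hq (by push_cast; linarith)
  have hq1 : Real.log T ^ 5 ≤ Real.log T ^ (5 * (K + 1)) :=
    pow_le_pow_right₀ hl (by omega)
  rw [mul_add]
  refine add_le_add ?_ ?_
  · calc s * N / V ^ 2 ≤ N ^ (1 - 2 * σ) * Real.log T ^ 5 * N / V ^ 2 := by gcongr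
      _ = Real.log T ^ 5 * (N ^ (1 - 2 * σ) * N / V ^ 2) := by ring
      _ = Real.log T ^ 5 * (N ^ (2 - 2 * σ) / V ^ 2) := by
        rw [show 2 - 2 * σ = (1 - 2 * σ) + 1 by ring, Real.rpow_add hN0, Real.rpow_one]
      _ ≤ _ := by
        have := Real.rpow_pos_of_pos hN0 (2 - 2 * σ)
        gcongr
  · have hNs := Real.rpow_pos_of_pos hN0 ((1 + θ) / 2)
    have hNs' := Real.rpow_pos_of_pos hN0 (1 - 2 * σ + (1 + θ) / 2)
    calc T * (s * N ^ ((1 + θ) / 2) / V ^ 2) ^ (2 * k)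
        ≤ T * (N ^ (1 - 2 * σ) * Real.log T ^ 5 * N ^ ((1 + θ) / 2) / V ^ 2) ^ (2 * k) := by gcongr
      _ = T * (Real.log T ^ 5 * (N ^ (1 - 2 * σ + (1 + θ) / 2) / V ^ 2)) ^ (2 * k) := by
        rw [Real.rpow_add hN0]; congr 2; ring
      _ = (Real.log T ^ 5) ^ (2 * k) * (T * (N ^ (1 - 2 * σ + (1 + θ) / 2) / V ^ 2) ^ (2 * k)) := by
        rw [Real.mul_rpow (by positivity) (by positivity)]; ring
      _ ≤ _ := by gcongr

/-- A large integral over a window produces a large value in it. -/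
lemma exists_large_value_of_integral {g : ℝ → ℝ} (hg : Continuous g) {γ L V : ℝ} (hL : 0 < L)
    (hV : V ≤ ∫ u in (γ - L)..(γ + L), g u) : ∃ u, |u - γ| ≤ L ∧ V / (2 * L) ≤ g u := by
  by_contra! hcon
  have hlt : ∫ u in (γ - L)..(γ + L), g u < ∫ u in (γ - L)..(γ + L), V / (2 * L) := by
    refine intervalIntegral.integral_lt_integral_of_continuousOn_of_le_of_exists_lt (by linarith)
      hg.continuousOn continuousOn_const (fun u hu => (hcon u ?_).le) ⟨γ, ⟨by linarith, by linarith⟩, hcon γ (by simpa using hL.le)⟩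
    rw [abs_le]; constructor <;> linarith [hu.1, hu.2]
  rw [intervalIntegral.integral_const, smul_eq_mul] at hlt
  have : (γ + L - (γ - L)) * (V / (2 * L)) = V := by field_simp; ring
  linarith

lemma card_le_of_cover {ι : Type*} (F : Finset ι) (P : ι → Prop) (Q : ℕ → ℝ → ι → Prop) {a b l M : ℝ}
    (hl : 0 ≤ l) (hcov : ∀ x ∈ F, P x ∨ ∃ (j : ℕ) (σ : ℝ), (j : ℝ) ≤ l ∧ (σ = a ∨ σ = b) ∧ Q j σ x)
    (hP : ∀ G ⊆ F, (∀ x ∈ G, P x) → (G.card : ℝ) ≤ M)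
    (hQ : ∀ (j : ℕ) (σ : ℝ), (j : ℝ) ≤ l → (σ = a ∨ σ = b) → ∀ G ⊆ F, (∀ x ∈ G, Q j σ x) → (G.card : ℝ) ≤ M) :
    (F.card : ℝ) ≤ (2 * l + 3) * M := by
  classical
  have hM : 0 ≤ M := by simpa using hP ∅ (empty_subset _) (by simp)
  let I := range (⌊l⌋₊ + 1) ×ˢ ({a, b} : Finset ℝ)
  have hsub : F ⊆ F.filter P ∪ I.biUnion fun q => F.filter (Q q.1 q.2) := by
    intro x hx
    rw [mem_union, mem_biUnion]
    rcases hcov x hx with hp | ⟨j, σ, hj, hσ, hq⟩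
    · exact Or.inl (mem_filter.2 ⟨hx, hp⟩)
    · refine Or.inr ⟨(j, σ), ?_, mem_filter.2 ⟨hx, hq⟩⟩
      simp only [I, mem_product, mem_range, mem_insert, mem_singleton]
      exact ⟨Nat.lt_succ_of_le (Nat.le_floor hj), hσ⟩
  have h1 : F.card ≤ (F.filter P).card + ∑ q ∈ I, (F.filter (Q q.1 q.2)).card :=
    (card_le_card hsub).trans ((card_union_le _ _).trans (add_le_add le_rfl card_biUnion_le))
  have h2 : (∑ q ∈ I, (F.filter (Q q.1 q.2)).card : ℝ) ≤ ∑ q ∈ I, M := by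
    refine sum_le_sum fun q hq => ?_
    simp only [I, mem_product, mem_range, mem_insert, mem_singleton] at hq
    refine hQ q.1 q.2 ?_ hq.2 _ (filter_subset _ _) fun x hx => (mem_filter.1 hx).2
    exact (Nat.le_floor_iff hl).1 (Nat.lt_succ_iff.1 hq.1)
  have h3 : (I.card : ℝ) ≤ (l + 1) * 2 := by
    simp only [I, card_product, card_range]
    push_cast
    have := Nat.floor_le hl
    have h4 : (({a, b} : Finset ℝ).card : ℝ) ≤ 2 := by exact_mod_cast card_le_two
    gcongr
  have h5 : (F.card : ℝ) ≤ (F.filter P).card + ∑ q ∈ I, ((F.filter (Q q.1 q.2)).card : ℝ) := by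
    exact_mod_cast h1
  rw [sum_const, nsmul_eq_mul] at h2
  have h6 := hP (F.filter P) (filter_subset _ _) fun x hx => (mem_filter.1 hx).2
  nlinarith

/-- Decomposition of an initial segment into dyadic blocks. -/
lemma eventually_exists_dyadic_blocks (h : S.WellBehaved θ A Z) {B : ℝ} :
    ∀ᶠ T : ℝ in atTop, ∀ X : ℝ, 1 ≤ X → X ≤ T ^ B → ∃ (J : ℕ) (W : ℝ), (J : ℝ) ≤ Real.log T ^ 2 ∧ 1 / 2 ≤ W ∧
      (∀ j < J, 2 ^ j * W ≤ X) ∧ ∀ (c : (ℕ →₀ ℕ) → ℝ) (s : ℂ), S.dpoly c (S.block 0 X) s =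
        ∑ j ∈ range J, S.dpoly c (S.block (2 ^ j * W) (2 * (2 ^ j * W))) s := by
  filter_upwards [eventually_log_ge (4 + 4 * |B|), eventually_gt_atTop 0] with T hl hT X hX hXT
  have hl1 : 4 ≤ Real.log T := by linarith [abs_nonneg B]
  obtain ⟨n, hn1, hn2⟩ := exists_nat_pow_near hX (by norm_num : (1 : ℝ) < 2)
  have hp : (0 : ℝ) < 2 ^ (n + 1) := by positivity
  have hW : (2 : ℝ) ^ (n + 1) * (X / 2 ^ (n + 1)) = X := by field_simp
  have hW1 : X / 2 ^ (n + 1) < 1 := by rwa [div_lt_one hp]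
  have hW2 : 1 / 2 ≤ X / 2 ^ (n + 1) := by
    rw [le_div_iff₀ hp, pow_succ]; linarith
  refine ⟨n + 1, X / 2 ^ (n + 1), ?_, hW2, ?_, ?_⟩
  · have h1 : (n : ℝ) * Real.log 2 ≤ Real.log X := by
      rw [← Real.log_pow]; exact Real.log_le_log (by positivity) hn1
    have h2 : Real.log X ≤ B * Real.log T := by
      rw [← Real.log_rpow hT]; exact Real.log_le_log (by linarith) hXT
    have h3 : (1 : ℝ) / 2 ≤ Real.log 2 := by linarith [Real.log_two_gt_d9]
    have h4 : B * Real.log T ≤ |B| * Real.log T :=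
      mul_le_mul_of_nonneg_right (le_abs_self B) (by linarith)
    have h5 : (n : ℝ) * (1 / 2) ≤ n * Real.log 2 := by gcongr
    push_cast
    nlinarith [abs_nonneg B]
  · intro j hj
    calc (2 : ℝ) ^ j * (X / 2 ^ (n + 1)) ≤ 2 ^ (n + 1) * (X / 2 ^ (n + 1)) := by
          gcongr; norm_num
      _ = X := hW
  · intro c s
    have := dpoly_block_zero_eq h c (lt_of_lt_of_le (by norm_num) hW2) s (n + 1)
    rw [hW] at this
    rw [this]
    have hb : S.block 0 (X / 2 ^ (n + 1)) = ∅ := by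
      refine Finset.eq_empty_of_forall_notMem fun m hm => ?_
      have := (mem_block h).1 hm
      linarith [S.one_le_val m, this.2]
    simp [hb, dpoly]

/-- Mean square of the mollifier. -/
lemma eventually_mean_square_mob_le (h : S.WellBehaved θ A Z) (B : ℝ) :
    ∀ᶠ T : ℝ in atTop, ∀ X : ℝ, 1 ≤ X → X ≤ T ^ B →
      ∫ t in (-(2 * T))..(2 * T), ‖S.dpoly mob (S.block 0 X) ((((1 + θ) / 2 : ℝ) : ℂ) + t * Complex.I)‖ ^ 2 ≤
        Real.log T ^ 10 * (X ^ (1 - θ) + T) := by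
  filter_upwards [eventually_exists_dyadic_blocks h (B := B), exists_mean_square_le h B,
    eventually_log_ge 1, eventually_gt_atTop 0] with T h1 h2 hl hT X hX hXT
  obtain ⟨J, W, hJ, hW, hjX, hd⟩ := h1 X hX hXT
  have hθ := h.lt_one
  have hθ0 := h.nonneg
  have hc : ∀ j : ℕ, Continuous fun t : ℝ => ‖S.dpoly mob (S.block (2 ^ j * W) (2 * (2 ^ j * W)))
      ((((1 + θ) / 2 : ℝ) : ℂ) + t * Complex.I)‖ ^ 2 := fun j =>
    (continuous_dpoly_line S mob _ _).norm.pow 2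
  calc _ ≤ ∫ t in (-(2 * T))..(2 * T), (J : ℝ) * ∑ j ∈ range J,
        ‖S.dpoly mob (S.block (2 ^ j * W) (2 * (2 ^ j * W)))
          ((((1 + θ) / 2 : ℝ) : ℂ) + t * Complex.I)‖ ^ 2 := by
        refine intervalIntegral.integral_mono (by linarith)
          (((continuous_dpoly_line S mob _ _).norm.pow 2).intervalIntegrable _ _)
          ((continuous_const.mul (continuous_finsetSum _ fun j _ => hc j)).intervalIntegrable _ _) ?_
        intro t
        have hcs := sq_sum_le_card_mul_sum_sq (s := range J) (f := fun j =>
          ‖S.dpoly mob (S.block (2 ^ j * W) (2 * (2 ^ j * W))) ((((1 + θ) / 2 : ℝ) : ℂ) + t * Complex.I)‖)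
        rw [card_range] at hcs
        refine le_trans ?_ hcs
        dsimp only
        rw [hd]
        exact pow_le_pow_left₀ (norm_nonneg _) (norm_sum_le _ _) 2
    _ = J * ∑ j ∈ range J, ∫ t in (-(2 * T))..(2 * T),
        ‖S.dpoly mob (S.block (2 ^ j * W) (2 * (2 ^ j * W)))
          ((((1 + θ) / 2 : ℝ) : ℂ) + t * Complex.I)‖ ^ 2 := by
        rw [intervalIntegral.integral_const_mul, intervalIntegral.integral_finsetSum]
        exact fun j _ => (hc j).intervalIntegrable _ _
    _ ≤ J * ∑ j ∈ range J, Real.log T ^ 6 * (X ^ (1 - θ) + T) := by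
        gcongr with j hj
        have hj := hjX j (mem_range.1 hj)
        have hN : 1 / 2 ≤ 2 ^ j * W := by
          have : (1 : ℝ) ≤ 2 ^ j := one_le_pow₀ (by norm_num)
          nlinarith
        refine (h2 _ _ hN (hj.trans hXT) (by linarith) mob abs_mob_le_dcount).trans ?_
        gcongr
        have hN0 : 0 < 2 ^ j * W := by linarith
        generalize (2 : ℝ) ^ j * W = N at hj hN hN0
        rw [add_mul, mul_assoc, ← Real.rpow_add hN0, mul_comm N, ← Real.rpow_add_one hN0.ne']
        have e1 : 1 - 2 * ((1 + θ) / 2) + 1 = 1 - θ := by ring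
        have e2 : θ + (1 - 2 * ((1 + θ) / 2)) = 0 := by ring
        rw [e1, e2, Real.rpow_zero, mul_one]
        gcongr
    _ = (J : ℝ) ^ 2 * (Real.log T ^ 6 * (X ^ (1 - θ) + T)) := by
        rw [sum_const, card_range, nsmul_eq_mul]; ring
    _ ≤ (Real.log T ^ 2) ^ 2 * (Real.log T ^ 6 * (X ^ (1 - θ) + T)) := by gcongr
    _ = _ := by ring

lemma mul_rpow_le_add {k a b : ℝ} (hk : 1 ≤ k) (ha : 0 ≤ a) (hb : 0 ≤ b) :
    (a * b) ^ (2 * k / (k + 1)) ≤ a ^ (2 * k) + b ^ 2 := by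
  have hk1 : 0 < k + 1 := by linarith
  have h1 := Real.geom_mean_le_arith_mean2_weighted (w₁ := 1 / (k + 1)) (w₂ := k / (k + 1))
    (by positivity) (by positivity) (Real.rpow_nonneg ha (2 * k)) (sq_nonneg b) (by field_simp; ring)
  have e1 : (a ^ (2 * k)) ^ (1 / (k + 1)) = a ^ (2 * k / (k + 1)) := by
    rw [← Real.rpow_mul ha]; congr 1; ring
  have e2 : (b ^ 2) ^ (k / (k + 1)) = b ^ (2 * k / (k + 1)) := by
    rw [← Real.rpow_natCast, ← Real.rpow_mul hb]; congr 1; push_cast; ring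
  rw [e1, e2, ← Real.mul_rpow ha hb] at h1
  have hw1 : 1 / (k + 1) ≤ 1 := by rw [div_le_one hk1]; linarith
  have hw2 : k / (k + 1) ≤ 1 := by rw [div_le_one hk1]; linarith
  nlinarith [Real.rpow_nonneg ha (2 * k), sq_nonneg b]

lemma continuous_zeta_half (h : S.WellBehaved θ A Z) :
    Continuous fun t : ℝ => ‖Z ((((1 + θ) / 2 : ℝ) : ℂ) + t * Complex.I)‖ :=
  (continuous_zeta_line h (half_add_mem h).1 (half_add_mem h).2.1.ne).norm

lemma integral_sub_le_integral {g : ℝ → ℝ} (hg : Continuous g) (hg0 : ∀ t, 0 ≤ g t) {a b : ℝ}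
    (ha : 0 ≤ a) (hab : a ≤ b) : ∫ t in (-a)..a, g t ≤ ∫ t in (-b)..b, g t :=
  intervalIntegral.integral_mono_interval (by linarith) (by linarith) hab
    (Eventually.of_forall hg0) (hg.intervalIntegrable _ _)

lemma exists_card_le_zeta_mob (h : S.WellBehaved θ A Z) {k ck : ℝ} (hk : 1 ≤ k)
    (hmom : ∃ C : ℝ, ∀ T : ℝ, 2 ≤ T →
      (1 / T) * (∫ t in (0:ℝ)..T, ‖Z ((((1 + θ) / 2 : ℝ) : ℂ) + Complex.I * (t : ℂ))‖ ^ (2 * k)) ≤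
        C * Real.log T ^ ck) (B : ℝ) :
    ∃ n : ℕ, ∀ᶠ T : ℝ in atTop, ∀ X V : ℝ, 1 ≤ X → X ≤ T ^ B → 0 < V → ∀ F : Finset ℂ,
      (∀ x ∈ F, |x.im| ≤ T) →
      (∀ x ∈ F, ∀ y ∈ F, x ≠ y → 4 * Real.log T ^ 3 ≤ |x.im - y.im|) →
      (∀ x ∈ F, V ≤ ∫ u in (x.im - Real.log T ^ 3)..(x.im + Real.log T ^ 3),
        ‖Z ((((1 + θ) / 2 : ℝ) : ℂ) + u * Complex.I)‖ *
          ‖S.dpoly mob (S.block 0 X) ((((1 + θ) / 2 : ℝ) : ℂ) + u * Complex.I)‖) →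
      (F.card : ℝ) ≤ Real.log T ^ n * ((X ^ (1 - θ) + T) * V ^ (-(2 * k / (k + 1)))) := by
  obtain ⟨K, hK⟩ := exists_moment_bound h hk hmom
  refine ⟨K + 15, ?_⟩
  filter_upwards [hK, eventually_mean_square_mob_le h B, eventually_log_ge 16, eventually_gt_atTop 0,
    eventually_log_pow_le_rpow 3 one_pos] with T h1 h2 hl hT hlT X V hX hXT hV F hF hsep hbig
  rw [Real.rpow_one] at hlT
  have hk1 : 0 < k + 1 := by linarith
  have hl0 : 0 < Real.log T := by linarith
  have hp1 : 1 ≤ 2 * k / (k + 1) := by rw [le_div_iff₀ hk1]; linarith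
  have hp2 : 2 * k / (k + 1) ≤ 2 := by rw [div_le_iff₀ hk1]; linarith
  have hz := continuous_zeta_half h
  have hm := (continuous_dpoly_line S mob (S.block 0 X) ((1 + θ) / 2)).norm
  have hl3 : 1 ≤ 4 * Real.log T ^ 3 := by
    have := one_le_pow₀ (by linarith : 1 ≤ Real.log T) (n := 3); linarith
  have hl30 : 0 < Real.log T ^ 3 := by positivity
  have hc := card_windows_le (hz.mul hm) (fun t => mul_nonneg (norm_nonneg _) (norm_nonneg _))
    (L := Real.log T ^ 3) (by positivity) hV hp1 F (fun x => x.im) (fun x hx y hy hxy => by linarith [hsep x hx y hy hxy]) (T := 2 * T)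
    (fun x hx => by linarith [hF x hx]) (by linarith) hbig
  have hz2 : Continuous fun t : ℝ => ‖Z ((((1 + θ) / 2 : ℝ) : ℂ) + t * Complex.I)‖ ^ (2 * k) :=
    hz.rpow_const fun _ => Or.inr (by linarith)
  have hm2 := hm.pow 2
  have hzm : Continuous fun t : ℝ => (‖Z ((((1 + θ) / 2 : ℝ) : ℂ) + t * Complex.I)‖ *
      ‖S.dpoly mob (S.block 0 X) ((((1 + θ) / 2 : ℝ) : ℂ) + t * Complex.I)‖) ^ (2 * k / (k + 1)) :=
    (hz.mul hm).rpow_const fun _ => Or.inr (by linarith)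
  have hX0 : 0 ≤ X ^ (1 - θ) := Real.rpow_nonneg (by linarith) _
  have hI : ∫ t in (-(2 * T))..(2 * T), (‖Z ((((1 + θ) / 2 : ℝ) : ℂ) + t * Complex.I)‖ *
      ‖S.dpoly mob (S.block 0 X) ((((1 + θ) / 2 : ℝ) : ℂ) + t * Complex.I)‖) ^ (2 * k / (k + 1)) ≤
      2 * (Real.log T ^ (K + 10) * (X ^ (1 - θ) + T)) := by
    calc _ ≤ ∫ t in (-(2 * T))..(2 * T), (‖Z ((((1 + θ) / 2 : ℝ) : ℂ) + t * Complex.I)‖ ^ (2 * k) +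
          ‖S.dpoly mob (S.block 0 X) ((((1 + θ) / 2 : ℝ) : ℂ) + t * Complex.I)‖ ^ 2) :=
          intervalIntegral.integral_mono (by linarith) (hzm.intervalIntegrable _ _)
            ((hz2.add hm2).intervalIntegrable _ _)
            fun t => mul_rpow_le_add hk (norm_nonneg _) (norm_nonneg _)
      _ = (∫ t in (-(2 * T))..(2 * T), ‖Z ((((1 + θ) / 2 : ℝ) : ℂ) + t * Complex.I)‖ ^ (2 * k)) +
          ∫ t in (-(2 * T))..(2 * T),
            ‖S.dpoly mob (S.block 0 X) ((((1 + θ) / 2 : ℝ) : ℂ) + t * Complex.I)‖ ^ 2 :=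
          intervalIntegral.integral_add (hz2.intervalIntegrable _ _) (hm2.intervalIntegrable _ _)
      _ ≤ T * Real.log T ^ K + Real.log T ^ 10 * (X ^ (1 - θ) + T) := by
          gcongr
          · exact (integral_sub_le_integral hz2 (fun t => by positivity) (by linarith)
              (by linarith)).trans h1
          · exact h2 X hX hXT
      _ ≤ (X ^ (1 - θ) + T) * Real.log T ^ (K + 10) + Real.log T ^ (K + 10) * (X ^ (1 - θ) + T) := by
          gcongr
          · linarith
          · linarith
          · omega
          · linarith
          · omega
      _ = _ := by ring
  have hV0 : 0 < V ^ (-(2 * k / (k + 1))) := Real.rpow_pos_of_pos hV _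
  calc (F.card : ℝ) ≤ _ := hc
    _ ≤ 2 * (4 * Real.log T ^ 3) * V ^ (-(2 * k / (k + 1))) *
        (2 * (Real.log T ^ (K + 10) * (X ^ (1 - θ) + T))) := by
        have h3 : (4 * Real.log T ^ 3) ^ (2 * k / (k + 1) - 1) ≤ 4 * Real.log T ^ 3 := by
          conv_rhs => rw [← Real.rpow_one (4 * Real.log T ^ 3)]
          exact Real.rpow_le_rpow_of_exponent_le hl3 (by linarith)
        refine mul_le_mul (by gcongr) hI ?_ (by positivity)
        exact intervalIntegral.integral_nonneg (by linarith) fun t _ =>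
          Real.rpow_nonneg (mul_nonneg (norm_nonneg _) (norm_nonneg _)) _
    _ = 16 * (Real.log T ^ (K + 13) * ((X ^ (1 - θ) + T) * V ^ (-(2 * k / (k + 1))))) := by ring
    _ ≤ Real.log T ^ 2 * (Real.log T ^ (K + 13) * ((X ^ (1 - θ) + T) * V ^ (-(2 * k / (k + 1))))) := by
        gcongr; nlinarith
    _ = _ := by ring

lemma exists_card_le_zeta (h : S.WellBehaved θ A Z) {k ck : ℝ} (hk : 1 ≤ k)
    (hmom : ∃ C : ℝ, ∀ T : ℝ, 2 ≤ T →
      (1 / T) * (∫ t in (0:ℝ)..T, ‖Z ((((1 + θ) / 2 : ℝ) : ℂ) + Complex.I * (t : ℂ))‖ ^ (2 * k)) ≤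
        C * Real.log T ^ ck) :
    ∃ n : ℕ, ∀ᶠ T : ℝ in atTop, ∀ V : ℝ, 0 < V → ∀ F : Finset ℂ,
      (∀ x ∈ F, |x.im| ≤ T) →
      (∀ x ∈ F, ∀ y ∈ F, x ≠ y → 4 * Real.log T ^ 3 ≤ |x.im - y.im|) →
      (∀ x ∈ F, V ≤ ∫ u in (x.im - Real.log T ^ 3)..(x.im + Real.log T ^ 3),
        ‖Z ((((1 + θ) / 2 : ℝ) : ℂ) + u * Complex.I)‖) →
      (F.card : ℝ) ≤ Real.log T ^ n * (T * V ^ (-(2 * k))) := by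
  obtain ⟨K, hK⟩ := exists_moment_bound h hk hmom
  obtain ⟨m, hm⟩ := exists_nat_ge (2 * k - 1)
  refine ⟨1 + 4 * m + K, ?_⟩
  filter_upwards [hK, eventually_log_ge 16, eventually_gt_atTop 0,
    eventually_log_pow_le_rpow 3 one_pos] with T h1 hl hT hlT V hV F hF hsep hbig
  rw [Real.rpow_one] at hlT
  have hl0 : 0 < Real.log T := by linarith
  have hz := continuous_zeta_half h
  have hl30 : 0 < Real.log T ^ 3 := by positivity
  have hl3 : 1 ≤ 4 * Real.log T ^ 3 := by
    have := one_le_pow₀ (by linarith : 1 ≤ Real.log T) (n := 3); linarith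
  have hc := card_windows_le hz (fun t => norm_nonneg _) (L := Real.log T ^ 3) hl30
    hV (by linarith : 1 ≤ 2 * k) F (fun x => x.im) (fun x hx y hy hxy => by linarith [hsep x hx y hy hxy])
    (T := 4 * T) (fun x hx => by linarith [hF x hx]) (by linarith) hbig
  have hV0 : 0 < V ^ (-(2 * k)) := Real.rpow_pos_of_pos hV _
  calc (F.card : ℝ) ≤ _ := hc
    _ ≤ Real.log T * (Real.log T ^ 4) ^ m * V ^ (-(2 * k)) * (T * Real.log T ^ K) := by
        have h3 : (4 * Real.log T ^ 3) ^ (2 * k - 1) ≤ (Real.log T ^ 4) ^ m := by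
          refine (Real.rpow_le_rpow_of_exponent_le hl3 hm).trans ?_
          rw [Real.rpow_natCast]
          gcongr
          rw [pow_succ _ 3]; nlinarith
        refine mul_le_mul (by gcongr; linarith) h1 ?_ (by positivity)
        exact intervalIntegral.integral_nonneg (by linarith) fun t _ => by positivity
    _ = _ := by ring

/-- Large values attained near separated ordinates. -/
lemma exists_card_le_near_large_values (h : S.WellBehaved θ A Z) {k ck : ℝ} (hk : 1 ≤ k)
    (hmom : ∃ C : ℝ, ∀ T : ℝ, 2 ≤ T →
      (1 / T) * (∫ t in (0:ℝ)..T, ‖Z ((((1 + θ) / 2 : ℝ) : ℂ) + Complex.I * (t : ℂ))‖ ^ (2 * k)) ≤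
        C * Real.log T ^ ck) (B : ℝ) :
    ∃ n : ℕ, ∀ᶠ T : ℝ in atTop, ∀ N σ V : ℝ, 1 / 2 ≤ N → N ≤ T ^ B → 0 ≤ σ → 0 < V →
      N ^ (1 - 2 * σ) ≤ T ^ B * V ^ 2 → ∀ c : (ℕ →₀ ℕ) → ℝ,
      (∀ m, |c m| ≤ dcount m) → ∀ F : Finset ℂ, (∀ x ∈ F, |x.im| ≤ T) →
      (∀ x ∈ F, ∀ y ∈ F, x ≠ y → 4 * Real.log T ^ 3 ≤ |x.im - y.im|) →
      (∀ x ∈ F, ∃ u : ℝ, |u - x.im| ≤ Real.log T ^ 3 ∧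
        V ≤ ‖S.dpoly c (S.block N (2 * N)) ((σ : ℂ) + u * Complex.I)‖) →
      (F.card : ℝ) ≤ Real.log T ^ n * (N ^ (2 - 2 * σ) / V ^ 2 +
        T * (N ^ (1 - 2 * σ + (1 + θ) / 2) / V ^ 2) ^ (2 * k)) := by
  obtain ⟨n, hn⟩ := exists_card_le_large_values h hk hmom B
  refine ⟨n, ?_⟩
  filter_upwards [hn, eventually_log_pow_le_rpow 4 one_pos, eventually_log_ge 2] with
    T hT hlT hl N σ V hN hNT hσ hV hc1 c hc F hF hsep hu
  rw [Real.rpow_one] at hlT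
  choose! τ hτ hτV using hu
  have hl3 : 2 * Real.log T ^ 3 ≤ T := by
    have : 0 ≤ Real.log T ^ 3 := by positivity
    rw [pow_succ] at hlT; nlinarith
  refine hT N σ V hN hNT hσ hV hc1 c hc F τ (fun x hx => ?_) (fun x hx y hy hxy => ?_) hτV
  · have h1 := abs_le.1 (hτ x hx)
    have h2 := abs_le.1 (hF x hx)
    exact abs_le.2 ⟨by linarith, by linarith⟩
  · have h1 := hsep x hx y hy hxy
    have h2 : |x.im - y.im| ≤ |τ x - τ y| + |τ x - x.im| + |τ y - y.im| := by
      have e : x.im - y.im = (τ x - τ y) - (τ x - x.im) + (τ y - y.im) := by ring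
      rw [e]
      exact (abs_add_le _ _).trans (by gcongr; exact abs_sub _ _)
    linarith [hτ x hx, hτ y hy]

lemma dyadic_rpow_le {N Y e : ℝ} (hN : 0 ≤ N) (hY : 0 ≤ Y) (hNY : N ≤ 6 * Y) (he : 0 ≤ e) (he2 : e ≤ 2) :
    N ^ e ≤ 36 * Y ^ e := by
  calc N ^ e ≤ (6 * Y) ^ e := Real.rpow_le_rpow hN hNY he
    _ = 6 ^ e * Y ^ e := Real.mul_rpow (by norm_num) hY
    _ ≤ 6 ^ (2 : ℝ) * Y ^ e := by
        gcongr
        norm_num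
    _ = _ := by norm_num

lemma exists_card_separated_zeros_le (h : S.WellBehaved θ A Z) {k ck : ℝ} (hk : 1 ≤ k)
    (hmom : ∃ C : ℝ, ∀ T : ℝ, 2 ≤ T →
      (1 / T) * (∫ t in (0:ℝ)..T, ‖Z ((((1 + θ) / 2 : ℝ) : ℂ) + Complex.I * (t : ℂ))‖ ^ (2 * k)) ≤
        C * Real.log T ^ ck) {B : ℝ} (hB : 0 ≤ B) :
    ∃ n : ℕ, ∀ᶠ T : ℝ in atTop, ∀ X Y α : ℝ, 1 ≤ X → X ≤ Y → Y ≤ T ^ B →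
      Real.log T ^ 6 ≤ Y ^ (α - (1 + θ) / 2) → (1 + θ) / 2 ≤ α → α ≤ 1 → ∀ F : Finset ℂ,
      (∀ x ∈ F, Z x = 0 ∧ α ≤ x.re ∧ x.re ≤ 1 ∧ 2 * Real.log T ^ 3 ≤ |x.im| ∧ |x.im| ≤ T) →
      (∀ x ∈ F, ∀ y ∈ F, x ≠ y → 4 * Real.log T ^ 3 ≤ |x.im - y.im|) →
      (F.card : ℝ) ≤ Real.log T ^ n * (Y ^ (2 - 2 * α) + T * X ^ (1 + θ - 2 * α) +
        (X ^ (1 - θ) + T) * Y ^ (-((2 * α - 1 - θ) * k / (k + 1)))) := by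
  obtain ⟨n, hn⟩ := exists_card_le_zeta_mob h hk hmom B
  refine ⟨3 + (19 + (n + 8)), ?_⟩
  filter_upwards [hn, eventually_card_le_mean_value h (B + 1), eventually_large_of_zero h hB,
    eventually_log_ge 36, eventually_ge_atTop 6] with T hzm hmv hlz hl hT X Y α hX hXY hYT hlY hα hα1 F hF hsep
  have hT0 : 0 < T := by linarith
  have hl0 : 0 < Real.log T := by linarith
  have hY0 : 0 < Y := by linarith
  have hX0 : 0 < X := by linarith
  have hk1 : 0 < k + 1 := by linarith
  have hθ := h.lt_one
  have hθ0 := h.nonneg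
  have hp0 : 0 ≤ 2 * k / (k + 1) := by positivity
  have hp2 : 2 * k / (k + 1) ≤ 2 := by rw [div_le_iff₀ hk1]; linarith
  have hcov := card_le_of_cover F
    (fun x => Y ^ (α - (1 + θ) / 2) ≤ Real.log T ^ 4 *
        ∫ u in (x.im - Real.log T ^ 3)..(x.im + Real.log T ^ 3),
          ‖Z ((((1 + θ) / 2 : ℝ) : ℂ) + u * Complex.I)‖ *
            ‖S.dpoly mob (S.block 0 X) ((((1 + θ) / 2 : ℝ) : ℂ) + u * Complex.I)‖)
    (fun j σ x => 2 ^ j * X ≤ 6 * Y ∧ (2 ^ j * X) ^ (α - σ) ≤ Real.log T ^ 4 *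
        ∫ u in (x.im - Real.log T ^ 3)..(x.im + Real.log T ^ 3),
            ‖S.dpoly (S.mollified X) (S.block (2 ^ j * X) (2 * (2 ^ j * X))) ((σ : ℂ) + u * Complex.I)‖)
    (a := (1 + θ) / 2) (b := 2) (l := Real.log T ^ 2) (M := Real.log T ^ (19 + (n + 8)) *
      (Y ^ (2 - 2 * α) + T * X ^ (1 + θ - 2 * α) +
        (X ^ (1 - θ) + T) * Y ^ (-((2 * α - 1 - θ) * k / (k + 1)))))
    (by positivity) (fun x hx => (hlz X Y α x hX hXY hYT hlY (hF x hx).2.1 (hF x hx).2.2.1 (hF x hx).1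
      (hF x hx).2.2.2.1 (hF x hx).2.2.2.2).imp id fun ⟨j, σ, h1, h2, h3, h4⟩ => ⟨j, σ, h1, h3, h2, h4⟩) ?_ ?_
  · refine hcov.trans ?_
    rw [pow_add _ 3, mul_assoc]
    gcongr
    nlinarith
  · intro G hG hbig
    have hV : 0 < Y ^ (α - (1 + θ) / 2) / Real.log T ^ 4 := by positivity
    have hc := hzm X _ hX (hXY.trans hYT) hV G (fun x hx => (hF x (hG hx)).2.2.2.2)
      (fun x hx y hy => hsep x (hG hx) y (hG hy)) (fun x hx => by
        rw [div_le_iff₀' (by positivity)]; exact hbig x hx)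
    refine hc.trans ?_
    have hVp : (Y ^ (α - (1 + θ) / 2) / Real.log T ^ 4) ^ (-(2 * k / (k + 1))) ≤
        Real.log T ^ 8 * Y ^ (-((2 * α - 1 - θ) * k / (k + 1))) := by
      rw [Real.div_rpow (by positivity) (by positivity), ← Real.rpow_mul hY0.le, Real.rpow_neg (by positivity),
        div_inv_eq_mul, mul_comm]
      have e : (α - (1 + θ) / 2) * -(2 * k / (k + 1)) = -((2 * α - 1 - θ) * k / (k + 1)) := by ring
      rw [e]
      gcongr
      calc (Real.log T ^ 4) ^ (2 * k / (k + 1)) ≤ (Real.log T ^ 4) ^ (2 : ℝ) :=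
            Real.rpow_le_rpow_of_exponent_le (one_le_pow₀ (by linarith)) hp2
        _ = _ := by rw [← Real.rpow_natCast, ← Real.rpow_mul hl0.le, ← Real.rpow_natCast]; norm_num
    calc _ ≤ Real.log T ^ n * ((X ^ (1 - θ) + T) *
          (Real.log T ^ 8 * Y ^ (-((2 * α - 1 - θ) * k / (k + 1))))) := by gcongr
      _ = Real.log T ^ (n + 8) * ((X ^ (1 - θ) + T) * Y ^ (-((2 * α - 1 - θ) * k / (k + 1)))) := by ring
      _ ≤ _ := by
        refine mul_le_mul (pow_le_pow_right₀ (by linarith) (by omega)) ?_ (by positivity) (by positivity)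
        have : 0 ≤ Y ^ (2 - 2 * α) + T * X ^ (1 + θ - 2 * α) := by positivity
        linarith
  · intro j σ hj hσ G hG hbig
    by_cases hGe : G = ∅
    · subst hGe; simp only [card_empty, Nat.cast_zero]; positivity
    obtain ⟨x₀, hx₀⟩ := nonempty_iff_ne_empty.2 hGe
    have hN6 := (hbig x₀ hx₀).1
    have hNX : X ≤ 2 ^ j * X := le_mul_of_one_le_left hX0.le (one_le_pow₀ (by norm_num))
    replace hbig := fun x hx => (hbig x hx).2
    generalize (2 : ℝ) ^ j * X = N at hN6 hNX hbig
    have hN0 : 0 < N := by linarith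
    have hσ0 : 0 ≤ σ := by rcases hσ with rfl | rfl <;> linarith
    have hV : 0 < N ^ (α - σ) / Real.log T ^ 4 := by positivity
    have hNT : N ≤ T ^ (B + 1) := by
      rw [Real.rpow_add hT0, Real.rpow_one]
      nlinarith [Real.rpow_pos_of_pos hT0 B]
    have hc := hmv N σ _ (by linarith) hNT hσ0 hV (S.mollified X) (abs_mollified_le S X) G
      (fun x hx => (hF x (hG hx)).2.2.2.2) (fun x hx y hy => hsep x (hG hx) y (hG hy)) (fun x hx => by
        rw [div_le_iff₀' (by positivity)]; exact hbig x hx)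
    refine hc.trans ?_
    have e : (N + T * N ^ θ) * N ^ (1 - 2 * σ) / (N ^ (α - σ) / Real.log T ^ 4) ^ 2 =
        Real.log T ^ 8 * (N ^ (2 - 2 * α) + T * N ^ (1 + θ - 2 * α)) := by
      have e1 : N ^ (2 - 2 * α) = N * N ^ (1 - 2 * σ) / (N ^ (α - σ)) ^ 2 := by
        rw [← Real.rpow_natCast, ← Real.rpow_mul hN0.le, mul_comm N, ← Real.rpow_add_one hN0.ne',
          ← Real.rpow_sub hN0]
        congr 1; push_cast; ring
      have e2 : N ^ (1 + θ - 2 * α) = N ^ θ * N ^ (1 - 2 * σ) / (N ^ (α - σ)) ^ 2 := by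
        rw [← Real.rpow_natCast, ← Real.rpow_mul hN0.le, ← Real.rpow_add hN0,
          ← Real.rpow_sub hN0]
        congr 1; push_cast; ring
      rw [e1, e2]
      field_simp
    rw [e]
    have h1 := dyadic_rpow_le hN0.le hY0.le hN6 (e := 2 - 2 * α) (by linarith) (by linarith)
    have h2 : N ^ (1 + θ - 2 * α) ≤ X ^ (1 + θ - 2 * α) :=
      Real.rpow_le_rpow_of_nonpos hX0 hNX (by linarith)
    calc _ ≤ Real.log T ^ 10 * (Real.log T ^ 8 * (Real.log T * Y ^ (2 - 2 * α) +
          Real.log T * (T * X ^ (1 + θ - 2 * α)))) := by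
          have h3 : T * N ^ (1 + θ - 2 * α) ≤ Real.log T * (T * X ^ (1 + θ - 2 * α)) :=
            (mul_le_mul_of_nonneg_left h2 hT0.le).trans
              (le_mul_of_one_le_left (by positivity) (by linarith))
          have h4 := h1.trans (mul_le_mul_of_nonneg_right hl (by positivity))
          gcongr
      _ = Real.log T ^ 19 * (Y ^ (2 - 2 * α) + T * X ^ (1 + θ - 2 * α)) := by ring
      _ ≤ _ := by
        refine mul_le_mul (pow_le_pow_right₀ (by linarith) (by omega)) ?_ (by positivity) (by positivity)
        have : 0 ≤ (X ^ (1 - θ) + T) * Y ^ (-((2 * α - 1 - θ) * k / (k + 1))) := by positivity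
        linarith

/-- Zeros detected by a mollified dyadic block, counted through large values. -/
lemma exists_card_le_mollified_block (h : S.WellBehaved θ A Z) {k ck : ℝ} (hk : 1 ≤ k)
    (hmom : ∃ C : ℝ, ∀ T : ℝ, 2 ≤ T →
      (1 / T) * (∫ t in (0:ℝ)..T, ‖Z ((((1 + θ) / 2 : ℝ) : ℂ) + Complex.I * (t : ℂ))‖ ^ (2 * k)) ≤
        C * Real.log T ^ ck) {B : ℝ} (hB : 0 ≤ B) :
    ∃ n : ℕ, ∀ᶠ T : ℝ in atTop, ∀ X N Y α σ : ℝ, 1 ≤ X → X ≤ N → N ≤ 6 * Y → Y ≤ T ^ B →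
      (3 + θ) / 4 ≤ α → α ≤ 1 → 0 ≤ σ → ∀ F : Finset ℂ,
      (∀ x ∈ F, |x.im| ≤ T) →
      (∀ x ∈ F, ∀ y ∈ F, x ≠ y → 4 * Real.log T ^ 3 ≤ |x.im - y.im|) →
      (∀ x ∈ F, N ^ (α - σ) ≤ Real.log T ^ 4 *
        ∫ u in (x.im - Real.log T ^ 3)..(x.im + Real.log T ^ 3),
            ‖S.dpoly (S.mollified X) (S.block N (2 * N)) ((σ : ℂ) + u * Complex.I)‖) →
      (F.card : ℝ) ≤ Real.log T ^ n * (Y ^ (2 - 2 * α) + T * X ^ (-(k * (4 * α - 3 - θ)))) := by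
  obtain ⟨n, hn⟩ := exists_card_le_near_large_values h hk hmom (B + 1)
  obtain ⟨m, hm⟩ := exists_nat_ge (2 * k)
  refine ⟨n + (16 + 15 * m), ?_⟩
  filter_upwards [hn, eventually_log_ge 36, eventually_ge_atTop 6,
    eventually_log_pow_le_rpow 15 one_pos] with
    T hlv hl hT hlT X N Y α σ hX hXN hNY hYT hα hα1 hσ F hF hsep hbig
  rw [Real.rpow_one] at hlT
  have hT0 : 0 < T := by linarith
  have hl0 : 0 < Real.log T := by linarith
  have hX0 : 0 < X := by linarith
  have hN0 : 0 < N := by linarith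
  have hY0 : 0 < Y := by linarith
  have hθ := h.lt_one
  have hθ0 := h.nonneg
  have hTB : 1 ≤ T ^ B := Real.one_le_rpow (by linarith) hB
  have hl14 : 4 * Real.log T ^ 14 ≤ Real.log T ^ 15 := by
    rw [pow_succ _ 14]; nlinarith [pow_pos hl0 14]
  have hV : 0 < N ^ (α - σ) / (2 * Real.log T ^ 7) := by positivity
  have hV2 : (N ^ (α - σ) / (2 * Real.log T ^ 7)) ^ 2 = N ^ (2 * α - 2 * σ) / (4 * Real.log T ^ 14) := by
    rw [div_pow, ← Real.rpow_natCast (N ^ (α - σ)), ← Real.rpow_mul hN0.le]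
    congr 2
    · push_cast; ring
    · ring
  have hNT : N ≤ T ^ (B + 1) := by
    rw [Real.rpow_add hT0, Real.rpow_one]; nlinarith
  have hcond : N ^ (1 - 2 * σ) ≤ T ^ (B + 1) * (N ^ (α - σ) / (2 * Real.log T ^ 7)) ^ 2 := by
    rw [hV2, ← mul_div_assoc, le_div_iff₀ (by positivity)]
    have h1 : N ^ (1 - 2 * σ) ≤ N ^ (2 * α - 2 * σ) :=
      Real.rpow_le_rpow_of_exponent_le (by linarith) (by linarith)
    have h2 : 4 * Real.log T ^ 14 ≤ T ^ (B + 1) := by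
      rw [Real.rpow_add hT0, Real.rpow_one]; nlinarith
    rw [mul_comm]
    exact mul_le_mul h2 h1 (by positivity) (by positivity)
  have hc := hlv N σ _ (by linarith) hNT hσ hV hcond (S.mollified X) (abs_mollified_le S X) F hF hsep
    (fun x hx => by
      obtain ⟨u, hu, hu2⟩ := exists_large_value_of_integral
        (continuous_dpoly_line S (S.mollified X) (S.block N (2 * N)) σ).norm (L := Real.log T ^ 3)
        (V := N ^ (α - σ) / Real.log T ^ 4) (by positivity)
        (by rw [div_le_iff₀' (by positivity)]; exact hbig x hx)
      refine ⟨u, hu, le_trans (le_of_eq ?_) hu2⟩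
      rw [div_div]; ring)
  refine hc.trans ?_
  rw [hV2]
  have e1 : N ^ (2 - 2 * σ) / (N ^ (2 * α - 2 * σ) / (4 * Real.log T ^ 14)) =
      4 * Real.log T ^ 14 * N ^ (2 - 2 * α) := by
    have : N ^ (2 - 2 * α) = N ^ (2 - 2 * σ) / N ^ (2 * α - 2 * σ) := by
      rw [← Real.rpow_sub hN0]; congr 1; ring
    rw [this]; field_simp
  have e2 : N ^ (1 - 2 * σ + (1 + θ) / 2) / (N ^ (2 * α - 2 * σ) / (4 * Real.log T ^ 14)) =
      4 * Real.log T ^ 14 * N ^ (-((4 * α - 3 - θ) / 2)) := by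
    have : N ^ (-((4 * α - 3 - θ) / 2)) = N ^ (1 - 2 * σ + (1 + θ) / 2) / N ^ (2 * α - 2 * σ) := by
      rw [← Real.rpow_sub hN0]; congr 1; ring
    rw [this]; field_simp
  rw [e1, e2, Real.mul_rpow (by positivity) (by positivity), ← Real.rpow_mul hN0.le]
  have e3 : -((4 * α - 3 - θ) / 2) * (2 * k) = -(k * (4 * α - 3 - θ)) := by ring
  rw [e3]
  have h3 : (4 * Real.log T ^ 14) ^ (2 * k) ≤ Real.log T ^ (15 * m) := by
    calc (4 * Real.log T ^ 14) ^ (2 * k) ≤ (Real.log T ^ 15) ^ (2 * k) :=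
          Real.rpow_le_rpow (by positivity) hl14 (by linarith)
      _ ≤ (Real.log T ^ 15) ^ (m : ℝ) :=
          Real.rpow_le_rpow_of_exponent_le (one_le_pow₀ (by linarith)) hm
      _ = _ := by rw [Real.rpow_natCast, pow_mul]
  have h4 := dyadic_rpow_le hN0.le hY0.le hNY (e := 2 - 2 * α) (by linarith) (by linarith)
  have h5 : N ^ (-(k * (4 * α - 3 - θ))) ≤ X ^ (-(k * (4 * α - 3 - θ))) :=
    Real.rpow_le_rpow_of_nonpos hX0 hXN (by
      have : 0 ≤ k * (4 * α - 3 - θ) := mul_nonneg (by linarith) (by linarith)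
      linarith)
  have h6 : 4 * Real.log T ^ 14 * N ^ (2 - 2 * α) ≤ Real.log T ^ (16 + 15 * m) * Y ^ (2 - 2 * α) := by
    calc _ ≤ Real.log T ^ 15 * (Real.log T * Y ^ (2 - 2 * α)) := by
          refine mul_le_mul hl14 (h4.trans (by gcongr)) (by positivity) (by positivity)
      _ = Real.log T ^ 16 * Y ^ (2 - 2 * α) := by ring
      _ ≤ _ := by
        refine mul_le_mul_of_nonneg_right (pow_le_pow_right₀ (by linarith) (by omega)) (by positivity)
  have h7 : (4 * Real.log T ^ 14) ^ (2 * k) * N ^ (-(k * (4 * α - 3 - θ))) ≤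
      Real.log T ^ (16 + 15 * m) * X ^ (-(k * (4 * α - 3 - θ))) :=
    mul_le_mul (h3.trans (pow_le_pow_right₀ (by linarith) (by omega))) h5 (by positivity) (by positivity)
  calc _ ≤ Real.log T ^ n * (Real.log T ^ (16 + 15 * m) * Y ^ (2 - 2 * α) +
        T * (Real.log T ^ (16 + 15 * m) * X ^ (-(k * (4 * α - 3 - θ))))) := by gcongr
    _ = _ := by ring

/-- Zeros near which the mollifier is large. -/
lemma exists_card_le_large_mob (h : S.WellBehaved θ A Z) {k ck : ℝ} (hk : 1 ≤ k)
    (hmom : ∃ C : ℝ, ∀ T : ℝ, 2 ≤ T →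
      (1 / T) * (∫ t in (0:ℝ)..T, ‖Z ((((1 + θ) / 2 : ℝ) : ℂ) + Complex.I * (t : ℂ))‖ ^ (2 * k)) ≤
        C * Real.log T ^ ck) {B : ℝ} (hB : 0 ≤ B) :
    ∃ n : ℕ, ∀ᶠ T : ℝ in atTop, ∀ X α : ℝ, 1 ≤ X → X ≤ T ^ B →
      (3 + θ) / 4 ≤ α → α ≤ 1 → ∀ F : Finset ℂ,
      (∀ x ∈ F, |x.im| ≤ T) →
      (∀ x ∈ F, ∀ y ∈ F, x ≠ y → 4 * Real.log T ^ 3 ≤ |x.im - y.im|) →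
      (∀ x ∈ F, ∃ u : ℝ, |u - x.im| ≤ Real.log T ^ 3 ∧ X ^ (α - (1 + θ) / 2) <
            ‖S.dpoly mob (S.block 0 X) ((((1 + θ) / 2 : ℝ) : ℂ) + u * Complex.I)‖) →
      (F.card : ℝ) ≤ Real.log T ^ n * (X ^ (2 - 2 * α) + T * X ^ (-(k * (4 * α - 3 - θ)))) := by
  obtain ⟨n, hn⟩ := exists_card_le_near_large_values h hk hmom (B + 1)
  obtain ⟨m, hm⟩ := exists_nat_ge (2 * k)
  refine ⟨3 + (n + (4 + 4 * m)), ?_⟩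
  filter_upwards [hn, eventually_log_ge 36, eventually_ge_atTop 6,
    eventually_log_pow_le_rpow 5 one_pos, eventually_exists_dyadic_blocks h (B := B)] with
    T hlv hl hT hlT hdy X α hX hXT hα hα1 F hF hsep hbig
  rw [Real.rpow_one] at hlT
  obtain ⟨J, W, hJ, hW, hjX, hd⟩ := hdy X hX hXT
  have hT0 : 0 < T := by linarith
  have hl0 : 0 < Real.log T := by linarith
  have hX0 : 0 < X := by linarith
  have hθ := h.lt_one
  have hθ0 := h.nonneg
  have hTB : 1 ≤ T ^ B := Real.one_le_rpow (by linarith) hB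
  have hV : 0 < X ^ (α - (1 + θ) / 2) / Real.log T ^ 2 := by positivity
  have hV2 : (X ^ (α - (1 + θ) / 2) / Real.log T ^ 2) ^ 2 = X ^ (2 * α - 1 - θ) / Real.log T ^ 4 := by
    rw [div_pow, ← Real.rpow_natCast (X ^ (α - (1 + θ) / 2)), ← Real.rpow_mul hX0.le,
      ← pow_mul]
    congr 2
    push_cast; ring
  have hcov := card_le_of_cover F (fun _ => False)
    (fun j σ x => j < J ∧ ∃ u : ℝ, |u - x.im| ≤ Real.log T ^ 3 ∧ X ^ (α - (1 + θ) / 2) / Real.log T ^ 2 ≤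
      ‖S.dpoly mob (S.block (2 ^ j * W) (2 * (2 ^ j * W))) ((((1 + θ) / 2 : ℝ) : ℂ) + u * Complex.I)‖)
    (a := 0) (b := 0) (l := Real.log T ^ 2)
    (M := Real.log T ^ (n + (4 + 4 * m)) * (X ^ (2 - 2 * α) + T * X ^ (-(k * (4 * α - 3 - θ)))))
    (by positivity) (fun x hx => Or.inr ?_) ?_ ?_
  · refine hcov.trans ?_
    rw [pow_add _ 3, mul_assoc]
    gcongr
    nlinarith
  · obtain ⟨u, hu, hlt⟩ := hbig x hx
    rw [hd] at hlt
    by_contra! hcon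
    have : ∀ j ∈ range J, ‖S.dpoly mob (S.block (2 ^ j * W) (2 * (2 ^ j * W)))
        ((((1 + θ) / 2 : ℝ) : ℂ) + u * Complex.I)‖ ≤ X ^ (α - (1 + θ) / 2) / Real.log T ^ 2 := by
      intro j hj
      have hj := mem_range.1 hj
      by_contra! hj2
      refine absurd (hcon j 0 ?_ (Or.inl rfl) hj u hu) (not_lt.2 hj2.le)
      have : (j : ℝ) ≤ J := by exact_mod_cast hj.le
      linarith
    have h1 := (norm_sum_le _ _).trans (sum_le_card_nsmul _ _ _ this)
    rw [card_range, nsmul_eq_mul] at h1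
    have h2 : (J : ℝ) * (X ^ (α - (1 + θ) / 2) / Real.log T ^ 2) ≤
        Real.log T ^ 2 * (X ^ (α - (1 + θ) / 2) / Real.log T ^ 2) := by gcongr
    rw [mul_div_cancel₀ _ (by positivity)] at h2
    linarith
  · intro G hG hb
    have : G = ∅ := Finset.eq_empty_of_forall_notMem hb
    subst this
    simp only [card_empty, Nat.cast_zero]; positivity
  · intro j σ hj hσ G hG hb
    by_cases hGe : G = ∅
    · subst hGe; simp only [card_empty, Nat.cast_zero]; positivity
    obtain ⟨x₀, hx₀⟩ := nonempty_iff_ne_empty.2 hGe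
    have hNX := hjX j (hb x₀ hx₀).1
    replace hb := fun x hx => (hb x hx).2
    have hN : 1 / 2 ≤ 2 ^ j * W := by
      have : (1 : ℝ) ≤ 2 ^ j := one_le_pow₀ (by norm_num)
      nlinarith
    generalize (2 : ℝ) ^ j * W = N at hNX hN hb
    have hN0 : 0 < N := by linarith
    have hNT : N ≤ T ^ (B + 1) := by
      rw [Real.rpow_add hT0, Real.rpow_one]; nlinarith
    have hcond : N ^ (1 - 2 * ((1 + θ) / 2)) ≤ T ^ (B + 1) * (X ^ (α - (1 + θ) / 2) / Real.log T ^ 2) ^ 2 := by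
      rw [hV2, ← mul_div_assoc (T ^ (B + 1)), le_div_iff₀ (by positivity)]
      have h1 : N ^ (1 - 2 * ((1 + θ) / 2)) ≤ 2 := by
        calc _ ≤ (1 / 2 : ℝ) ^ (1 - 2 * ((1 + θ) / 2)) :=
              Real.rpow_le_rpow_of_nonpos (by norm_num) hN (by linarith)
          _ ≤ (1 / 2 : ℝ) ^ (-1 : ℝ) :=
              Real.rpow_le_rpow_of_exponent_ge (by norm_num) (by norm_num) (by linarith)
          _ = 2 := by rw [Real.rpow_neg_one]; norm_num
      have h2 : 2 * Real.log T ^ 4 ≤ T ^ (B + 1) := by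
        rw [Real.rpow_add hT0, Real.rpow_one]
        have : 2 * Real.log T ^ 4 ≤ Real.log T ^ 5 := by
          rw [pow_succ _ 4]; nlinarith [pow_pos hl0 4]
        nlinarith
      have h3 : 1 ≤ X ^ (2 * α - 1 - θ) := Real.one_le_rpow hX (by linarith)
      calc _ ≤ 2 * Real.log T ^ 4 := by gcongr
        _ ≤ T ^ (B + 1) * 1 := by rw [mul_one]; exact h2
        _ ≤ _ := by gcongr
    have hc := hlv N _ _ hN hNT (half_add_mem h).2.2.le hV hcond mob abs_mob_le_dcount G
      (fun x hx => hF x (hG hx)) (fun x hx y hy => hsep x (hG hx) y (hG hy)) hb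
    refine hc.trans ?_
    rw [hV2]
    have h1 : N ^ (2 - 2 * ((1 + θ) / 2)) / (X ^ (2 * α - 1 - θ) / Real.log T ^ 4) ≤
        Real.log T ^ 4 * X ^ (2 - 2 * α) := by
      have : X ^ (2 - 2 * α) = X ^ (2 - 2 * ((1 + θ) / 2)) / X ^ (2 * α - 1 - θ) := by
        rw [← Real.rpow_sub hX0]; congr 1; ring
      rw [this, div_div_eq_mul_div, mul_comm, mul_div_assoc]
      gcongr
      linarith
    have h2 : N ^ (1 - 2 * ((1 + θ) / 2) + (1 + θ) / 2) / (X ^ (2 * α - 1 - θ) / Real.log T ^ 4) ≤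
        Real.log T ^ 4 * X ^ (-((4 * α - 3 - θ) / 2)) := by
      have : X ^ (-((4 * α - 3 - θ) / 2)) = X ^ (1 - 2 * ((1 + θ) / 2) + (1 + θ) / 2) / X ^ (2 * α - 1 - θ) := by
        rw [← Real.rpow_sub hX0]; congr 1; ring
      rw [this, div_div_eq_mul_div, mul_comm, mul_div_assoc]
      gcongr
      linarith
    have h3 : (Real.log T ^ 4) ^ (2 * k) ≤ Real.log T ^ (4 * m) := by
      calc (Real.log T ^ 4) ^ (2 * k) ≤ (Real.log T ^ 4) ^ (m : ℝ) :=
            Real.rpow_le_rpow_of_exponent_le (one_le_pow₀ (by linarith)) hm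
        _ = _ := by rw [Real.rpow_natCast, pow_mul]
    have h4 : (N ^ (1 - 2 * ((1 + θ) / 2) + (1 + θ) / 2) / (X ^ (2 * α - 1 - θ) / Real.log T ^ 4)) ^ (2 * k) ≤
        Real.log T ^ (4 + 4 * m) * X ^ (-(k * (4 * α - 3 - θ))) := by
      calc _ ≤ (Real.log T ^ 4 * X ^ (-((4 * α - 3 - θ) / 2))) ^ (2 * k) :=
            Real.rpow_le_rpow (by positivity) h2 (by linarith)
        _ = (Real.log T ^ 4) ^ (2 * k) * X ^ (-(k * (4 * α - 3 - θ))) := by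
            rw [Real.mul_rpow (by positivity) (by positivity), ← Real.rpow_mul hX0.le]
            congr 2; ring
        _ ≤ _ := by
            refine mul_le_mul_of_nonneg_right (h3.trans (pow_le_pow_right₀ (by linarith) (by omega)))
              (by positivity)
    calc _ ≤ Real.log T ^ n * (Real.log T ^ (4 + 4 * m) * X ^ (2 - 2 * α) +
          T * (Real.log T ^ (4 + 4 * m) * X ^ (-(k * (4 * α - 3 - θ))))) := by
          have h5 := h1.trans (mul_le_mul_of_nonneg_right
            (pow_le_pow_right₀ (by linarith : 1 ≤ Real.log T) (by omega : 4 ≤ 4 + 4 * m))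
            (by positivity : 0 ≤ X ^ (2 - 2 * α)))
          gcongr
      _ = _ := by ring

lemma exists_card_separated_zeros_le_of_large_values (h : S.WellBehaved θ A Z) {k ck : ℝ} (hk : 1 ≤ k)
    (hmom : ∃ C : ℝ, ∀ T : ℝ, 2 ≤ T →
      (1 / T) * (∫ t in (0:ℝ)..T, ‖Z ((((1 + θ) / 2 : ℝ) : ℂ) + Complex.I * (t : ℂ))‖ ^ (2 * k)) ≤
        C * Real.log T ^ ck) {B : ℝ} (hB : 0 ≤ B) :
    ∃ n : ℕ, ∀ᶠ T : ℝ in atTop, ∀ X Y α : ℝ, 1 ≤ X → X ≤ Y → Y ≤ T ^ B →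
      Real.log T ^ 6 ≤ Y ^ (α - (1 + θ) / 2) → (3 + θ) / 4 ≤ α → α ≤ 1 → ∀ F : Finset ℂ,
      (∀ x ∈ F, Z x = 0 ∧ α ≤ x.re ∧ x.re ≤ 1 ∧ 2 * Real.log T ^ 3 ≤ |x.im| ∧ |x.im| ≤ T) →
      (∀ x ∈ F, ∀ y ∈ F, x ≠ y → 4 * Real.log T ^ 3 ≤ |x.im - y.im|) →
      (F.card : ℝ) ≤ Real.log T ^ n * (Y ^ (2 - 2 * α) + T * X ^ (-(k * (4 * α - 3 - θ))) +
        T * (X ^ (α - (1 + θ) / 2) / Y ^ (α - (1 + θ) / 2)) ^ (2 * k)) := by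
  obtain ⟨n₁, hn₁⟩ := exists_card_le_mollified_block h hk hmom hB
  obtain ⟨n₂, hn₂⟩ := exists_card_le_large_mob h hk hmom hB
  obtain ⟨n₃, hn₃⟩ := exists_card_le_zeta h hk hmom
  obtain ⟨m, hm⟩ := exists_nat_ge (2 * k)
  refine ⟨4 + (n₁ + n₂ + n₃ + 4 * m), ?_⟩
  filter_upwards [hn₁, hn₂, hn₃, eventually_large_of_zero h hB,
    eventually_log_ge 36, eventually_ge_atTop 6] with
    T hQ hM hzc hlz hl hT X Y α hX hXY hYT hlY hα hα1 F hF hsep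
  have hT0 : 0 < T := by linarith
  have hl0 : 0 < Real.log T := by linarith
  have hl1 : 1 ≤ Real.log T := by linarith
  have hY0 : 0 < Y := by linarith
  have hX0 : 0 < X := by linarith
  have hθ := h.lt_one
  have hθ0 := h.nonneg
  have hU : 0 < X ^ (α - (1 + θ) / 2) := by positivity
  have hV0 : 0 < Y ^ (α - (1 + θ) / 2) := by positivity
  have hXY2 : X ^ (2 - 2 * α) ≤ Y ^ (2 - 2 * α) := Real.rpow_le_rpow hX0.le hXY (by linarith)
  have hr : 0 ≤ T * (X ^ (α - (1 + θ) / 2) / Y ^ (α - (1 + θ) / 2)) ^ (2 * k) := by positivity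
  have hs : 0 ≤ Y ^ (2 - 2 * α) + T * X ^ (-(k * (4 * α - 3 - θ))) := by positivity
  have hcov := card_le_of_cover F
    (fun x => Y ^ (α - (1 + θ) / 2) ≤ Real.log T ^ 4 *
        ∫ u in (x.im - Real.log T ^ 3)..(x.im + Real.log T ^ 3),
          ‖Z ((((1 + θ) / 2 : ℝ) : ℂ) + u * Complex.I)‖ *
            ‖S.dpoly mob (S.block 0 X) ((((1 + θ) / 2 : ℝ) : ℂ) + u * Complex.I)‖)
    (fun j σ x => 2 ^ j * X ≤ 6 * Y ∧ (2 ^ j * X) ^ (α - σ) ≤ Real.log T ^ 4 *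
        ∫ u in (x.im - Real.log T ^ 3)..(x.im + Real.log T ^ 3),
            ‖S.dpoly (S.mollified X) (S.block (2 ^ j * X) (2 * (2 ^ j * X))) ((σ : ℂ) + u * Complex.I)‖)
    (a := (1 + θ) / 2) (b := 2) (l := Real.log T ^ 2)
    (M := 3 * (Real.log T ^ (n₁ + n₂ + n₃ + 4 * m) * (Y ^ (2 - 2 * α) + T * X ^ (-(k * (4 * α - 3 - θ))) +
        T * (X ^ (α - (1 + θ) / 2) / Y ^ (α - (1 + θ) / 2)) ^ (2 * k))))
    (by positivity) (fun x hx => (hlz X Y α x hX hXY hYT hlY (hF x hx).2.1 (hF x hx).2.2.1 (hF x hx).1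
      (hF x hx).2.2.2.1 (hF x hx).2.2.2.2).imp id fun ⟨j, σ, h1, h2, h3, h4⟩ => ⟨j, σ, h1, h3, h2, h4⟩) ?_ ?_
  · refine hcov.trans ?_
    rw [pow_add _ 4, mul_assoc, ← mul_assoc (2 * Real.log T ^ 2 + 3)]
    gcongr
    nlinarith [pow_pos hl0 2, pow_pos hl0 3]
  · intro G hG hb
    have hGim : ∀ x ∈ G, |x.im| ≤ T := fun x hx => (hF x (hG hx)).2.2.2.2
    have hGsep : ∀ x ∈ G, ∀ y ∈ G, x ≠ y → 4 * Real.log T ^ 3 ≤ |x.im - y.im| :=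
      fun x hx y hy => hsep x (hG hx) y (hG hy)
    have hcov2 := card_le_of_cover G
      (fun x => ∃ u : ℝ, |u - x.im| ≤ Real.log T ^ 3 ∧ X ^ (α - (1 + θ) / 2) <
            ‖S.dpoly mob (S.block 0 X) ((((1 + θ) / 2 : ℝ) : ℂ) + u * Complex.I)‖)
      (fun _ _ x => Y ^ (α - (1 + θ) / 2) / (Real.log T ^ 4 * X ^ (α - (1 + θ) / 2)) ≤
        ∫ u in (x.im - Real.log T ^ 3)..(x.im + Real.log T ^ 3), ‖Z ((((1 + θ) / 2 : ℝ) : ℂ) + u * Complex.I)‖)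
      (a := 0) (b := 0) (l := 0)
      (M := Real.log T ^ (n₁ + n₂ + n₃ + 4 * m) * (Y ^ (2 - 2 * α) + T * X ^ (-(k * (4 * α - 3 - θ))) +
        T * (X ^ (α - (1 + θ) / 2) / Y ^ (α - (1 + θ) / 2)) ^ (2 * k))) le_rfl ?_ ?_ ?_
    · simpa using hcov2
    · intro x hx
      by_cases hu : ∃ u : ℝ, |u - x.im| ≤ Real.log T ^ 3 ∧ X ^ (α - (1 + θ) / 2) <
            ‖S.dpoly mob (S.block 0 X) ((((1 + θ) / 2 : ℝ) : ℂ) + u * Complex.I)‖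
      · exact Or.inl hu
      refine Or.inr ⟨0, 0, by simp, Or.inl rfl, ?_⟩
      push Not at hu
      have hz := continuous_zeta_half h
      have hmc := (continuous_dpoly_line S mob (S.block 0 X) ((1 + θ) / 2)).norm
      have hl3 : 0 ≤ Real.log T ^ 3 := by positivity
      have hI : ∫ u in (x.im - Real.log T ^ 3)..(x.im + Real.log T ^ 3),
          ‖Z ((((1 + θ) / 2 : ℝ) : ℂ) + u * Complex.I)‖ *
            ‖S.dpoly mob (S.block 0 X) ((((1 + θ) / 2 : ℝ) : ℂ) + u * Complex.I)‖ ≤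
          ∫ u in (x.im - Real.log T ^ 3)..(x.im + Real.log T ^ 3),
            ‖Z ((((1 + θ) / 2 : ℝ) : ℂ) + u * Complex.I)‖ * X ^ (α - (1 + θ) / 2) := by
        refine intervalIntegral.integral_mono_on (by linarith) ((hz.mul hmc).intervalIntegrable _ _)
          ((hz.mul continuous_const).intervalIntegrable _ _) fun u hux => ?_
        refine mul_le_mul_of_nonneg_left (hu u ?_) (norm_nonneg _)
        rw [abs_le]; constructor <;> linarith [hux.1, hux.2]
      rw [intervalIntegral.integral_mul_const] at hI
      rw [div_le_iff₀' (by positivity)]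
      calc _ ≤ _ := hb x hx
        _ ≤ _ := mul_le_mul_of_nonneg_left hI (by positivity)
        _ = _ := by ring
    · intro G' hG' hb'
      refine (hM X α hX (hXY.trans hYT) hα hα1 G' (fun x hx => hGim x (hG' hx))
        (fun x hx y hy => hGsep x (hG' hx) y (hG' hy)) hb').trans ?_
      refine mul_le_mul (pow_le_pow_right₀ hl1 (by omega)) ?_ (by positivity) (by positivity)
      linarith
    · intro j σ hj hσ G' hG' hb'
      refine (hzc _ (by positivity) G' (fun x hx => hGim x (hG' hx))
        (fun x hx y hy => hGsep x (hG' hx) y (hG' hy)) hb').trans ?_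
      have e : (Y ^ (α - (1 + θ) / 2) / (Real.log T ^ 4 * X ^ (α - (1 + θ) / 2))) ^ (-(2 * k)) =
          (Real.log T ^ 4) ^ (2 * k) * (X ^ (α - (1 + θ) / 2) / Y ^ (α - (1 + θ) / 2)) ^ (2 * k) := by
        rw [Real.rpow_neg (by positivity), ← Real.inv_rpow (by positivity), inv_div, mul_div_assoc,
          Real.mul_rpow (by positivity) (by positivity)]
      have h3 : (Real.log T ^ 4) ^ (2 * k) ≤ Real.log T ^ (4 * m) := by
        calc (Real.log T ^ 4) ^ (2 * k) ≤ (Real.log T ^ 4) ^ (m : ℝ) :=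
              Real.rpow_le_rpow_of_exponent_le (one_le_pow₀ hl1) hm
          _ = _ := by rw [Real.rpow_natCast, pow_mul]
      rw [e]
      calc _ ≤ Real.log T ^ n₃ * (T * (Real.log T ^ (4 * m) *
            (X ^ (α - (1 + θ) / 2) / Y ^ (α - (1 + θ) / 2)) ^ (2 * k))) := by gcongr
        _ = Real.log T ^ (n₃ + 4 * m) *
            (T * (X ^ (α - (1 + θ) / 2) / Y ^ (α - (1 + θ) / 2)) ^ (2 * k)) := by ring
        _ ≤ _ := by
          refine mul_le_mul (pow_le_pow_right₀ hl1 (by omega)) ?_ (by positivity) (by positivity)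
          linarith
  · intro j σ hj hσ G hG hb
    by_cases hGe : G = ∅
    · subst hGe; simp only [card_empty, Nat.cast_zero]; positivity
    obtain ⟨x₀, hx₀⟩ := nonempty_iff_ne_empty.2 hGe
    have hNX : X ≤ 2 ^ j * X := le_mul_of_one_le_left hX0.le (one_le_pow₀ (by norm_num))
    have hσ0 : 0 ≤ σ := by rcases hσ with rfl | rfl <;> linarith
    refine (hQ X (2 ^ j * X) Y α σ hX hNX (hb x₀ hx₀).1 hYT hα hα1 hσ0 G
      (fun x hx => (hF x (hG hx)).2.2.2.2) (fun x hx y hy => hsep x (hG hx) y (hG hy))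
      fun x hx => (hb x hx).2).trans ?_
    have h1 : Real.log T ^ n₁ * (Y ^ (2 - 2 * α) + T * X ^ (-(k * (4 * α - 3 - θ)))) ≤
        Real.log T ^ (n₁ + n₂ + n₃ + 4 * m) * (Y ^ (2 - 2 * α) + T * X ^ (-(k * (4 * α - 3 - θ))) +
        T * (X ^ (α - (1 + θ) / 2) / Y ^ (α - (1 + θ) / 2)) ^ (2 * k)) :=
      mul_le_mul (pow_le_pow_right₀ hl1 (by omega)) (by linarith) (by positivity) (by positivity)
    have h2 : 0 ≤ Real.log T ^ (n₁ + n₂ + n₃ + 4 * m) * (Y ^ (2 - 2 * α) + T * X ^ (-(k * (4 * α - 3 - θ))) +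
        T * (X ^ (α - (1 + θ) / 2) / Y ^ (α - (1 + θ) / 2)) ^ (2 * k)) := by positivity
    linarith

/-- Zeros are counted, up to logarithms, by well-separated zeros away from the real axis. -/
lemma exists_card_le_of_separated (h : S.WellBehaved θ A Z) :
    ∃ n : ℕ, ∀ᶠ T : ℝ in atTop, ∀ α M : ℝ, (1 + θ) / 2 ≤ α → 0 ≤ M →
      (∀ F : Finset ℂ,
        (∀ x ∈ F, Z x = 0 ∧ α ≤ x.re ∧ x.re ≤ 1 ∧ 2 * Real.log T ^ 3 ≤ |x.im| ∧ |x.im| ≤ T) →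
        (∀ x ∈ F, ∀ y ∈ F, x ≠ y → 4 * Real.log T ^ 3 ≤ |x.im - y.im|) → (F.card : ℝ) ≤ M) →
      ∀ F : Finset ℂ, (∀ x ∈ F, Z x = 0 ∧ α ≤ x.re ∧ |x.im| ≤ T) →
        (F.card : ℝ) ≤ Real.log T ^ n * (M + 1) := by
  obtain ⟨c, hc⟩ := exists_wide_window_count h (half_add_mem h).1 (half_add_mem h).2.1 4
  refine ⟨c + 1, ?_⟩
  filter_upwards [hc, eventually_log_ge 4, eventually_gt_atTop 0] with T hw hl hT α M hα hM hsep F hF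
  classical
  have hl0 : 0 < Real.log T := by linarith
  have hl3 : 0 < Real.log T ^ 3 := by positivity
  have hl4 : 4 * Real.log T ^ 3 ≤ Real.log T ^ 4 := by rw [pow_succ _ 3]; nlinarith
  have hlc : 1 ≤ Real.log T ^ c := one_le_pow₀ (by linarith)
  have h1 : ((F.filter (· = 1)).card : ℝ) ≤ 1 := by
    exact_mod_cast card_le_one.2 fun a ha b hb => by
      rw [(mem_filter.1 ha).2, (mem_filter.1 hb).2]
  have h2 : ((F.filter (fun x => x ≠ 1 ∧ |x.im| < 2 * Real.log T ^ 3)).card : ℝ) ≤ Real.log T ^ c := by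
    refine hw 0 (by simpa using hT.le) _ fun z hz => ?_
    obtain ⟨hzF, hz1, hz2⟩ := mem_filter.1 hz
    refine ⟨(hF z hzF).1, hz1, hα.trans (hF z hzF).2.1, ?_⟩
    rw [sub_zero]; linarith
  have h3 : ((F.filter (fun x => x ≠ 1 ∧ ¬|x.im| < 2 * Real.log T ^ 3)).card : ℝ) ≤ M * Real.log T ^ c := by
    obtain ⟨R, hRF, hR, hcard⟩ := exists_separated_card_le
      (F.filter (fun x => x ≠ 1 ∧ ¬|x.im| < 2 * Real.log T ^ 3)) (fun x => x.im)
      (D := 4 * Real.log T ^ 3) (B := Real.log T ^ c) (by positivity) (fun y hy G hG hGD => by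
        refine hw y.im (hF y (mem_filter.1 hy).1).2.2 G fun z hz => ?_
        obtain ⟨hzF, hz1, hz2⟩ := mem_filter.1 (hG hz)
        exact ⟨(hF z hzF).1, hz1, hα.trans (hF z hzF).2.1, (hGD z hz).trans hl4⟩)
    refine hcard.trans (mul_le_mul_of_nonneg_right (hsep R (fun x hx => ?_) hR) (by positivity))
    obtain ⟨hxF, hx1, hx2⟩ := mem_filter.1 (hRF hx)
    obtain ⟨hz, hxα, hxT⟩ := hF x hxF
    refine ⟨hz, hxα, ?_, not_lt.1 hx2, hxT⟩
    by_contra! hre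
    exact zeta_ne_zero h hre hz
  have hsplit : F.card = (F.filter (· = 1)).card +
      ((F.filter (fun x => x ≠ 1 ∧ |x.im| < 2 * Real.log T ^ 3)).card +
        (F.filter (fun x => x ≠ 1 ∧ ¬|x.im| < 2 * Real.log T ^ 3)).card) := by
    rw [← card_filter_add_card_filter_not (s := F) (· = 1),
      ← card_filter_add_card_filter_not (s := F.filter (fun x => ¬x = 1)) (fun x => |x.im| < 2 * Real.log T ^ 3),
      filter_filter, filter_filter]
  rw [hsplit]
  push_cast
  calc _ ≤ 1 + (Real.log T ^ c + M * Real.log T ^ c) := by gcongr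
    _ ≤ Real.log T ^ c * (4 * (M + 1)) := by nlinarith
    _ ≤ Real.log T ^ c * (Real.log T * (M + 1)) := by gcongr
    _ = _ := by ring

lemma card_le_of_separated {T D : ℝ} (hT : 0 ≤ T) (hD : 2 ≤ D) (F : Finset ℂ) (hF : ∀ x ∈ F, |x.im| ≤ T)
    (hsep : ∀ x ∈ F, ∀ y ∈ F, x ≠ y → D ≤ |x.im - y.im|) : (F.card : ℝ) ≤ 2 * (T + 1) := by
  have := card_windows_le (g := fun _ => 1) continuous_const (fun _ => zero_le_one) (L := 1) (V := 2) (p := 1)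
    one_pos two_pos le_rfl F (fun x => x.im) (fun x hx y hy hxy => by linarith [hsep x hx y hy hxy])
    (T := T + 1) (fun x hx => by linarith [hF x hx]) (by linarith)
    (fun x hx => by rw [intervalIntegral.integral_const, smul_eq_mul]; linarith)
  refine this.trans (le_of_eq ?_)
  simp only [sub_self, Real.rpow_zero, Real.one_rpow, intervalIntegral.integral_const, smul_eq_mul,
    Real.rpow_neg_one]
  ring

lemma zeroCount_le {α T K : ℝ} (hK : 0 ≤ K)
    (hF : ∀ F : Finset ℂ, (∀ x ∈ F, Z x = 0 ∧ α ≤ x.re ∧ |x.im| ≤ T) → (F.card : ℝ) ≤ K) :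
    (zeroCount Z α T : ℝ) ≤ K := by
  unfold zeroCount
  rcases Set.finite_or_infinite {ρ : ℂ | Z ρ = 0 ∧ α ≤ ρ.re ∧ |ρ.im| ≤ T} with hfin | hinf
  · rw [Set.ncard_eq_toFinset_card _ hfin]
    exact hF _ fun x hx => by simpa using hx
  · rw [hinf.ncard]; simpa using hK

/-- Passage from large heights to all heights. -/
lemma exists_zeroCount_le_of_eventually (h : S.WellBehaved θ A Z) {P : ℝ → Prop} {E : ℝ → ℝ}
    (hP : ∀ α, P α → (1 + θ) / 2 ≤ α) (hE : ∀ α, P α → α ≤ 1 → 0 ≤ E α)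
    (hev : ∃ n : ℕ, ∀ᶠ T : ℝ in atTop, ∀ α, P α → α ≤ 1 → ∀ F : Finset ℂ,
      (∀ x ∈ F, Z x = 0 ∧ α ≤ x.re ∧ |x.im| ≤ T) → (F.card : ℝ) ≤ T ^ E α * Real.log T ^ n) :
    ∃ n : ℕ, ∀ m, n ≤ m → ∃ C : ℝ, 0 ≤ C ∧ ∀ α T : ℝ, P α → 2 ≤ T →
      (zeroCount Z α T : ℝ) ≤ C * T ^ E α * Real.log T ^ m := by
  obtain ⟨n, hn⟩ := hev
  obtain ⟨n₀, hn₀⟩ := exists_card_le_of_separated h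
  obtain ⟨T₀, hT₀⟩ := eventually_atTop.1 ((hn.and hn₀).and ((eventually_log_ge 1).and (eventually_ge_atTop 2)))
  obtain ⟨⟨-, hb⟩, hl₀, hT₀2⟩ := hT₀ T₀ le_rfl
  have hl30 : 1 ≤ Real.log T₀ ^ 3 := one_le_pow₀ hl₀
  have hK := hb _ (2 * (T₀ + 1)) le_rfl (by linarith) fun F hF hsep =>
    card_le_of_separated (by linarith) (by linarith : 2 ≤ 4 * Real.log T₀ ^ 3) F
      (fun x hx => (hF x hx).2.2.2.2) hsep
  have hK0 : 0 ≤ Real.log T₀ ^ n₀ * (2 * (T₀ + 1) + 1) := by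
    have : 0 ≤ 2 * (T₀ + 1) + 1 := by linarith
    positivity
  generalize Real.log T₀ ^ n₀ * (2 * (T₀ + 1) + 1) = K at hK hK0
  refine ⟨n, fun m hm => ⟨K / Real.log 2 ^ m + 1, ?_, fun α T hα hT => ?_⟩⟩
  · have := Real.log_pos one_lt_two
    positivity
  have hl2 := Real.log_pos one_lt_two
  have hlT : Real.log 2 ≤ Real.log T := Real.log_le_log (by norm_num) hT
  have hlT0 : 0 < Real.log T := by linarith
  have hT0 : 0 < T := by linarith
  refine zeroCount_le (by positivity) fun F hF => ?_
  rcases lt_or_ge 1 α with h1 | h1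
  · have : F = ∅ := Finset.eq_empty_of_forall_notMem fun x hx =>
      zeta_ne_zero h (h1.trans_le (hF x hx).2.1) (hF x hx).1
    subst this
    simp only [card_empty, Nat.cast_zero]; positivity
  rcases le_total T₀ T with h2 | h2
  · obtain ⟨⟨hb, -⟩, hl, -⟩ := hT₀ T h2
    have hE0 : 0 < T ^ E α := by positivity
    calc (F.card : ℝ) ≤ T ^ E α * Real.log T ^ n := hb α hα h1 F hF
      _ ≤ T ^ E α * Real.log T ^ m := by gcongr
      _ = 1 * T ^ E α * Real.log T ^ m := by ring
      _ ≤ _ := by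
        gcongr
        have : 0 ≤ K / Real.log 2 ^ m := by positivity
        linarith
  · have h3 : 1 ≤ T ^ E α := Real.one_le_rpow (by linarith) (hE α hα h1)
    calc (F.card : ℝ) ≤ K := hK F fun x hx => ⟨(hF x hx).1, (hP α hα).trans (hF x hx).2.1,
          (hF x hx).2.2.trans h2⟩
      _ = K / Real.log 2 ^ m * 1 * Real.log 2 ^ m := by field_simp
      _ ≤ K / Real.log 2 ^ m * T ^ E α * Real.log T ^ m := by gcongr
      _ ≤ _ := by gcongr; linarith

lemma exists_density_first (h : S.WellBehaved θ A Z) {k ck : ℝ} (hk : 1 ≤ k)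
    (hmom : ∃ C : ℝ, ∀ T : ℝ, 2 ≤ T →
      (1 / T) * (∫ t in (0:ℝ)..T, ‖Z ((((1 + θ) / 2 : ℝ) : ℂ) + Complex.I * (t : ℂ))‖ ^ (2 * k)) ≤
        C * Real.log T ^ ck) :
    ∃ n : ℕ, ∀ᶠ T : ℝ in atTop, ∀ α : ℝ, (1 + θ) / 2 ≤ α → α ≤ 1 → ∀ F : Finset ℂ,
      (∀ x ∈ F, Z x = 0 ∧ α ≤ x.re ∧ |x.im| ≤ T) →
      (F.card : ℝ) ≤ T ^ (2 * (k + 1) * (1 - α) / (2 * (1 - α) + k * (1 - θ))) * Real.log T ^ n := by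
  have hθ := h.lt_one
  have hθ0 := h.nonneg
  have hd : 0 < 1 - θ := by linarith
  have hkd : 0 < k * (1 - θ) := by positivity
  obtain ⟨n₁, hn₁⟩ := exists_card_separated_zeros_le h hk hmom (B := (k + 1) / (k * (1 - θ))) (by positivity)
  obtain ⟨n₀, hn₀⟩ := exists_card_le_of_separated h
  refine ⟨n₀ + (n₁ + 14), ?_⟩
  filter_upwards [hn₁, hn₀, eventually_log_ge 5, eventually_ge_atTop 2] with T h1 h0 hl hT α hα hα1 F hF
  have hT0 : 0 < T := by linarith
  have hl0 : 0 < Real.log T := by linarith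
  have hl1 : 1 ≤ Real.log T := by linarith
  have hl3 : 1 ≤ Real.log T ^ 3 := one_le_pow₀ hl1
  have hD : 0 < 2 * (1 - α) + k * (1 - θ) := by linarith
  have hE0 : 0 ≤ 2 * (k + 1) * (1 - α) / (2 * (1 - α) + k * (1 - θ)) :=
    div_nonneg (mul_nonneg (by linarith) (by linarith)) hD.le
  have hTE : 1 ≤ T ^ (2 * (k + 1) * (1 - α) / (2 * (1 - α) + k * (1 - θ))) :=
    Real.one_le_rpow (by linarith) hE0
  suffices hs : ∀ F : Finset ℂ,
      (∀ x ∈ F, Z x = 0 ∧ α ≤ x.re ∧ x.re ≤ 1 ∧ 2 * Real.log T ^ 3 ≤ |x.im| ∧ |x.im| ≤ T) →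
      (∀ x ∈ F, ∀ y ∈ F, x ≠ y → 4 * Real.log T ^ 3 ≤ |x.im - y.im|) →
      (F.card : ℝ) ≤ Real.log T ^ (n₁ + 12) *
        (4 * T ^ (2 * (k + 1) * (1 - α) / (2 * (1 - α) + k * (1 - θ)))) by
    refine (h0 α _ hα (by positivity) hs F hF).trans ?_
    rw [pow_add _ n₀, mul_left_comm (T ^ _)]
    refine mul_le_mul_of_nonneg_left ?_ (by positivity)
    have hp : 1 ≤ Real.log T ^ (n₁ + 12) := one_le_pow₀ hl1
    generalize T ^ (2 * (k + 1) * (1 - α) / (2 * (1 - α) + k * (1 - θ))) = t at hTE ⊢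
    rw [show n₁ + 14 = (n₁ + 12) + 2 by ring, pow_add _ (n₁ + 12)]
    generalize Real.log T ^ (n₁ + 12) = q at hp ⊢
    have : 1 ≤ q * t := by nlinarith
    nlinarith [mul_le_mul_of_nonneg_left (by nlinarith : 5 ≤ Real.log T ^ 2) (by linarith : 0 ≤ q * t)]
  intro F hF hsep
  by_cases hY : Real.log T ^ 6 ≤ (T ^ ((k + 1) / (2 * (1 - α) + k * (1 - θ)))) ^ (α - (1 + θ) / 2)
  · have hX1 : 1 ≤ T ^ (1 / (1 - θ)) := Real.one_le_rpow (by linarith) (by positivity)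
    have hXY : T ^ (1 / (1 - θ)) ≤ T ^ ((k + 1) / (2 * (1 - α) + k * (1 - θ))) := by
      refine Real.rpow_le_rpow_of_exponent_le (by linarith) ?_
      rw [div_le_div_iff₀ hd hD]; linarith
    have hYT : T ^ ((k + 1) / (2 * (1 - α) + k * (1 - θ))) ≤ T ^ ((k + 1) / (k * (1 - θ))) := by
      refine Real.rpow_le_rpow_of_exponent_le (by linarith) ?_
      gcongr
      linarith
    refine (h1 _ _ α hX1 hXY hYT hY hα hα1 F hF hsep).trans ?_
    refine mul_le_mul (pow_le_pow_right₀ hl1 (by omega)) ?_ (by positivity) (by positivity)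
    have e1 : (T ^ ((k + 1) / (2 * (1 - α) + k * (1 - θ)))) ^ (2 - 2 * α) =
        T ^ (2 * (k + 1) * (1 - α) / (2 * (1 - α) + k * (1 - θ))) := by
      rw [← Real.rpow_mul hT0.le]; congr 1; ring
    have e2 : T * (T ^ (1 / (1 - θ))) ^ (1 + θ - 2 * α) ≤
        T ^ (2 * (k + 1) * (1 - α) / (2 * (1 - α) + k * (1 - θ))) := by
      rw [← Real.rpow_mul hT0.le, mul_comm, ← Real.rpow_add_one hT0.ne']
      refine Real.rpow_le_rpow_of_exponent_le (by linarith) ?_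
      have : 1 / (1 - θ) * (1 + θ - 2 * α) + 1 = 2 * (1 - α) / (1 - θ) := by field_simp; ring
      rw [this, div_le_div_iff₀ hd hD]
      have : 0 ≤ (1 - α) * (1 - θ - 2 * (1 - α)) := mul_nonneg (by linarith) (by linarith)
      nlinarith
    have e3 : (T ^ (1 / (1 - θ))) ^ (1 - θ) = T := by
      rw [← Real.rpow_mul hT0.le, one_div_mul_cancel hd.ne', Real.rpow_one]
    have e4 : T * (T ^ ((k + 1) / (2 * (1 - α) + k * (1 - θ)))) ^ (-((2 * α - 1 - θ) * k / (k + 1))) =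
        T ^ (2 * (k + 1) * (1 - α) / (2 * (1 - α) + k * (1 - θ))) := by
      rw [← Real.rpow_mul hT0.le, mul_comm, ← Real.rpow_add_one hT0.ne']
      congr 1
      have : k + 1 ≠ 0 := by linarith
      field_simp
      ring
    rw [e1, e3, add_mul, e4]
    linarith
  · have hlt := (not_le.1 hY).le
    have hcard := card_le_of_separated hT0.le (by linarith : 2 ≤ 4 * Real.log T ^ 3) F
      (fun x hx => (hF x hx).2.2.2.2) hsep
    have e : T = T ^ (2 * (k + 1) * (1 - α) / (2 * (1 - α) + k * (1 - θ))) *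
        ((T ^ ((k + 1) / (2 * (1 - α) + k * (1 - θ)))) ^ (α - (1 + θ) / 2)) ^ (2 * k / (k + 1)) := by
      rw [← Real.rpow_mul hT0.le, ← Real.rpow_mul hT0.le, ← Real.rpow_add hT0]
      conv_lhs => rw [← Real.rpow_one T]
      congr 1
      have : k + 1 ≠ 0 := by linarith
      field_simp
      ring
    have hp2 : 2 * k / (k + 1) ≤ 2 := by rw [div_le_iff₀ (by linarith)]; linarith
    have h2 : ((T ^ ((k + 1) / (2 * (1 - α) + k * (1 - θ)))) ^ (α - (1 + θ) / 2)) ^ (2 * k / (k + 1)) ≤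
        Real.log T ^ 12 := by
      calc _ ≤ (Real.log T ^ 6) ^ (2 * k / (k + 1)) :=
            Real.rpow_le_rpow (by positivity) hlt (div_nonneg (by linarith) (by linarith))
        _ ≤ (Real.log T ^ 6) ^ (2 : ℝ) :=
            Real.rpow_le_rpow_of_exponent_le (one_le_pow₀ hl1) hp2
        _ = _ := by
            rw [← Real.rpow_natCast, ← Real.rpow_mul hl0.le, ← Real.rpow_natCast]; norm_num
    have h3 : T ≤ T ^ (2 * (k + 1) * (1 - α) / (2 * (1 - α) + k * (1 - θ))) * Real.log T ^ (n₁ + 12) := by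
      calc T = _ := e
        _ ≤ _ := mul_le_mul_of_nonneg_left (h2.trans (pow_le_pow_right₀ hl1 (by omega))) (by positivity)
    linarith

lemma exists_density_second (h : S.WellBehaved θ A Z) {k ck : ℝ} (hk : 1 ≤ k)
    (hmom : ∃ C : ℝ, ∀ T : ℝ, 2 ≤ T →
      (1 / T) * (∫ t in (0:ℝ)..T, ‖Z ((((1 + θ) / 2 : ℝ) : ℂ) + Complex.I * (t : ℂ))‖ ^ (2 * k)) ≤
        C * Real.log T ^ ck) :
    ∃ n : ℕ, ∀ᶠ T : ℝ in atTop, ∀ α : ℝ, (3 + θ) / 4 ≤ α → α ≤ 1 → ∀ F : Finset ℂ,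
      (∀ x ∈ F, Z x = 0 ∧ α ≤ x.re ∧ |x.im| ≤ T) →
      (F.card : ℝ) ≤ T ^ (4 * (3 * α - 2 - θ) * (1 - α) /
        (k * (2 * α - 1 - θ) * (4 * α - 3 - θ) + 4 * (3 * α - 2 - θ) * (1 - α))) * Real.log T ^ n := by
  have hθ := h.lt_one
  have hθ0 := h.nonneg
  have hd : 0 < 1 - θ := by linarith
  obtain ⟨n₁, hn₁⟩ := exists_card_separated_zeros_le_of_large_values h hk hmom (B := 8 / (1 - θ)) (by positivity)
  obtain ⟨n₀, hn₀⟩ := exists_card_le_of_separated h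
  refine ⟨n₀ + (n₁ + 2), ?_⟩
  filter_upwards [hn₁, hn₀, eventually_log_ge 5, eventually_ge_atTop 2,
    eventually_log_pow_le_rpow 6 (b := 1 / (8 * (k + 1))) (by positivity)] with T h1 h0 hl hT hlT α hα hα1 F hF
  have hT0 : 0 < T := by linarith
  have hl0 : 0 < Real.log T := by linarith
  have hl1 : 1 ≤ Real.log T := by linarith
  obtain ⟨D, hD⟩ : ∃ D, D = k * (2 * α - 1 - θ) * (4 * α - 3 - θ) + 4 * (3 * α - 2 - θ) * (1 - α) := ⟨_, rfl⟩
  have p1 : (1 - θ) / 2 ≤ 2 * α - 1 - θ := by linarith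
  have p2 : 0 ≤ 4 * α - 3 - θ := by linarith
  have p3 : (1 - θ) / 4 ≤ 3 * α - 2 - θ := by linarith
  have q1 : 2 * α - 1 - θ ≤ 1 - θ := by linarith
  have q2 : 4 * α - 3 - θ ≤ 1 - θ := by linarith
  have q3 : 3 * α - 2 - θ ≤ 1 - θ := by linarith
  have hDlow : (1 - θ) ^ 2 / 4 ≤ D := by
    have a1 : (1 - θ) / 2 * (4 * α - 3 - θ) ≤ k * (2 * α - 1 - θ) * (4 * α - 3 - θ) := by
      gcongr
      nlinarith
    have a2 : (1 - θ) / 4 * (1 - α) ≤ (3 * α - 2 - θ) * (1 - α) := by gcongr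
    nlinarith
  have hD0 : 0 < D := lt_of_lt_of_le (by positivity) hDlow
  have hDup : D ≤ (k + 1) * (1 - θ) ^ 2 := by
    have a1 : k * (2 * α - 1 - θ) * (4 * α - 3 - θ) ≤ k * (1 - θ) * (1 - θ) := by gcongr
    have a2 : (3 * α - 2 - θ) * (1 - α) ≤ (1 - θ) * ((1 - θ) / 4) := by
      gcongr; linarith
    nlinarith
  rw [← hD]
  have hE0 : 0 ≤ 4 * (3 * α - 2 - θ) * (1 - α) / D :=
    div_nonneg (mul_nonneg (by linarith) (by linarith)) hD0.le
  have hTE : 1 ≤ T ^ (4 * (3 * α - 2 - θ) * (1 - α) / D) := Real.one_le_rpow (by linarith) hE0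
  suffices hs : ∀ F : Finset ℂ,
      (∀ x ∈ F, Z x = 0 ∧ α ≤ x.re ∧ x.re ≤ 1 ∧ 2 * Real.log T ^ 3 ≤ |x.im| ∧ |x.im| ≤ T) →
      (∀ x ∈ F, ∀ y ∈ F, x ≠ y → 4 * Real.log T ^ 3 ≤ |x.im - y.im|) →
      (F.card : ℝ) ≤ Real.log T ^ n₁ * (3 * T ^ (4 * (3 * α - 2 - θ) * (1 - α) / D)) by
    refine (h0 α _ (by linarith) (by positivity) hs F hF).trans ?_
    rw [pow_add _ n₀, mul_left_comm (T ^ _)]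
    refine mul_le_mul_of_nonneg_left ?_ (by positivity)
    have hp : 1 ≤ Real.log T ^ n₁ := one_le_pow₀ hl1
    generalize T ^ (4 * (3 * α - 2 - θ) * (1 - α) / D) = t at hTE ⊢
    rw [pow_add _ n₁]
    generalize Real.log T ^ n₁ = q at hp ⊢
    have : 1 ≤ q * t := by nlinarith
    nlinarith [mul_le_mul_of_nonneg_left (by nlinarith : 5 ≤ Real.log T ^ 2) (by linarith : 0 ≤ q * t)]
  intro F hF hsep
  have hX1 : 1 ≤ T ^ ((2 * α - 1 - θ) / D) :=
    Real.one_le_rpow (by linarith) (div_nonneg (by linarith) hD0.le)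
  have hXY : T ^ ((2 * α - 1 - θ) / D) ≤ T ^ (2 * (3 * α - 2 - θ) / D) := by
    refine Real.rpow_le_rpow_of_exponent_le (by linarith) ?_
    gcongr
    linarith
  have hYT : T ^ (2 * (3 * α - 2 - θ) / D) ≤ T ^ (8 / (1 - θ)) := by
    refine Real.rpow_le_rpow_of_exponent_le (by linarith) ?_
    rw [div_le_div_iff₀ hD0 hd]
    nlinarith
  have hY : Real.log T ^ 6 ≤ (T ^ (2 * (3 * α - 2 - θ) / D)) ^ (α - (1 + θ) / 2) := by
    refine hlT.trans ?_
    rw [← Real.rpow_mul hT0.le]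
    refine Real.rpow_le_rpow_of_exponent_le (by linarith) ?_
    have e : 2 * (3 * α - 2 - θ) / D * (α - (1 + θ) / 2) = (3 * α - 2 - θ) * (2 * α - 1 - θ) / D := by ring
    rw [e, div_le_div_iff₀ (by positivity) hD0]
    have a : (1 - θ) / 4 * ((1 - θ) / 2) ≤ (3 * α - 2 - θ) * (2 * α - 1 - θ) := by gcongr; linarith
    nlinarith
  refine (h1 _ _ α hX1 hXY hYT hY hα hα1 F hF hsep).trans ?_
  refine mul_le_mul_of_nonneg_left ?_ (by positivity)
  have e1 : (T ^ (2 * (3 * α - 2 - θ) / D)) ^ (2 - 2 * α) = T ^ (4 * (3 * α - 2 - θ) * (1 - α) / D) := by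
    rw [← Real.rpow_mul hT0.le]; congr 1; ring
  have e0 : 1 + (-(k * (2 * α - 1 - θ) * (4 * α - 3 - θ))) / D = 4 * (3 * α - 2 - θ) * (1 - α) / D := by
    field_simp
    rw [hD]; ring
  have e2 : T * (T ^ ((2 * α - 1 - θ) / D)) ^ (-(k * (4 * α - 3 - θ))) =
      T ^ (4 * (3 * α - 2 - θ) * (1 - α) / D) := by
    rw [← e0, Real.rpow_add hT0, Real.rpow_one, ← Real.rpow_mul hT0.le]
    congr 2; ring
  have e3 : T * ((T ^ ((2 * α - 1 - θ) / D)) ^ (α - (1 + θ) / 2) /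
      (T ^ (2 * (3 * α - 2 - θ) / D)) ^ (α - (1 + θ) / 2)) ^ (2 * k) =
      T ^ (4 * (3 * α - 2 - θ) * (1 - α) / D) := by
    rw [← e0, Real.rpow_add hT0, Real.rpow_one, ← Real.rpow_mul hT0.le, ← Real.rpow_mul hT0.le,
      ← Real.rpow_sub hT0, ← Real.rpow_mul hT0.le]
    congr 2; ring
  rw [e1, e2, e3]
  linarith

end BeurlingSystem

/-- Theorem 5.1: zero-density estimates conditional on `2k`-th moment bounds of
`ζ_𝒫` (and of `ζ'_𝒫`, which may be omitted when `2k` is an integer) on the line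
`Re s = (1+θ)/2`. -/
theorem zero_density_moments
    (θ : ℝ) (hθ0 : 0 ≤ θ) (hθ1 : θ < 1) (S : BeurlingSystem)
    (A : ℝ) (hA : 0 < A)
    (hwb : (fun x : ℝ => (S.Nint x : ℝ) - A * x) =O[atTop] fun x : ℝ => x ^ θ)
    (Z : ℂ → ℂ) (hZ : S.IsZeta θ A Z)
    (k : ℝ) (hk : 1 ≤ k) (ck : ℝ)
    (hmom : ∃ C : ℝ, ∀ T : ℝ, 2 ≤ T →
      (1 / T) * (∫ t in (0:ℝ)..T,
          ‖Z ((((1 + θ) / 2 : ℝ) : ℂ) + Complex.I * (t : ℂ))‖ ^ (2 * k))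
        ≤ C * Real.log T ^ ck)
    (hmom' : (∃ C : ℝ, ∀ T : ℝ, 2 ≤ T →
        (1 / T) * (∫ t in (0:ℝ)..T,
            ‖deriv Z ((((1 + θ) / 2 : ℝ) : ℂ) + Complex.I * (t : ℂ))‖ ^ (2 * k))
          ≤ C * Real.log T ^ ck)
      ∨ (∃ m : ℕ, (m : ℝ) = 2 * k)) :
    ∃ c C : ℝ,
      (∀ α T : ℝ, (1 + θ) / 2 ≤ α → 2 ≤ T →
        (zeroCount Z α T : ℝ)
          ≤ C * T ^ (2 * (k + 1) * (1 - α) / (2 * (1 - α) + k * (1 - θ)))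
            * Real.log T ^ c) ∧
      (∀ α T : ℝ, (3 * k - 1 + (k - 1) * θ) / (4 * k - 2) ≤ α → 2 ≤ T →
        (zeroCount Z α T : ℝ)
          ≤ C * T ^ (4 * (3 * α - 2 - θ) * (1 - α) /
              (k * (2 * α - 1 - θ) * (4 * α - 3 - θ) + 4 * (3 * α - 2 - θ) * (1 - α)))
            * Real.log T ^ c) := by
  have h : S.WellBehaved θ A Z := ⟨hθ0, hθ1, hA, hwb, hZ⟩
  have hd : 0 < 1 - θ := by linarith
  have hcond : ∀ α : ℝ, (3 * k - 1 + (k - 1) * θ) / (4 * k - 2) ≤ α → (3 + θ) / 4 ≤ α := by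
    intro α hα
    refine le_trans ?_ hα
    rw [div_le_div_iff₀ (by norm_num) (by linarith)]
    linarith
  obtain ⟨n₁, h₁⟩ := BeurlingSystem.exists_zeroCount_le_of_eventually h
    (P := fun α => (1 + θ) / 2 ≤ α)
    (E := fun α => 2 * (k + 1) * (1 - α) / (2 * (1 - α) + k * (1 - θ)))
    (fun α hα => hα)
    (fun α _ hα1 => div_nonneg (mul_nonneg (by linarith) (by linarith))
      (add_nonneg (by linarith) (mul_nonneg (by linarith) hd.le)))
    (BeurlingSystem.exists_density_first h hk hmom)
  obtain ⟨n₂, h₂⟩ := BeurlingSystem.exists_zeroCount_le_of_eventually h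
    (P := fun α => (3 * k - 1 + (k - 1) * θ) / (4 * k - 2) ≤ α)
    (E := fun α => 4 * (3 * α - 2 - θ) * (1 - α) /
      (k * (2 * α - 1 - θ) * (4 * α - 3 - θ) + 4 * (3 * α - 2 - θ) * (1 - α)))
    (fun α hα => by have := hcond α hα; linarith)
    (fun α hα hα1 => by
      have hα' := hcond α hα
      have hn : 0 ≤ 4 * (3 * α - 2 - θ) * (1 - α) := mul_nonneg (by linarith) (by linarith)
      exact div_nonneg hn (add_nonneg (mul_nonneg (mul_nonneg (by linarith) (by linarith))
        (by linarith)) hn))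
    (by
      obtain ⟨n, hn⟩ := BeurlingSystem.exists_density_second h hk hmom
      exact ⟨n, hn.mono fun T hT α hα => hT α (hcond α hα)⟩)
  obtain ⟨C₁, -, h₁⟩ := h₁ (max n₁ n₂) (le_max_left _ _)
  obtain ⟨C₂, -, h₂⟩ := h₂ (max n₁ n₂) (le_max_right _ _)
  refine ⟨(max n₁ n₂ : ℕ), max C₁ C₂, fun α T hα hT => ?_, fun α T hα hT => ?_⟩
  · have hl : 0 ≤ Real.log T := Real.log_nonneg (by linarith)
    rw [Real.rpow_natCast]
    refine (h₁ α T hα hT).trans ?_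
    gcongr
    exact le_max_left _ _
  · have hl : 0 ≤ Real.log T := Real.log_nonneg (by linarith)
    rw [Real.rpow_natCast]
    refine (h₂ α T hα hT).trans ?_
    gcongr
    exact le_max_right _ _
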